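/- There is an absolute constant C such that for every T > 0 there exists a convex, continuously differentiable function a : ℝ² × ℝ² → ℝ with |∇a(x₁,x₂)| ≤ 100 for all (x₁,x₂), such that for every s ∈ (0,1), every N ≥ 1, and every solution u of the defocusing cubic NLS on [0,T] × ℝ², one has ∫₀^T ∫_{ℝ²} |I_N u(t,x)|⁴ dx dt ≤ C T^{1/3} ( sup_{t∈[0,T]} ‖I_N u(t,·)‖_{Ḣ¹(ℝ²)} ‖I_N u(t,·)‖_{L²(ℝ²)}³ + ‖u(0,·)‖_{L²(ℝ²)}⁴ ) + C T^{1/3} | ∫₀^T ∫_{ℝ²×ℝ²} ∇a(x₁,x₂) · { Ñ_bad(t,·,·), I_N u(t,x₁) I_N u(t,x₂) }_p (x₁,x₂) dx₁ dx₂ dt |. -/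

import Mathlib

open MeasureTheory Real Complex
open scoped FourierTransform ENNReal ContDiff

noncomputable section

/-- The `j`-th partial derivative of a function on `EuclideanSpace ℝ (Fin n)`. -/
def pd {n : ℕ} {F : Type*} [NormedAddCommGroup F] [NormedSpace ℝ F]
    (j : Fin n) (f : EuclideanSpace ℝ (Fin n) → F) (x : EuclideanSpace ℝ (Fin n)) : F :=
  fderiv ℝ f x (EuclideanSpace.single j 1)

/-- The Laplacian. -/
def lap {n : ℕ} {F : Type*} [NormedAddCommGroup F] [NormedSpace ℝ F]
    (f : EuclideanSpace ℝ (Fin n) → F) (x : EuclideanSpace ℝ (Fin n)) : F :=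
  ∑ j, pd j (pd j f) x

/-- `f` coincides with a (complex-valued) Schwartz function. -/
def IsSchwartz {n : ℕ} (f : EuclideanSpace ℝ (Fin n) → ℂ) : Prop :=
  ∃ g : SchwartzMap (EuclideanSpace ℝ (Fin n)) ℂ, ⇑g = f

/-- `f` coincides with a (real-valued) Schwartz function. -/
def IsSchwartzR {n : ℕ} (f : EuclideanSpace ℝ (Fin n) → ℝ) : Prop :=
  ∃ g : SchwartzMap (EuclideanSpace ℝ (Fin n)) ℝ, ⇑g = f

/-- A (smooth, spatially Schwartz) solution of the defocusing cubic NLS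
`i ∂ₜ u + Δ u = |u|² u` on `[0,T] × ℝⁿ`. -/
def IsNLSSolution (n : ℕ) (T : ℝ) (u : ℝ → EuclideanSpace ℝ (Fin n) → ℂ) : Prop :=
  ContDiff ℝ ∞ (Function.uncurry u) ∧
  (∀ t ∈ Set.Icc (0:ℝ) T, IsSchwartz (u t)) ∧
  (∀ t ∈ Set.Icc (0:ℝ) T, ∀ x, Complex.I * deriv (fun s => u s x) t + lap (u t) x
      = (‖u t x‖ : ℂ)^2 * u t x)

/-- Inhomogeneous Sobolev norm via the Fourier transform. -/
def HsNorm {n : ℕ} (σ : ℝ) (f : EuclideanSpace ℝ (Fin n) → ℂ) : ℝ :=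
  (∫ ξ, (1 + ‖ξ‖) ^ (2 * σ) * ‖𝓕 f ξ‖ ^ 2) ^ ((1:ℝ)/2)

/-- Homogeneous Sobolev norm via the Fourier transform. -/
def HdotNorm {n : ℕ} (σ : ℝ) (f : EuclideanSpace ℝ (Fin n) → ℂ) : ℝ :=
  (∫ ξ, ‖ξ‖ ^ (2 * σ) * ‖𝓕 f ξ‖ ^ 2) ^ ((1:ℝ)/2)

/-- The Fourier multiplier operator with (real) symbol `m`. -/
def fourierMult {n : ℕ} (m : EuclideanSpace ℝ (Fin n) → ℝ) (f : EuclideanSpace ℝ (Fin n) → ℂ) :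
    EuclideanSpace ℝ (Fin n) → ℂ :=
  𝓕⁻ (fun ξ => (m ξ : ℂ) * 𝓕 f ξ)

/-- The standing hypotheses on the radial profile `φ` of the symbol of the smoothing
operator `I = I_N`, with derivative-bound constants `Ck` (independent of `N`). -/
structure IMultiplier (s N : ℝ) (Ck : ℕ → ℝ) (φ : ℝ → ℝ) : Prop where
  contDiff : ContDiffOn ℝ ∞ φ (Set.Ioi 0)
  pos : ∀ r > (0:ℝ), 0 < φ r
  le_one : ∀ r > (0:ℝ), φ r ≤ 1
  anti : AntitoneOn φ (Set.Ioi 0)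
  eq_one : ∀ r : ℝ, 0 < r → r ≤ N → φ r = 1
  eq_pow : ∀ r : ℝ, 2 * N ≤ r → φ r = (r / N) ^ (s - 1)
  mono_mul : MonotoneOn (fun r => r * φ r) (Set.Ioi 0)
  deriv_bound : ∀ k : ℕ, 1 ≤ k → ∀ r > (0:ℝ), |iteratedDeriv k φ r| ≤ Ck k * φ r * r ^ (-(k:ℝ))

/-- The smoothing operator `I = I_N`, a Fourier multiplier with symbol `φ (|ξ|)`. -/
def Iop {n : ℕ} (φ : ℝ → ℝ) (f : EuclideanSpace ℝ (Fin n) → ℂ) : EuclideanSpace ℝ (Fin n) → ℂ :=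
  fourierMult (fun ξ => φ ‖ξ‖) f

/-- The operator `⟨D⟩ I_N`, a Fourier multiplier with symbol `(1 + |ξ|) φ (|ξ|)`. -/
def DIop {n : ℕ} (φ : ℝ → ℝ) (f : EuclideanSpace ℝ (Fin n) → ℂ) : EuclideanSpace ℝ (Fin n) → ℂ :=
  fourierMult (fun ξ => (1 + ‖ξ‖) * φ ‖ξ‖) f

/-- Mixed space-time norm `‖v‖_{L^q_{[0,T]} L^r_x}` (with values in `ℝ≥0∞`). -/
def mixNorm {α : Type*} [MeasureSpace α] {F : Type*} [NormedAddCommGroup F]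
    (T : ℝ) (q r : ℝ≥0∞) (v : ℝ → α → F) : ℝ≥0∞ :=
  eLpNorm (fun t => (eLpNorm (v t) r volume).toReal) q (volume.restrict (Set.Ioc 0 T))

/-- An admissible pair in `ℝ²`: `1/q + 1/r = 1/2` and `2 < q ≤ ∞`. -/
def Admissible (q r : ℝ≥0∞) : Prop := 1/q + 1/r = 1/2 ∧ 2 < q

/-- The `L²` norm. -/
def L2Norm {n : ℕ} (f : EuclideanSpace ℝ (Fin n) → ℂ) : ℝ :=
  (∫ x, ‖f x‖ ^ 2) ^ ((1:ℝ)/2)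

/-- The `L²` norm of the (spatial) gradient. -/
def gradL2Norm {n : ℕ} (f : EuclideanSpace ℝ (Fin n) → ℂ) : ℝ :=
  (∫ x, ∑ j, ‖pd j f x‖ ^ 2) ^ ((1:ℝ)/2)

/-- Space-time `L⁴_{[0,T]} L⁴_x` norm (real-valued). -/
def L4L4Norm {n : ℕ} (T : ℝ) (v : ℝ → EuclideanSpace ℝ (Fin n) → ℂ) : ℝ :=
  (∫ t in Set.Ioc (0:ℝ) T, ∫ x, ‖v t x‖ ^ 4) ^ ((1:ℝ)/4)

/-- The modified energy `E(v) = ½∫|∇v|² + ¼∫|v|⁴`. -/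
def energy {n : ℕ} (v : EuclideanSpace ℝ (Fin n) → ℂ) : ℝ :=
  (1/2) * (∫ x, ∑ j, ‖pd j v x‖ ^ 2) + (1/4) * ∫ x, ‖v x‖ ^ 4

/-- The Morawetz action `M_a(t) = 2 ∫ ∇a · Im (ū ∇u) dx`. -/
def morAction {n : ℕ} (a : EuclideanSpace ℝ (Fin n) → ℝ)
    (u : ℝ → EuclideanSpace ℝ (Fin n) → ℂ) (t : ℝ) : ℝ :=
  2 * ∫ x, ∑ j, pd j a x * ((starRingEnd ℂ) (u t x) * pd j (u t) x).im

/-- All derivatives of `a` grow at most polynomially. -/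
def PolyGrowth {n : ℕ} (a : EuclideanSpace ℝ (Fin n) → ℝ) : Prop :=
  ∀ k : ℕ, ∃ C d : ℝ, ∀ x, ‖iteratedFDeriv ℝ k a x‖ ≤ C * (1 + ‖x‖) ^ d

/-- The cubic nonlinearity `|u|²u`. -/
def cubicN {n : ℕ} (u : ℝ → EuclideanSpace ℝ (Fin n) → ℂ) (t : ℝ)
    (x : EuclideanSpace ℝ (Fin n)) : ℂ :=
  ((‖u t x‖ ^ 2 : ℝ) : ℂ) * u t x

/-- The commutator `W = I_N(|u|²u) - |I_N u|² I_N u`. -/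
def Wcomm {n : ℕ} (φ : ℝ → ℝ) (u : ℝ → EuclideanSpace ℝ (Fin n) → ℂ) (t : ℝ)
    (x : EuclideanSpace ℝ (Fin n)) : ℂ :=
  Iop φ (cubicN u t) x - ((‖Iop φ (u t) x‖ ^ 2 : ℝ) : ℂ) * Iop φ (u t) x

/-- The bad part `Ñ_bad` of the nonlinearity on `ℝ² × ℝ²`. -/
def Nbad (φ : ℝ → ℝ) (u : ℝ → EuclideanSpace ℝ (Fin 2) → ℂ) (t : ℝ)
    (p : EuclideanSpace ℝ (Fin 2) × EuclideanSpace ℝ (Fin 2)) : ℂ :=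
  Wcomm φ u t p.1 * Iop φ (u t) p.2 + Wcomm φ u t p.2 * Iop φ (u t) p.1

/-- The tensor product `I_N u (t,x₁) · I_N u (t,x₂)`. -/
def tensIu (φ : ℝ → ℝ) (u : ℝ → EuclideanSpace ℝ (Fin 2) → ℂ) (t : ℝ)
    (p : EuclideanSpace ℝ (Fin 2) × EuclideanSpace ℝ (Fin 2)) : ℂ :=
  Iop φ (u t) p.1 * Iop φ (u t) p.2

/-- The component of the momentum bracket `{F, G}_p` in the direction `v`. -/
def bracketDir (F G : EuclideanSpace ℝ (Fin 2) × EuclideanSpace ℝ (Fin 2) → ℂ)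
    (p v : EuclideanSpace ℝ (Fin 2) × EuclideanSpace ℝ (Fin 2)) : ℝ :=
  (F p * (starRingEnd ℂ) (fderiv ℝ G p v) - G p * (starRingEnd ℂ) (fderiv ℝ F p v)).re

/-- The error density `∇a · { Ñ_bad , I_N u ⊗ I_N u }_p (x₁, x₂)`. -/
def errDensity (a : EuclideanSpace ℝ (Fin 2) × EuclideanSpace ℝ (Fin 2) → ℝ)
    (φ : ℝ → ℝ) (u : ℝ → EuclideanSpace ℝ (Fin 2) → ℂ) (t : ℝ)
    (p : EuclideanSpace ℝ (Fin 2) × EuclideanSpace ℝ (Fin 2)) : ℝ :=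
  (∑ j : Fin 2, fderiv ℝ a p (EuclideanSpace.single j 1, 0) *
      bracketDir (Nbad φ u t) (tensIu φ u t) p (EuclideanSpace.single j 1, 0))
  + ∑ j : Fin 2, fderiv ℝ a p (0, EuclideanSpace.single j 1) *
      bracketDir (Nbad φ u t) (tensIu φ u t) p (0, EuclideanSpace.single j 1)

/-- The Euclidean plane. -/
abbrev Plane := EuclideanSpace ℝ (Fin 2)

namespace IsSchwartz

variable {n : ℕ} {f g : EuclideanSpace ℝ (Fin n) → ℂ}

theorem mul (hf : IsSchwartz f) (hg : IsSchwartz g) : IsSchwartz (fun x => f x * g x) := by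
  obtain ⟨F, rfl⟩ := hf
  obtain ⟨G, rfl⟩ := hg
  exact ⟨SchwartzMap.pairing (ContinuousLinearMap.mul ℂ ℂ) F G, by ext x; simp⟩

theorem conj (hf : IsSchwartz f) : IsSchwartz (fun x => (starRingEnd ℂ) (f x)) := by
  obtain ⟨F, rfl⟩ := hf
  exact ⟨SchwartzMap.postcompCLM (𝕜 := ℝ) (Complex.conjCLE : ℂ →L[ℝ] ℂ) F, by ext x; simp⟩

theorem add (hf : IsSchwartz f) (hg : IsSchwartz g) : IsSchwartz (fun x => f x + g x) := by
  obtain ⟨F, rfl⟩ := hf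
  obtain ⟨G, rfl⟩ := hg
  exact ⟨F + G, by ext x; simp⟩

theorem sub (hf : IsSchwartz f) (hg : IsSchwartz g) : IsSchwartz (fun x => f x - g x) := by
  obtain ⟨F, rfl⟩ := hf
  obtain ⟨G, rfl⟩ := hg
  exact ⟨F - G, by ext x; simp⟩

theorem const_mul (c : ℂ) (hf : IsSchwartz f) : IsSchwartz (fun x => c * f x) := by
  obtain ⟨F, rfl⟩ := hf
  exact ⟨c • F, by ext x; simp⟩

theorem zero : IsSchwartz (fun _ : EuclideanSpace ℝ (Fin n) => (0 : ℂ)) := ⟨0, by ext x; simp⟩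

theorem sum {ι : Type*} (s : Finset ι) {F : ι → EuclideanSpace ℝ (Fin n) → ℂ}
    (h : ∀ i ∈ s, IsSchwartz (F i)) : IsSchwartz (fun x => ∑ i ∈ s, F i x) := by
  classical
  induction s using Finset.induction_on with
  | empty => simpa using zero
  | insert a s ha ih =>
    simp only [Finset.sum_insert ha]
    exact (h a (Finset.mem_insert_self a s)).add
      (ih fun i hi => h i (Finset.mem_insert_of_mem hi))

theorem pd (hf : IsSchwartz f) (j : Fin n) : IsSchwartz (_root_.pd j f) := by
  obtain ⟨F, rfl⟩ := hf
  refine ⟨LineDeriv.lineDerivOp (EuclideanSpace.single j (1 : ℝ)) F, ?_⟩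
  ext x
  exact SchwartzMap.lineDerivOp_apply_eq_fderiv _ F x

theorem lap (hf : IsSchwartz f) : IsSchwartz (_root_.lap f) :=
  sum _ fun j _ => (hf.pd j).pd j

theorem contDiff (hf : IsSchwartz f) : ContDiff ℝ ∞ f := by
  obtain ⟨F, rfl⟩ := hf
  exact F.smooth ⊤

theorem continuous (hf : IsSchwartz f) : Continuous f := hf.contDiff.continuous

theorem differentiable (hf : IsSchwartz f) : Differentiable ℝ f :=
  hf.contDiff.differentiable (by simp)

theorem integrable (hf : IsSchwartz f) : Integrable f := by
  obtain ⟨F, rfl⟩ := hf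
  exact F.integrable

theorem exists_norm_le (hf : IsSchwartz f) : ∃ C, ∀ x, ‖f x‖ ≤ C := by
  obtain ⟨F, rfl⟩ := hf
  exact ⟨SchwartzMap.seminorm ℝ 0 0 F, fun x => SchwartzMap.norm_le_seminorm ℝ F x⟩

theorem fourier (hf : IsSchwartz f) : IsSchwartz (𝓕 f) := by
  obtain ⟨F, rfl⟩ := hf
  exact ⟨𝓕 F, SchwartzMap.fourier_coe F⟩

theorem fourierInv (hf : IsSchwartz f) : IsSchwartz (𝓕⁻ f) := by
  obtain ⟨F, rfl⟩ := hf
  exact ⟨𝓕⁻ F, SchwartzMap.fourierInv_coe F⟩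

theorem fourierInv_fourier (hf : IsSchwartz f) : 𝓕⁻ (𝓕 f) = f :=
  hf.continuous.fourierInv_fourier_eq hf.integrable hf.fourier.integrable

theorem fourier_fourierInv (hf : IsSchwartz f) : 𝓕 (𝓕⁻ f) = f :=
  hf.continuous.fourier_fourierInv_eq hf.integrable hf.fourier.integrable

theorem fourier_add (hf : IsSchwartz f) (hg : IsSchwartz g) (ξ : EuclideanSpace ℝ (Fin n)) :
    𝓕 (fun x => f x + g x) ξ = 𝓕 f ξ + 𝓕 g ξ := by
  simp only [Real.fourier_eq]
  rw [← integral_add]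
  · simp
  · exact (Real.fourierIntegral_convergent_iff ξ).2 hf.integrable
  · exact (Real.fourierIntegral_convergent_iff ξ).2 hg.integrable

theorem fourier_const_mul (c : ℂ) (ξ : EuclideanSpace ℝ (Fin n)) :
    𝓕 (fun x => c * f x) ξ = c * 𝓕 f ξ := by
  simp only [Real.fourier_eq]
  rw [← integral_const_mul]
  refine integral_congr_ae (.of_forall fun x => ?_)
  simp only [Circle.smul_def, smul_eq_mul]
  ring

theorem fourier_conj (ξ : EuclideanSpace ℝ (Fin n)) :
    𝓕 (fun x => (starRingEnd ℂ) (f x)) ξ = (starRingEnd ℂ) (𝓕 f (-ξ)) := by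
  simp only [Real.fourier_eq]
  rw [← integral_conj]
  refine integral_congr_ae (.of_forall fun x => ?_)
  simp only [Circle.smul_def, smul_eq_mul, map_mul, inner_neg_right, neg_neg]
  rw [← Circle.coe_inv_eq_conj, ← Real.fourierChar.map_neg_eq_inv]

theorem fourier_pd (hf : IsSchwartz f) (j : Fin n) (ξ : EuclideanSpace ℝ (Fin n)) :
    𝓕 (_root_.pd j f) ξ = 2 * π * Complex.I * ξ j * 𝓕 f ξ := by
  obtain ⟨F, rfl⟩ := hf
  have h : _root_.pd j F = ⇑(LineDeriv.lineDerivOp (EuclideanSpace.single j (1 : ℝ)) F) := by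
    ext x
    exact (SchwartzMap.lineDerivOp_apply_eq_fderiv _ F x).symm
  rw [h, ← SchwartzMap.fourier_coe, SchwartzMap.fourier_lineDerivOp_eq]
  rw [← SchwartzMap.fourier_coe]
  simp only [smul_apply, smul_eq_mul]
  rw [SchwartzMap.smulLeftCLM_apply_apply (by fun_prop)]
  simp [EuclideanSpace.inner_single_right]
  ring

theorem fourier_lap (hf : IsSchwartz f) (ξ : EuclideanSpace ℝ (Fin n)) :
    𝓕 (_root_.lap f) ξ = -(4 * π ^ 2 * ‖ξ‖ ^ 2 : ℝ) * 𝓕 f ξ := by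
  have h : 𝓕 (_root_.lap f) ξ = ∑ j, 𝓕 (_root_.pd j (_root_.pd j f)) ξ := by
    have e : ∀ F : EuclideanSpace ℝ (Fin n) → ℂ, 𝓕 F ξ = ∫ v, 𝐞 (-inner ℝ v ξ) • F v :=
      fun F => Real.fourier_eq F ξ
    simp only [e]
    rw [← integral_finsetSum]
    · simp only [_root_.lap, Finset.smul_sum]
    · intro j _
      exact (Real.fourierIntegral_convergent_iff ξ).2 ((hf.pd j).pd j).integrable
  rw [h, EuclideanSpace.real_norm_sq_eq]
  simp only [fun j => (hf.pd j).fourier_pd j ξ, fun j => hf.fourier_pd j ξ]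
  push_cast
  rw [Finset.mul_sum, ← Finset.sum_neg_distrib, Finset.sum_mul]
  refine Finset.sum_congr rfl fun j _ => ?_
  linear_combination 4 * π ^ 2 * (ξ j : ℂ) ^ 2 * 𝓕 f ξ * Complex.I_sq

theorem fourier_mul (hf : IsSchwartz f) (hg : IsSchwartz g) (ξ : EuclideanSpace ℝ (Fin n)) :
    𝓕 (fun x => f x * g x) ξ = ∫ η, 𝓕 f η * 𝓕 g (ξ - η) := by
  obtain ⟨F, rfl⟩ := hf
  obtain ⟨G, rfl⟩ := hg
  have h1 : ⇑(SchwartzMap.convolution (ContinuousLinearMap.mul ℂ ℂ) (𝓕⁻ F) (𝓕⁻ G)) =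
      𝓕⁻ (fun x => F x * G x) := by
    have : (fun x => F x * G x) = SchwartzMap.pairing (ContinuousLinearMap.mul ℂ ℂ) F G := by
      ext x
      simp
    rw [this, ← SchwartzMap.fourierInv_coe]
    simp [SchwartzMap.convolution]
  have h2 := SchwartzMap.convolution_apply (ContinuousLinearMap.mul ℂ ℂ) (𝓕⁻ F) (𝓕⁻ G) (-ξ)
  rw [h1, Real.fourierInv_eq_fourier_neg, neg_neg] at h2
  rw [h2, convolution_def, ← integral_neg_eq_self]
  refine integral_congr_ae (.of_forall fun η => ?_)
  simp only [ContinuousLinearMap.mul_apply', SchwartzMap.fourierInv_coe]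
  rw [Real.fourierInv_eq_fourier_neg, Real.fourierInv_eq_fourier_neg]
  rw [neg_neg, show -(-ξ - -η) = ξ - η by abel]

theorem integral_pd_eq_zero (hf : IsSchwartz f) (j : Fin n) : ∫ x, _root_.pd j f x = 0 := by
  have h := hf.fourier_pd j 0
  rw [Real.fourier_eq] at h
  simpa using h

theorem integral_norm_sq_fourier (hf : IsSchwartz f) : ∫ ξ, ‖𝓕 f ξ‖ ^ 2 = ∫ x, ‖f x‖ ^ 2 := by
  obtain ⟨F, rfl⟩ := hf
  rw [← SchwartzMap.fourier_coe]
  exact SchwartzMap.integral_norm_sq_fourier F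

theorem integral_fourier_mul (hf : IsSchwartz f) (hg : IsSchwartz g) :
    ∫ ξ, 𝓕 f ξ * g ξ = ∫ x, f x * 𝓕 g x := by
  obtain ⟨F, rfl⟩ := hf
  obtain ⟨G, rfl⟩ := hg
  rw [← SchwartzMap.fourier_coe, ← SchwartzMap.fourier_coe]
  exact SchwartzMap.integral_fourier_mul_eq F G

end IsSchwartz

/-- The squared Japanese bracket `1 + ‖ξ‖²`. -/
def jb (ξ : Plane) : ℝ := 1 + ‖ξ‖ ^ 2

theorem one_le_jb (ξ : Plane) : 1 ≤ jb ξ := by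
  unfold jb
  nlinarith [sq_nonneg ‖ξ‖]

theorem jb_pos (ξ : Plane) : 0 < jb ξ := zero_lt_one.trans_le (one_le_jb ξ)

theorem jb_neg (ξ : Plane) : jb (-ξ) = jb ξ := by simp [jb]

theorem continuous_jb : Continuous jb := by unfold jb; fun_prop

theorem abs_coord_le_norm (ξ : Plane) (j : Fin 2) : |ξ j| ≤ ‖ξ‖ := by
  simpa using PiLp.norm_apply_le ξ j

theorem norm_le_jb (ξ : Plane) : ‖ξ‖ ≤ jb ξ := by
  unfold jb
  nlinarith [sq_nonneg (‖ξ‖ - 1)]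

theorem jb_pow_le (k : ℕ) (ξ η : Plane) : jb ξ ^ k ≤ 4 ^ k * (jb η ^ k + jb (ξ - η) ^ k) := by
  have h1 : jb ξ ≤ 2 * (jb η + jb (ξ - η)) := by
    have : ‖ξ‖ ≤ ‖η‖ + ‖ξ - η‖ := by simpa using norm_add_le η (ξ - η)
    unfold jb
    nlinarith [sq_nonneg (‖η‖ - ‖ξ - η‖), norm_nonneg ξ, norm_nonneg η]
  have h2 := add_pow_le (jb_pos η).le (jb_pos (ξ - η)).le k
  have hs : (0 : ℝ) ≤ jb η ^ k + jb (ξ - η) ^ k :=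
    add_nonneg (pow_nonneg (jb_pos _).le _) (pow_nonneg (jb_pos _).le _)
  calc jb ξ ^ k ≤ (2 * (jb η + jb (ξ - η))) ^ k := pow_le_pow_left₀ (jb_pos _).le h1 k
    _ = 2 ^ k * (jb η + jb (ξ - η)) ^ k := mul_pow _ _ _
    _ ≤ 2 ^ k * (2 ^ k * (jb η ^ k + jb (ξ - η) ^ k)) := by
        refine mul_le_mul_of_nonneg_left (h2.trans ?_) (by positivity)
        exact mul_le_mul_of_nonneg_right (pow_le_pow_right₀ one_le_two (Nat.sub_le k 1)) hs
    _ = 4 ^ k * (jb η ^ k + jb (ξ - η) ^ k) := by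
        rw [← mul_assoc, ← mul_pow]
        norm_num

theorem integrable_inv_jb_pow {k : ℕ} (hk : 2 ≤ k) : Integrable fun ξ : Plane => (jb ξ ^ k)⁻¹ := by
  have h := integrable_rpow_neg_one_add_norm_sq (E := Plane) (r := 2 * k) (μ := volume) (by
    have : (2 : ℝ) ≤ k := by exact_mod_cast hk
    simp
    linarith)
  refine h.congr (.of_forall fun ξ => ?_)
  simp only
  rw [show -(2 * (k : ℝ)) / 2 = -(k : ℝ) by ring, Real.rpow_neg (by positivity), Real.rpow_natCast]
  rfl

/-- `f̂` decays like `K (1 + ‖ξ‖²)^{-k}`. -/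
def FourierDecay (K : ℝ) (k : ℕ) (f : Plane → ℂ) : Prop := ∀ ξ, ‖𝓕 f ξ‖ * jb ξ ^ k ≤ K

/-- The Wiener norm `∫ |f̂|`. -/
def wienerNorm (f : Plane → ℂ) : ℝ := ∫ ξ, ‖𝓕 f ξ‖

/-- The constant `∫ (1 + ‖ξ‖²)^{-2}`. -/
def jbInt : ℝ := ∫ ξ : Plane, (jb ξ ^ 2)⁻¹

theorem jbInt_nonneg : 0 ≤ jbInt :=
  integral_nonneg fun ξ => inv_nonneg.2 (pow_nonneg (jb_pos ξ).le 2)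

theorem wienerNorm_nonneg (f : Plane → ℂ) : 0 ≤ wienerNorm f :=
  integral_nonneg fun _ => norm_nonneg _

/-- The cubic nonlinearity `|f|² f`. -/
def cub (f : Plane → ℂ) (x : Plane) : ℂ := ((‖f x‖ ^ 2 : ℝ) : ℂ) * f x

theorem cub_eq (f : Plane → ℂ) : cub f = fun x => (f x * (starRingEnd ℂ) (f x)) * f x := by
  ext x
  simp [cub, Complex.mul_conj, Complex.normSq_eq_norm_sq]

theorem IsSchwartz.cub {f : Plane → ℂ} (hf : IsSchwartz f) : IsSchwartz (cub f) := by
  rw [cub_eq]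
  exact (hf.mul hf.conj).mul hf

theorem IsSchwartz.norm_le_wienerNorm {f : Plane → ℂ} (hf : IsSchwartz f) (x : Plane) :
    ‖f x‖ ≤ wienerNorm f := by
  conv_lhs => rw [← hf.fourierInv_fourier]
  rw [Real.fourierInv_eq]
  refine (norm_integral_le_integral_norm _).trans (le_of_eq ?_)
  simp [wienerNorm]

theorem IsSchwartz.integrable_conv {f g : Plane → ℂ} (hf : IsSchwartz f) (hg : IsSchwartz g)
    (ξ : Plane) : Integrable fun η => ‖f η‖ * ‖g (ξ - η)‖ := by
  obtain ⟨C, hC⟩ := hg.exists_norm_le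
  refine hf.integrable.norm.mul_bdd (c := C) ?_ (.of_forall fun η => ?_)
  · exact ((hg.continuous.comp (continuous_const.sub continuous_id)).norm).aestronglyMeasurable
  · simpa using hC _

theorem wienerNorm_mul_le {f g : Plane → ℂ} (hf : IsSchwartz f) (hg : IsSchwartz g) :
    wienerNorm (fun x => f x * g x) ≤ wienerNorm f * wienerNorm g := by
  have hF := hf.fourier
  have hG := hg.fourier
  have hi : Integrable (fun p : Plane × Plane => ‖𝓕 f p.2‖ * ‖𝓕 g (p.1 - p.2)‖)
      (volume.prod volume) := by
    have := Integrable.convolution_integrand (ContinuousLinearMap.mul ℝ ℝ) (μ := volume)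
      (ν := volume) hF.integrable.norm hG.integrable.norm
    simpa using this
  have h1 : ∀ ξ, ‖𝓕 (fun x => f x * g x) ξ‖ ≤ ∫ η, ‖𝓕 f η‖ * ‖𝓕 g (ξ - η)‖ := fun ξ => by
    rw [hf.fourier_mul hg]
    refine (norm_integral_le_integral_norm _).trans (le_of_eq ?_)
    simp
  calc wienerNorm (fun x => f x * g x)
      ≤ ∫ ξ, ∫ η, ‖𝓕 f η‖ * ‖𝓕 g (ξ - η)‖ :=
        integral_mono (hf.mul hg).fourier.integrable.norm hi.integral_prod_left h1
    _ = ∫ η, ∫ ξ, ‖𝓕 f η‖ * ‖𝓕 g (ξ - η)‖ := integral_integral_swap hi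
    _ = wienerNorm f * wienerNorm g := by
        have : ∀ η, ∫ ξ, ‖𝓕 f η‖ * ‖𝓕 g (ξ - η)‖ = ‖𝓕 f η‖ * wienerNorm g := fun η => by
          rw [integral_const_mul, integral_sub_right_eq_self (fun ξ => ‖𝓕 g ξ‖)]
          rfl
        simp only [this]
        rw [integral_mul_const]
        rfl

theorem wienerNorm_conj (f : Plane → ℂ) :
    wienerNorm (fun x => (starRingEnd ℂ) (f x)) = wienerNorm f := by
  unfold wienerNorm
  simp only [IsSchwartz.fourier_conj, RCLike.norm_conj]
  exact integral_neg_eq_self (fun ξ => ‖𝓕 f ξ‖) volume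

namespace FourierDecay

variable {K L : ℝ} {k : ℕ} {f g : Plane → ℂ}

theorem nonneg (h : FourierDecay K k f) : 0 ≤ K :=
  (mul_nonneg (norm_nonneg _) (pow_nonneg (jb_pos 0).le k)).trans (h 0)

theorem norm_le (h : FourierDecay K k f) (ξ : Plane) : ‖𝓕 f ξ‖ ≤ K * (jb ξ ^ k)⁻¹ := by
  rw [← div_eq_mul_inv, le_div_iff₀ (pow_pos (jb_pos ξ) k)]
  exact h ξ

theorem mono_const (h : FourierDecay K k f) (hKL : K ≤ L) : FourierDecay L k f :=
  fun ξ => (h ξ).trans hKL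

theorem mono {l : ℕ} (h : FourierDecay K k f) (hl : l ≤ k) : FourierDecay K l f := fun ξ =>
  (mul_le_mul_of_nonneg_left (pow_le_pow_right₀ (one_le_jb ξ) hl) (norm_nonneg _)).trans (h ξ)

theorem wienerNorm_le (h : FourierDecay K k f) (hk : 2 ≤ k) : wienerNorm f ≤ K * jbInt := by
  unfold wienerNorm jbInt
  rw [← integral_const_mul]
  exact integral_mono_of_nonneg (.of_forall fun _ => norm_nonneg _)
    ((integrable_inv_jb_pow le_rfl).const_mul K) (.of_forall (h.mono hk).norm_le)

theorem norm_apply_le (h : FourierDecay K k f) (hk : 2 ≤ k) (hf : IsSchwartz f) (x : Plane) :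
    ‖f x‖ ≤ K * jbInt :=
  (hf.norm_le_wienerNorm x).trans (h.wienerNorm_le hk)

theorem integral_norm_sq_le (h : FourierDecay K k f) (hk : 1 ≤ k) (hf : IsSchwartz f) :
    ∫ x, ‖f x‖ ^ 2 ≤ K ^ 2 * jbInt := by
  rw [← hf.integral_norm_sq_fourier]
  unfold jbInt
  rw [← integral_const_mul]
  refine integral_mono_of_nonneg (.of_forall fun _ => by positivity)
    ((integrable_inv_jb_pow le_rfl).const_mul _) (.of_forall fun ξ => ?_)
  have := pow_le_pow_left₀ (norm_nonneg _) ((h.mono hk).norm_le ξ) 2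
  simpa [mul_pow] using this

theorem add (hf : IsSchwartz f) (hg : IsSchwartz g) (h : FourierDecay K k f)
    (h' : FourierDecay L k g) : FourierDecay (K + L) k (fun x => f x + g x) := fun ξ => by
  rw [hf.fourier_add hg]
  have := mul_le_mul_of_nonneg_right (norm_add_le (𝓕 f ξ) (𝓕 g ξ)) (pow_nonneg (jb_pos ξ).le k)
  linarith [h ξ, h' ξ]

theorem const_mul (c : ℂ) (h : FourierDecay K k f) :
    FourierDecay (‖c‖ * K) k (fun x => c * f x) := fun ξ => by
  rw [IsSchwartz.fourier_const_mul, norm_mul, mul_assoc]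
  exact mul_le_mul_of_nonneg_left (h ξ) (norm_nonneg c)

theorem conj (h : FourierDecay K k f) :
    FourierDecay K k (fun x => (starRingEnd ℂ) (f x)) := fun ξ => by
  rw [IsSchwartz.fourier_conj, RCLike.norm_conj, ← jb_neg]
  exact h _

theorem pd (hf : IsSchwartz f) (h : FourierDecay K (k + 1) f) (j : Fin 2) :
    FourierDecay (2 * π * K) k (_root_.pd j f) := fun ξ => by
  rw [hf.fourier_pd]
  have h1 : |ξ j| ≤ jb ξ := (abs_coord_le_norm ξ j).trans (norm_le_jb ξ)
  have h2 := h ξ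
  simp only [norm_mul, Complex.norm_ofNat, Complex.norm_real, Complex.norm_I, Real.norm_eq_abs,
    abs_of_pos Real.pi_pos]
  have h3 : |ξ j| * (‖𝓕 f ξ‖ * jb ξ ^ k) ≤ jb ξ * (‖𝓕 f ξ‖ * jb ξ ^ k) :=
    mul_le_mul_of_nonneg_right h1 (mul_nonneg (norm_nonneg _) (pow_nonneg (jb_pos ξ).le k))
  rw [pow_succ] at h2
  nlinarith [Real.pi_pos]

theorem lap (hf : IsSchwartz f) (h : FourierDecay K (k + 1) f) :
    FourierDecay (4 * π ^ 2 * K) k (_root_.lap f) := fun ξ => by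
  rw [hf.fourier_lap, norm_mul, norm_neg, Complex.norm_real, Real.norm_eq_abs, abs_of_nonneg
    (by positivity)]
  have h1 : ‖ξ‖ ^ 2 ≤ jb ξ := by simp [jb]
  have h2 := h ξ
  have h3 : ‖ξ‖ ^ 2 * (‖𝓕 f ξ‖ * jb ξ ^ k) ≤ jb ξ * (‖𝓕 f ξ‖ * jb ξ ^ k) :=
    mul_le_mul_of_nonneg_right h1 (mul_nonneg (norm_nonneg _) (pow_nonneg (jb_pos ξ).le k))
  rw [pow_succ] at h2
  nlinarith [Real.pi_pos, sq_nonneg π]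

theorem mul (hf : IsSchwartz f) (hg : IsSchwartz g) (h : FourierDecay K k f)
    (h' : FourierDecay L k g) :
    FourierDecay (4 ^ k * (K * wienerNorm g + wienerNorm f * L)) k (fun x => f x * g x) :=
  fun ξ => by
  have hF := hf.fourier
  have hG := hg.fourier
  rw [hf.fourier_mul hg]
  have h1 : ‖∫ η, 𝓕 f η * 𝓕 g (ξ - η)‖ ≤ ∫ η, ‖𝓕 f η‖ * ‖𝓕 g (ξ - η)‖ := by
    refine (norm_integral_le_integral_norm _).trans (le_of_eq ?_)
    simp
  have hc : 0 ≤ jb ξ ^ k := pow_nonneg (jb_pos ξ).le k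
  have hi1 : Integrable fun η => ‖𝓕 g (ξ - η)‖ := (hG.integrable.comp_sub_left ξ).norm
  calc ‖∫ η, 𝓕 f η * 𝓕 g (ξ - η)‖ * jb ξ ^ k
      ≤ (∫ η, ‖𝓕 f η‖ * ‖𝓕 g (ξ - η)‖) * jb ξ ^ k := mul_le_mul_of_nonneg_right h1 hc
    _ = ∫ η, ‖𝓕 f η‖ * ‖𝓕 g (ξ - η)‖ * jb ξ ^ k := (integral_mul_const _ _).symm
    _ ≤ ∫ η, 4 ^ k * (K * ‖𝓕 g (ξ - η)‖ + ‖𝓕 f η‖ * L) := by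
        refine integral_mono ((hF.integrable_conv hG ξ).mul_const _)
          (((hi1.const_mul K).add (hF.integrable.norm.mul_const L)).const_mul _) fun η => ?_
        have e1 := mul_le_mul_of_nonneg_right (h η) (norm_nonneg (𝓕 g (ξ - η)))
        have e2 := mul_le_mul_of_nonneg_left (h' (ξ - η)) (norm_nonneg (𝓕 f η))
        have e3 := mul_le_mul_of_nonneg_left (jb_pow_le k ξ η)
          (mul_nonneg (norm_nonneg (𝓕 f η)) (norm_nonneg (𝓕 g (ξ - η))))
        refine e3.trans ?_
        have : (0 : ℝ) < 4 ^ k := by positivity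
        nlinarith
    _ = 4 ^ k * (K * wienerNorm g + wienerNorm f * L) := by
        rw [integral_const_mul, integral_add (hi1.const_mul K) (hF.integrable.norm.mul_const L),
          integral_const_mul, integral_mul_const,
          integral_sub_left_eq_self (fun η => ‖𝓕 g η‖) volume ξ]
        rfl

theorem cub (hf : IsSchwartz f) (h : FourierDecay K k f) :
    FourierDecay (4 ^ k * (1 + 2 * 4 ^ k) * (wienerNorm f ^ 2 * K)) k (cub f) := by
  rw [cub_eq]
  have h1 := mul hf hf.conj h h.conj
  rw [wienerNorm_conj] at h1
  refine (mul (hf.mul hf.conj) hf h1 h).mono_const ?_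
  have h2 := wienerNorm_mul_le hf hf.conj
  rw [wienerNorm_conj] at h2
  have h3 := mul_le_mul_of_nonneg_right h2 h.nonneg
  have h4 : (0 : ℝ) < 4 ^ k := by positivity
  nlinarith [mul_le_mul_of_nonneg_left h3 h4.le]

end FourierDecay

/-- The time derivative of a space-time function. -/
def dt {F : Type*} [NormedAddCommGroup F] [NormedSpace ℝ F] (U : ℝ → Plane → F) (t : ℝ)
    (x : Plane) : F := deriv (fun s => U s x) t

section Smooth

variable {F : Type*} [NormedAddCommGroup F] [NormedSpace ℝ F] {U : ℝ → Plane → F}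

theorem hasFDerivAt_slice_right {t : ℝ} {x : Plane}
    (hU : DifferentiableAt ℝ (Function.uncurry U) (t, x)) :
    HasFDerivAt (U t) ((fderiv ℝ (Function.uncurry U) (t, x)).comp
      (ContinuousLinearMap.inr ℝ ℝ Plane)) x := by
  have h : HasFDerivAt (fun y : Plane => (t, y)) (ContinuousLinearMap.inr ℝ ℝ Plane) x :=
    (hasFDerivAt_const t x).prodMk (hasFDerivAt_id x)
  exact hU.hasFDerivAt.comp x h

theorem hasDerivAt_slice_left {t : ℝ} {x : Plane}
    (hU : DifferentiableAt ℝ (Function.uncurry U) (t, x)) :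
    HasDerivAt (fun s => U s x) (fderiv ℝ (Function.uncurry U) (t, x) (1, 0)) t := by
  have h : HasDerivAt (fun s : ℝ => (s, x)) ((1 : ℝ), (0 : Plane)) t :=
    (hasDerivAt_id t).prodMk (hasDerivAt_const t x)
  exact hU.hasFDerivAt.comp_hasDerivAt t h

theorem pd_eq_fderiv_uncurry {t : ℝ} {x : Plane}
    (hU : DifferentiableAt ℝ (Function.uncurry U) (t, x)) (j : Fin 2) :
    pd j (U t) x = fderiv ℝ (Function.uncurry U) (t, x) (0, EuclideanSpace.single j 1) := by
  rw [pd, (hasFDerivAt_slice_right hU).fderiv]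
  simp

theorem contDiff_uncurry_pd (hU : ContDiff ℝ ∞ (Function.uncurry U)) (j : Fin 2) :
    ContDiff ℝ ∞ (Function.uncurry fun t => pd j (U t)) := by
  have h : (Function.uncurry fun t => pd j (U t)) = fun p : ℝ × Plane =>
      fderiv ℝ (Function.uncurry U) p (0, EuclideanSpace.single j 1) := by
    ext ⟨t, x⟩
    exact pd_eq_fderiv_uncurry (hU.differentiable (by simp) _) j
  rw [h]
  exact (hU.fderiv_right (m := ∞) (by simp)).clm_apply contDiff_const

theorem contDiff_uncurry_dt (hU : ContDiff ℝ ∞ (Function.uncurry U)) :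
    ContDiff ℝ ∞ (Function.uncurry (dt U)) := by
  have h : Function.uncurry (dt U) = fun p : ℝ × Plane =>
      fderiv ℝ (Function.uncurry U) p (1, 0) := by
    ext ⟨t, x⟩
    exact (hasDerivAt_slice_left (hU.differentiable (by simp) _)).deriv
  rw [h]
  exact (hU.fderiv_right (m := ∞) (by simp)).clm_apply contDiff_const

theorem hasDerivAt_dt (hU : ContDiff ℝ ∞ (Function.uncurry U)) (t : ℝ) (x : Plane) :
    HasDerivAt (fun s => U s x) (dt U t x) t :=
  (hasDerivAt_slice_left (hU.differentiable (by simp) (t, x))).differentiableAt.hasDerivAt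

theorem dt_pd_comm (hU : ContDiff ℝ ∞ (Function.uncurry U)) (j : Fin 2) (t : ℝ) (x : Plane) :
    dt (fun t => pd j (U t)) t x = pd j (dt U t) x := by
  have hd : Differentiable ℝ (Function.uncurry U) := hU.differentiable (by simp)
  have hf : ContDiff ℝ ∞ (fderiv ℝ (Function.uncurry U)) := hU.fderiv_right (by simp)
  have hfd := hf.differentiable (by simp) (t, x)
  have key : ∀ v : ℝ × Plane, HasFDerivAt (fun p => fderiv ℝ (Function.uncurry U) p v)
      ((fderiv ℝ (fderiv ℝ (Function.uncurry U)) (t, x)).flip v) (t, x) := fun v => by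
    have := hfd.hasFDerivAt.clm_apply (hasFDerivAt_const v (t, x))
    simpa using this
  have e1 : dt (fun t => pd j (U t)) t x =
      fderiv ℝ (fderiv ℝ (Function.uncurry U)) (t, x) (1, 0) (0, EuclideanSpace.single j 1) := by
    have h : (Function.uncurry fun t => pd j (U t)) = fun p : ℝ × Plane =>
        fderiv ℝ (Function.uncurry U) p (0, EuclideanSpace.single j 1) := by
      ext ⟨t, x⟩
      exact pd_eq_fderiv_uncurry (hd _) j
    have hk := key (0, EuclideanSpace.single j 1)
    rw [← h] at hk
    exact (hasDerivAt_slice_left hk.differentiableAt).deriv.trans (by rw [hk.fderiv]; simp)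
  have e2 : pd j (dt U t) x =
      fderiv ℝ (fderiv ℝ (Function.uncurry U)) (t, x) (0, EuclideanSpace.single j 1) (1, 0) := by
    have h : Function.uncurry (dt U) = fun p : ℝ × Plane =>
        fderiv ℝ (Function.uncurry U) p (1, 0) := by
      ext ⟨t, x⟩
      exact (hasDerivAt_slice_left (hd _)).deriv
    have hk := key (1, 0)
    rw [← h] at hk
    rw [pd_eq_fderiv_uncurry hk.differentiableAt, hk.fderiv]
    simp
  rw [e1, e2]
  exact (hU.contDiffAt.isSymmSndFDerivAt (by
    rw [minSmoothness_of_isRCLikeNormedField]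
    exact WithTop.coe_le_coe.2 (le_top (a := (2 : ℕ∞))))).eq _ _

end Smooth

theorem measurable_fourier {v : ℝ → Plane → ℂ} (hv : Continuous (Function.uncurry v)) :
    StronglyMeasurable fun p : ℝ × Plane => 𝓕 (v p.1) p.2 := by
  have h : StronglyMeasurable fun q : (ℝ × Plane) × Plane =>
      𝐞 (-inner ℝ q.2 q.1.2) • v q.1.1 q.2 := by
    have : Continuous fun q : (ℝ × Plane) × Plane => 𝐞 (-inner ℝ q.2 q.1.2) • v q.1.1 q.2 := by
      have h1 : Continuous fun q : (ℝ × Plane) × Plane => -inner ℝ q.2 q.1.2 := by fun_prop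
      simp only [Circle.smul_def, smul_eq_mul]
      refine (continuous_subtype_val.comp (Real.continuous_fourierChar.comp h1)).mul ?_
      exact hv.comp ((continuous_fst.comp continuous_fst).prodMk continuous_snd)
    exact this.stronglyMeasurable
  have := h.integral_prod_right' (ν := volume)
  simpa only [Real.fourier_eq] using this

/-- The fundamental theorem of calculus in time on the Fourier side. -/
theorem fourier_sub_eq_integral {u v : ℝ → Plane → ℂ} {s t K : ℝ} (hst : s ≤ t)
    (hs : IsSchwartz (u s)) (ht : IsSchwartz (u t))
    (hd : ∀ τ ∈ Set.Icc s t, ∀ x, HasDerivAt (fun σ => u σ x) (v τ x) τ)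
    (hvc : Continuous (Function.uncurry v)) (hv : ∀ τ ∈ Set.Icc s t, IsSchwartz (v τ))
    (hK : ∀ τ ∈ Set.Icc s t, FourierDecay K 2 (v τ)) (ξ : Plane) :
    𝓕 (u t) ξ - 𝓕 (u s) ξ = ∫ τ in Set.Ioc s t, 𝓕 (v τ) ξ := by
  obtain ⟨R, hR⟩ : ∃ R : Plane → ℂ, R = fun ξ => ∫ τ in Set.Ioc s t, 𝓕 (v τ) ξ := ⟨_, rfl⟩
  have hmeas := measurable_fourier hvc
  have hsub : Set.Ioc s t ⊆ Set.Icc s t := Set.Ioc_subset_Icc_self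
  have hb : ∀ τ ∈ Set.Ioc s t, ∀ ξ, ‖𝓕 (v τ) ξ‖ ≤ K * (jb ξ ^ 2)⁻¹ := fun τ hτ ξ =>
    (hK τ (hsub hτ)).norm_le ξ
  have hK0 : 0 ≤ K := (hK s ⟨le_rfl, hst⟩).nonneg
  have hbK : ∀ τ ∈ Set.Ioc s t, ∀ ξ, ‖𝓕 (v τ) ξ‖ ≤ K := fun τ hτ ξ =>
    (hb τ hτ ξ).trans (mul_le_of_le_one_right hK0
      (inv_le_one_of_one_le₀ (one_le_pow₀ (one_le_jb ξ))))
  have hmeas1 : ∀ ξ, StronglyMeasurable fun τ => 𝓕 (v τ) ξ := fun ξ =>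
    hmeas.comp_measurable (g := fun τ : ℝ => (τ, ξ)) measurable_prodMk_right
  have hRc : Continuous R := by
    rw [hR]
    refine continuous_of_dominated (bound := fun _ => K) (fun ξ => (hmeas1 ξ).aestronglyMeasurable)
      (fun ξ => ?_) (integrable_const K) ?_
    · exact (ae_restrict_mem measurableSet_Ioc).mono fun τ hτ => hbK τ hτ ξ
    · exact (ae_restrict_mem measurableSet_Ioc).mono fun τ hτ =>
        (hv τ (hsub hτ)).fourier.continuous
  have hprod : Integrable (fun p : Plane × ℝ => 𝓕 (v p.2) p.1)
      (volume.prod (volume.restrict (Set.Ioc s t))) := by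
    have h1 : Integrable (fun p : Plane × ℝ => (K * (jb p.1 ^ 2)⁻¹) * (1 : ℝ))
        (volume.prod (volume.restrict (Set.Ioc s t))) :=
      ((integrable_inv_jb_pow le_rfl).const_mul K).mul_prod (integrable_const 1)
    refine h1.mono' (hmeas.comp_measurable measurable_swap).aestronglyMeasurable ?_
    have : ∀ᵐ p : Plane × ℝ ∂(volume.prod (volume.restrict (Set.Ioc s t))),
        p.2 ∈ Set.Ioc s t := by
      rw [← Measure.restrict_univ (μ := (volume : Measure Plane)), Measure.prod_restrict]
      exact (ae_restrict_mem (MeasurableSet.univ.prod measurableSet_Ioc)).mono fun p hp => hp.2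
    filter_upwards [this] with p hp
    simpa using hb p.2 hp p.1
  have hRi : Integrable R := by
    rw [hR]
    exact hprod.integral_prod_left
  have hinv : ∀ x, 𝓕⁻ R x = u t x - u s x := fun x => by
    have e1 : 𝓕⁻ R x = ∫ ξ, ∫ τ in Set.Ioc s t, 𝐞 (inner ℝ ξ x) • 𝓕 (v τ) ξ := by
      rw [Real.fourierInv_eq]
      refine integral_congr_ae (.of_forall fun ξ => ?_)
      simp only [hR, Circle.smul_def]
      rw [integral_smul]
    have hp2 : Integrable (fun p : Plane × ℝ => 𝐞 (inner ℝ p.1 x) • 𝓕 (v p.2) p.1)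
        (volume.prod (volume.restrict (Set.Ioc s t))) := by
      refine (integrable_norm_iff ?_).1 ?_
      · simp only [Circle.smul_def, smul_eq_mul]
        have hc : Continuous fun p : Plane × ℝ => inner ℝ p.1 x := by fun_prop
        exact (continuous_subtype_val.comp
          (Real.continuous_fourierChar.comp hc)).aestronglyMeasurable.mul hprod.aestronglyMeasurable
      · simpa using hprod.norm
    rw [e1, integral_integral_swap hp2]
    have e2 : ∀ τ ∈ Set.Ioc s t, ∫ ξ, 𝐞 (inner ℝ ξ x) • 𝓕 (v τ) ξ = v τ x := fun τ hτ => by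
      rw [← Real.fourierInv_eq, (hv τ (hsub hτ)).fourierInv_fourier]
    rw [setIntegral_congr_fun measurableSet_Ioc e2, ← intervalIntegral.integral_of_le hst]
    refine intervalIntegral.integral_eq_sub_of_hasDerivAt (f := fun τ => u τ x)
      (f' := fun τ => v τ x) (fun τ hτ => ?_) ?_
    · rw [Set.uIcc_of_le hst] at hτ
      exact hd τ hτ x
    · refine Continuous.intervalIntegrable ?_ _ _
      exact hvc.comp (continuous_id.prodMk continuous_const)
  have hfi : Integrable (𝓕 R) := by
    have e : 𝓕 R = fun x => u t (-x) - u s (-x) := by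
      ext x
      rw [← hinv, Real.fourierInv_eq_fourier_neg, neg_neg]
    rw [e]
    exact (ht.integrable.sub hs.integrable).comp_neg
  have h1 : 𝓕 (𝓕⁻ R) = R := hRc.fourier_fourierInv_eq hRi hfi
  have h2 : 𝓕⁻ R = fun x => u t x + (-1 : ℂ) * u s x := by
    ext x
    rw [hinv]
    ring
  rw [h2] at h1
  have h3 := congrFun h1 ξ
  rw [ht.fourier_add (hs.const_mul (-1)), IsSchwartz.fourier_const_mul] at h3
  simp only [hR] at h3
  linear_combination h3

section Solution

variable {T : ℝ} {u : ℝ → Plane → ℂ}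

theorem IsNLSSolution.dt_eq (hu : IsNLSSolution 2 T u) {t : ℝ} (ht : t ∈ Set.Icc 0 T) :
    dt u t = fun x => Complex.I * lap (u t) x + -Complex.I * cub (u t) x := by
  ext x
  have h := hu.2.2 t ht x
  have hc : cub (u t) x = (‖u t x‖ : ℂ) ^ 2 * u t x := by simp [cub]
  rw [hc]
  unfold dt
  linear_combination (-Complex.I) * h + deriv (fun s => u s x) t * Complex.I_sq

theorem IsNLSSolution.isSchwartz_dt (hu : IsNLSSolution 2 T u) {t : ℝ}
    (ht : t ∈ Set.Icc 0 T) : IsSchwartz (dt u t) := by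
  rw [hu.dt_eq ht]
  have := hu.2.1 t ht
  exact (this.lap.const_mul _).add (this.cub.const_mul _)

theorem IsNLSSolution.fourier_dt (hu : IsNLSSolution 2 T u) {t : ℝ}
    (ht : t ∈ Set.Icc 0 T) (ξ : Plane) :
    𝓕 (dt u t) ξ = -Complex.I * (4 * π ^ 2 * ‖ξ‖ ^ 2 : ℝ) * 𝓕 (u t) ξ
      - Complex.I * 𝓕 (cub (u t)) ξ := by
  have := hu.2.1 t ht
  rw [hu.dt_eq ht, (this.lap.const_mul _).fourier_add (this.cub.const_mul _),
    IsSchwartz.fourier_const_mul, IsSchwartz.fourier_const_mul, this.fourier_lap]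
  ring

/-- The constant in the decay bound for the time derivative of a solution. -/
def dtConst (K : ℝ) : ℝ := 4 * π ^ 2 * K + 4 ^ 3 * (1 + 2 * 4 ^ 3) * ((K * jbInt) ^ 2 * K)

theorem IsNLSSolution.fourierDecay_dt (hu : IsNLSSolution 2 T u) {t K : ℝ}
    (ht : t ∈ Set.Icc 0 T) (hK : FourierDecay K 4 (u t)) :
    FourierDecay (dtConst K) 3 (dt u t) := by
  have hS := hu.2.1 t ht
  rw [hu.dt_eq ht]
  refine FourierDecay.mono_const (FourierDecay.add (hS.lap.const_mul _) (hS.cub.const_mul _)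
    ((FourierDecay.lap hS hK).const_mul _)
    (((FourierDecay.cub hS (hK.mono (by norm_num : 3 ≤ 4)))).const_mul _)) ?_
  have h1 : wienerNorm (u t) ^ 2 ≤ (K * jbInt) ^ 2 :=
    pow_le_pow_left₀ (wienerNorm_nonneg _) (hK.wienerNorm_le (by norm_num)) 2
  have h2 := mul_le_mul_of_nonneg_right h1 hK.nonneg
  simp only [Complex.norm_I, norm_neg, one_mul, dtConst]
  nlinarith

theorem continuousOn_fourier_mul {S : Set ℝ} {f g : ℝ → Plane → ℂ} {K L : ℝ}
    (hf : ∀ τ ∈ S, IsSchwartz (f τ)) (hg : ∀ τ ∈ S, IsSchwartz (g τ))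
    (hK : ∀ τ ∈ S, FourierDecay K 2 (f τ)) (hL : ∀ τ ∈ S, FourierDecay L 0 (g τ))
    (hfc : ∀ ξ, ContinuousOn (fun τ => 𝓕 (f τ) ξ) S)
    (hgc : ∀ ξ, ContinuousOn (fun τ => 𝓕 (g τ) ξ) S) (ξ : Plane) :
    ContinuousOn (fun τ => 𝓕 (fun x => f τ x * g τ x) ξ) S := by
  have e : Set.EqOn (fun τ => 𝓕 (fun x => f τ x * g τ x) ξ)
      (fun τ => ∫ η, 𝓕 (f τ) η * 𝓕 (g τ) (ξ - η)) S := fun τ hτ =>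
    (hf τ hτ).fourier_mul (hg τ hτ) ξ
  refine ContinuousOn.congr ?_ e
  refine continuousOn_of_dominated (bound := fun η => K * (jb η ^ 2)⁻¹ * L) (fun τ hτ => ?_)
    (fun τ hτ => .of_forall fun η => ?_) (((integrable_inv_jb_pow le_rfl).const_mul K).mul_const L)
    (.of_forall fun η => (hfc η).mul (hgc (ξ - η)))
  · have h2 := (hg τ hτ).fourier.continuous
    exact ((hf τ hτ).fourier.continuous.mul
      (h2.comp (continuous_const.sub continuous_id))).aestronglyMeasurable
  · rw [norm_mul]
    have h1 := (hK τ hτ).norm_le η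
    have h2 := (hL τ hτ) (ξ - η)
    rw [pow_zero, mul_one] at h2
    exact mul_le_mul h1 h2 (norm_nonneg _) ((norm_nonneg _).trans h1)

theorem IsNLSSolution.continuousOn_fourier (hu : IsNLSSolution 2 T u) {s t K : ℝ} (hs : 0 ≤ s)
    (ht : t ≤ T) (hK : ∀ τ ∈ Set.Icc s t, FourierDecay K 4 (u τ)) (ξ : Plane) :
    ContinuousOn (fun τ => 𝓕 (u τ) ξ) (Set.Icc s t) := by
  have hsub : Set.Icc s t ⊆ Set.Icc 0 T := Set.Icc_subset_Icc hs ht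
  have key : ∀ a ∈ Set.Icc s t, ∀ b ∈ Set.Icc s t, a ≤ b →
      ‖𝓕 (u b) ξ - 𝓕 (u a) ξ‖ ≤ dtConst K * (b - a) := fun a ha b hb hab => by
    have hsub' : Set.Icc a b ⊆ Set.Icc s t := Set.Icc_subset_Icc ha.1 hb.2
    have hdec : ∀ τ ∈ Set.Icc a b, FourierDecay (dtConst K) 2 (dt u τ) := fun τ hτ =>
      (hu.fourierDecay_dt (hsub (hsub' hτ)) (hK τ (hsub' hτ))).mono (by norm_num)
    rw [fourier_sub_eq_integral hab (hu.2.1 a (hsub ha)) (hu.2.1 b (hsub hb))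
      (fun τ _ x => hasDerivAt_dt hu.1 τ x) (contDiff_uncurry_dt hu.1).continuous
      (fun τ hτ => hu.isSchwartz_dt (hsub (hsub' hτ))) hdec ξ,
      ← intervalIntegral.integral_of_le hab]
    refine (intervalIntegral.norm_integral_le_of_norm_le_const (C := dtConst K)
      fun τ hτ => ?_).trans (le_of_eq (by rw [abs_of_nonneg (sub_nonneg.2 hab)]))
    rw [Set.uIoc_of_le hab] at hτ
    have := (hdec τ (Set.Ioc_subset_Icc_self hτ)).mono (Nat.zero_le 2) ξ
    simpa using this
  rcases Set.eq_empty_or_nonempty (Set.Icc s t) with h0 | ⟨τ₀, hτ₀⟩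
  · rw [h0]
    exact continuousOn_empty _
  have hC : 0 ≤ dtConst K := (hu.fourierDecay_dt (hsub hτ₀) (hK τ₀ hτ₀)).nonneg
  refine (LipschitzOnWith.of_dist_le_mul (K := ⟨dtConst K, hC⟩) fun a ha b hb => ?_).continuousOn
  rw [dist_eq_norm, Real.dist_eq]
  rcases le_total a b with hab | hab
  · rw [norm_sub_rev, abs_sub_comm, abs_of_nonneg (sub_nonneg.2 hab)]
    exact key a ha b hb hab
  · rw [abs_of_nonneg (sub_nonneg.2 hab)]
    exact key b hb a ha hab

theorem IsNLSSolution.continuousOn_fourier_cub (hu : IsNLSSolution 2 T u) {s t K : ℝ} (hs : 0 ≤ s)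
    (ht : t ≤ T) (hK : ∀ τ ∈ Set.Icc s t, FourierDecay K 4 (u τ)) (ξ : Plane) :
    ContinuousOn (fun τ => 𝓕 (cub (u τ)) ξ) (Set.Icc s t) := by
  have hS : ∀ τ ∈ Set.Icc s t, IsSchwartz (u τ) := fun τ hτ =>
    hu.2.1 τ (Set.Icc_subset_Icc hs ht hτ)
  have hc := hu.continuousOn_fourier hs ht hK
  have hcc : ∀ ξ, ContinuousOn (fun τ => 𝓕 (fun x => (starRingEnd ℂ) (u τ x)) ξ) (Set.Icc s t) :=
    fun ξ => by
    simp only [IsSchwartz.fourier_conj]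
    exact Complex.continuous_conj.comp_continuousOn (hc (-ξ))
  simp only [cub_eq]
  have hK2 : ∀ τ ∈ Set.Icc s t, FourierDecay K 2 (u τ) := fun τ hτ => (hK τ hτ).mono (by norm_num)
  have hm := continuousOn_fourier_mul hS (fun τ hτ => (hS τ hτ).conj) hK2
    (fun τ hτ => (hK2 τ hτ).conj.mono (Nat.zero_le _)) hc hcc
  refine continuousOn_fourier_mul (K := 4 ^ 2 * (K * (K * jbInt) + (K * jbInt) * K)) (L := K)
    (fun τ hτ => (hS τ hτ).mul (hS τ hτ).conj) hS (fun τ hτ => ?_)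
    (fun τ hτ => (hK2 τ hτ).mono (Nat.zero_le _)) hm hc ξ
  refine (FourierDecay.mul (hS τ hτ) (hS τ hτ).conj (hK2 τ hτ) (hK2 τ hτ).conj).mono_const ?_
  rw [wienerNorm_conj]
  have h1 := (hK2 τ hτ).wienerNorm_le le_rfl
  have h2 := (hK2 τ hτ).nonneg
  gcongr

theorem IsNLSSolution.hasDerivAt_fourier (hu : IsNLSSolution 2 T u) {s t K : ℝ} (hs : 0 ≤ s)
    (ht : t ≤ T) (hK : ∀ τ ∈ Set.Icc s t, FourierDecay K 4 (u τ)) (ξ : Plane) {τ : ℝ}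
    (hτ : τ ∈ Set.Ioo s t) :
    HasDerivAt (fun τ => 𝓕 (u τ) ξ) (𝓕 (dt u τ) ξ) τ := by
  have hsub : Set.Icc s t ⊆ Set.Icc 0 T := Set.Icc_subset_Icc hs ht
  have hst : s ≤ t := (hτ.1.trans hτ.2).le
  have hgc : ContinuousOn (fun σ => 𝓕 (dt u σ) ξ) (Set.Icc s t) := by
    have : Set.EqOn (fun σ => 𝓕 (dt u σ) ξ) (fun σ =>
        -Complex.I * (4 * π ^ 2 * ‖ξ‖ ^ 2 : ℝ) * 𝓕 (u σ) ξ - Complex.I * 𝓕 (cub (u σ)) ξ)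
        (Set.Icc s t) := fun σ hσ => hu.fourier_dt (hsub hσ) ξ
    refine ContinuousOn.congr ?_ this
    exact (continuousOn_const.mul (hu.continuousOn_fourier hs ht hK ξ)).sub
      (continuousOn_const.mul (hu.continuousOn_fourier_cub hs ht hK ξ))
  have hrep : ∀ σ ∈ Set.Icc s t,
      𝓕 (u s) ξ + ∫ r in s..σ, 𝓕 (dt u r) ξ = 𝓕 (u σ) ξ := fun σ hσ => by
    have hsub' : Set.Icc s σ ⊆ Set.Icc s t := Set.Icc_subset_Icc le_rfl hσ.2
    rw [intervalIntegral.integral_of_le hσ.1,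
      ← fourier_sub_eq_integral hσ.1 (hu.2.1 s (hsub ⟨le_rfl, hst⟩)) (hu.2.1 σ (hsub hσ))
      (fun τ _ x => hasDerivAt_dt hu.1 τ x) (contDiff_uncurry_dt hu.1).continuous
      (fun τ hτ => hu.isSchwartz_dt (hsub (hsub' hτ)))
      (fun τ hτ => (hu.fourierDecay_dt (hsub (hsub' hτ)) (hK τ (hsub' hτ))).mono (by norm_num)) ξ]
    ring
  have hmem : Set.Icc s t ∈ nhds τ := Icc_mem_nhds hτ.1 hτ.2
  have h1 : HasDerivAt (fun σ => 𝓕 (u s) ξ + ∫ r in s..σ, 𝓕 (dt u r) ξ) (𝓕 (dt u τ) ξ) τ := by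
    refine (intervalIntegral.integral_hasDerivAt_right ?_ ?_ (hgc.continuousAt hmem)).const_add _
    · refine (hgc.mono ?_).intervalIntegrable
      rw [Set.uIcc_of_le hτ.1.le]
      exact Set.Icc_subset_Icc le_rfl hτ.2.le
    · exact ⟨_, hmem, hgc.aestronglyMeasurable measurableSet_Icc⟩
  refine h1.congr_of_eventuallyEq ?_
  filter_upwards [hmem] with σ hσ using (hrep σ hσ).symm

/-- The modulus of `û(τ, ξ)` only changes through the nonlinearity. -/
theorem IsNLSSolution.abs_norm_fourier_sub_le (hu : IsNLSSolution 2 T u) {s t K : ℝ} (hs : 0 ≤ s)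
    (hst : s ≤ t) (ht : t ≤ T) (hK : ∀ τ ∈ Set.Icc s t, FourierDecay K 4 (u τ)) (ξ : Plane) :
    |‖𝓕 (u t) ξ‖ - ‖𝓕 (u s) ξ‖| ≤ ∫ τ in s..t, ‖𝓕 (cub (u τ)) ξ‖ := by
  set θ : ℝ := 4 * π ^ 2 * ‖ξ‖ ^ 2 with hθ
  have hsub : Set.Icc s t ⊆ Set.Icc 0 T := Set.Icc_subset_Icc hs ht
  have hE : ∀ τ : ℝ, ‖Complex.exp (θ * τ * Complex.I)‖ = 1 := fun τ => by
    rw [← Complex.ofReal_mul, Complex.norm_exp_ofReal_mul_I]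
  have hEd : ∀ τ : ℝ, HasDerivAt (fun τ : ℝ => Complex.exp (θ * τ * Complex.I))
      (Complex.exp (θ * τ * Complex.I) * (θ * Complex.I)) τ := fun τ => by
    have h0 : HasDerivAt (fun τ : ℝ => (θ : ℂ) * τ * Complex.I) (θ * 1 * Complex.I) τ :=
      ((Complex.ofRealCLM.hasDerivAt (x := τ)).const_mul (θ : ℂ)).mul_const Complex.I
    simpa using h0.cexp
  have hEc : Continuous fun τ : ℝ => Complex.exp (θ * τ * Complex.I) := by fun_prop
  have hNc := hu.continuousOn_fourier_cub hs ht hK ξ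
  have hcont : ContinuousOn (fun τ : ℝ => Complex.exp (θ * τ * Complex.I) *
      (-Complex.I * 𝓕 (cub (u τ)) ξ)) (Set.Icc s t) :=
    hEc.continuousOn.mul (continuousOn_const.mul hNc)
  have key : ∫ τ in s..t, Complex.exp (θ * τ * Complex.I) * (-Complex.I * 𝓕 (cub (u τ)) ξ) =
      Complex.exp (θ * t * Complex.I) * 𝓕 (u t) ξ -
        Complex.exp (θ * s * Complex.I) * 𝓕 (u s) ξ := by
    refine intervalIntegral.integral_eq_sub_of_hasDerivAt_of_le
      (f := fun τ : ℝ => Complex.exp (θ * τ * Complex.I) * 𝓕 (u τ) ξ) hst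
      (hEc.continuousOn.mul (hu.continuousOn_fourier hs ht hK ξ)) (fun τ hτ => ?_) ?_
    · have h := (hEd τ).mul (hu.hasDerivAt_fourier hs ht hK ξ hτ)
      rw [hu.fourier_dt (hsub (Set.Ioo_subset_Icc_self hτ)), ← hθ] at h
      exact h.congr_deriv (by ring)
    · refine ContinuousOn.intervalIntegrable ?_
      rwa [Set.uIcc_of_le hst]
  have h1 : |‖𝓕 (u t) ξ‖ - ‖𝓕 (u s) ξ‖| ≤
      ‖Complex.exp (θ * t * Complex.I) * 𝓕 (u t) ξ -
        Complex.exp (θ * s * Complex.I) * 𝓕 (u s) ξ‖ := by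
    have := abs_norm_sub_norm_le (Complex.exp (θ * t * Complex.I) * 𝓕 (u t) ξ)
      (Complex.exp (θ * s * Complex.I) * 𝓕 (u s) ξ)
    rwa [norm_mul, norm_mul, hE, hE, one_mul, one_mul] at this
  rw [← key] at h1
  refine h1.trans ((intervalIntegral.norm_integral_le_integral_norm hst).trans (le_of_eq ?_))
  refine intervalIntegral.integral_congr fun τ _ => ?_
  simp only [norm_mul, hE, norm_neg, Complex.norm_I, one_mul]

end Solution

/-- Differentiation under the integral sign, integrated in time. -/
theorem integral_sub_eq_integral_deriv {α : Type*} [MeasurableSpace α] {μ : Measure α} [SFinite μ]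
    {F F' : ℝ → α → ℝ} {s t K : ℝ} (hst : s ≤ t)
    (hd : ∀ x, ∀ τ ∈ Set.Ioo s t, HasDerivAt (fun σ => F σ x) (F' τ x) τ)
    (hc : ∀ x, ContinuousOn (fun σ => F σ x) (Set.Icc s t))
    (hc' : ∀ x, ContinuousOn (fun σ => F' σ x) (Set.Icc s t))
    (hm : AEStronglyMeasurable (Function.uncurry F') ((volume.restrict (Set.Ioc s t)).prod μ))
    (hi : ∀ τ ∈ Set.Ioc s t, Integrable (F' τ) μ)
    (hK : ∀ τ ∈ Set.Ioc s t, ∫ x, ‖F' τ x‖ ∂μ ≤ K)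
    (hs : Integrable (F s) μ) (ht : Integrable (F t) μ) :
    ∫ x, F t x ∂μ - ∫ x, F s x ∂μ = ∫ τ in Set.Ioc s t, ∫ x, F' τ x ∂μ := by
  have hprod : Integrable (Function.uncurry F') ((volume.restrict (Set.Ioc s t)).prod μ) := by
    rw [integrable_prod_iff hm]
    refine ⟨(ae_restrict_mem measurableSet_Ioc).mono hi, ?_⟩
    refine (integrable_const K).mono' hm.norm.integral_prod_right' ?_
    refine (ae_restrict_mem measurableSet_Ioc).mono fun τ hτ => ?_
    rw [Real.norm_of_nonneg (integral_nonneg fun _ => norm_nonneg _)]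
    exact hK τ hτ
  rw [integral_integral_swap hprod, ← integral_sub ht hs]
  refine integral_congr_ae (.of_forall fun x => ?_)
  simp only
  rw [← intervalIntegral.integral_of_le hst]
  refine (intervalIntegral.integral_eq_sub_of_hasDerivAt_of_le (f := fun σ => F σ x)
    (f' := fun σ => F' σ x) hst (hc x) (hd x) ?_).symm
  refine ContinuousOn.intervalIntegrable ?_
  rw [Set.uIcc_of_le hst]
  exact hc' x

theorem pd_mul {f g : Plane → ℂ} (hf : IsSchwartz f) (hg : IsSchwartz g) (j : Fin 2) :
    pd j (fun x => f x * g x) = fun x => pd j f x * g x + f x * pd j g x := by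
  ext x
  have := fderiv_mul (hf.differentiable x) (hg.differentiable x)
  simp only [pd]
  rw [show (fun x => f x * g x) = f * g from rfl, this]
  simp
  ring

theorem pd_conj {f : Plane → ℂ} (j : Fin 2) :
    pd j (fun x => (starRingEnd ℂ) (f x)) = fun x => (starRingEnd ℂ) (pd j f x) := by
  ext x
  have : fderiv ℝ (fun x => (starRingEnd ℂ) (f x)) x =
      (Complex.conjCLE : ℂ →L[ℝ] ℂ).comp (fderiv ℝ f x) :=
    Complex.conjCLE.comp_fderiv
  simp [pd, this]

theorem lap_conj {f : Plane → ℂ} :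
    lap (fun x => (starRingEnd ℂ) (f x)) = fun x => (starRingEnd ℂ) (lap f x) := by
  ext x
  simp only [lap, pd_conj, map_sum]

theorem integral_mul_pd {f g : Plane → ℂ} (hf : IsSchwartz f) (hg : IsSchwartz g) (j : Fin 2) :
    ∫ x, f x * pd j g x = -∫ x, pd j f x * g x := by
  have h := (hf.mul hg).integral_pd_eq_zero j
  rw [pd_mul hf hg, integral_add ((hf.pd j).mul hg).integrable (hf.mul (hg.pd j)).integrable] at h
  linear_combination h

theorem integral_mul_lap {f g : Plane → ℂ} (hf : IsSchwartz f) (hg : IsSchwartz g) :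
    ∫ x, f x * lap g x = -∫ x, ∑ j, pd j f x * pd j g x := by
  simp only [lap, Finset.mul_sum]
  rw [integral_finsetSum _ fun j _ => (hf.mul ((hg.pd j).pd j)).integrable,
    integral_finsetSum _ fun j _ => ((hf.pd j).mul (hg.pd j)).integrable,
    ← Finset.sum_neg_distrib]
  exact Finset.sum_congr rfl fun j _ => integral_mul_pd hf (hg.pd j) j

theorem IsSchwartz.integrable_norm_sq {f : Plane → ℂ} (hf : IsSchwartz f) :
    Integrable fun x => ‖f x‖ ^ 2 := by
  have := (hf.conj.mul hf).integrable.norm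
  refine this.congr (.of_forall fun x => ?_)
  simp [sq]

/-- A time-family of Schwartz functions with uniform Fourier decay. -/
def UniformDecay (S : Set ℝ) (k : ℕ) (F : ℝ → Plane → ℂ) : Prop :=
  (∀ t ∈ S, IsSchwartz (F t)) ∧ ∃ K, ∀ t ∈ S, FourierDecay K k (F t)

namespace UniformDecay

variable {S : Set ℝ} {k : ℕ} {F G : ℝ → Plane → ℂ}

theorem mono {l : ℕ} (h : UniformDecay S k F) (hl : l ≤ k) : UniformDecay S l F :=
  ⟨h.1, h.2.imp fun _ hK t ht => (hK t ht).mono hl⟩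

theorem mono_set {S' : Set ℝ} (h : UniformDecay S k F) (hS : S' ⊆ S) : UniformDecay S' k F :=
  ⟨fun t ht => h.1 t (hS ht), h.2.imp fun _ hK t ht => hK t (hS ht)⟩

theorem congr (h : UniformDecay S k F) (hFG : ∀ t ∈ S, G t = F t) : UniformDecay S k G :=
  ⟨fun t ht => hFG t ht ▸ h.1 t ht, h.2.imp fun _ hK t ht => hFG t ht ▸ hK t ht⟩

theorem add (hF : UniformDecay S k F) (hG : UniformDecay S k G) :
    UniformDecay S k (fun t x => F t x + G t x) := by
  obtain ⟨hF, K, hK⟩ := hF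
  obtain ⟨hG, L, hL⟩ := hG
  exact ⟨fun t ht => (hF t ht).add (hG t ht), K + L, fun t ht =>
    FourierDecay.add (hF t ht) (hG t ht) (hK t ht) (hL t ht)⟩

theorem const_mul (c : ℂ) (hF : UniformDecay S k F) : UniformDecay S k (fun t x => c * F t x) := by
  obtain ⟨hF, K, hK⟩ := hF
  exact ⟨fun t ht => (hF t ht).const_mul c, _, fun t ht => (hK t ht).const_mul c⟩

theorem conj (hF : UniformDecay S k F) :
    UniformDecay S k (fun t x => (starRingEnd ℂ) (F t x)) := by
  obtain ⟨hF, K, hK⟩ := hF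
  exact ⟨fun t ht => (hF t ht).conj, K, fun t ht => (hK t ht).conj⟩

theorem pd (hF : UniformDecay S (k + 1) F) (j : Fin 2) :
    UniformDecay S k (fun t => _root_.pd j (F t)) := by
  obtain ⟨hF, K, hK⟩ := hF
  exact ⟨fun t ht => (hF t ht).pd j, _, fun t ht => FourierDecay.pd (hF t ht) (hK t ht) j⟩

theorem lap (hF : UniformDecay S (k + 1) F) : UniformDecay S k (fun t => _root_.lap (F t)) := by
  obtain ⟨hF, K, hK⟩ := hF
  exact ⟨fun t ht => (hF t ht).lap, _, fun t ht => FourierDecay.lap (hF t ht) (hK t ht)⟩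

theorem mul (hk : 2 ≤ k) (hF : UniformDecay S k F) (hG : UniformDecay S k G) :
    UniformDecay S k (fun t x => F t x * G t x) := by
  obtain ⟨hF, K, hK⟩ := hF
  obtain ⟨hG, L, hL⟩ := hG
  refine ⟨fun t ht => (hF t ht).mul (hG t ht), 4 ^ k * (K * (L * jbInt) + K * jbInt * L),
    fun t ht => ?_⟩
  refine (FourierDecay.mul (hF t ht) (hG t ht) (hK t ht) (hL t ht)).mono_const ?_
  have h1 := (hK t ht).wienerNorm_le hk
  have h2 := (hL t ht).wienerNorm_le hk
  have h3 := (hK t ht).nonneg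
  have h4 := (hL t ht).nonneg
  gcongr

theorem cub (hk : 2 ≤ k) (hF : UniformDecay S k F) : UniformDecay S k (fun t => cub (F t)) := by
  simp only [cub_eq]
  exact (hF.mul hk hF.conj).mul hk hF

theorem exists_norm_le (hk : 2 ≤ k) (hF : UniformDecay S k F) :
    ∃ C, 0 ≤ C ∧ ∀ t ∈ S, ∀ x, ‖F t x‖ ≤ C := by
  obtain ⟨hF, K, hK⟩ := hF
  refine ⟨|K| * jbInt, mul_nonneg (abs_nonneg _) jbInt_nonneg, fun t ht x => ?_⟩
  exact ((hK t ht).norm_apply_le hk (hF t ht) x).trans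
    (mul_le_mul_of_nonneg_right (le_abs_self K) jbInt_nonneg)

theorem exists_integral_norm_sq_le (hk : 1 ≤ k) (hF : UniformDecay S k F) :
    ∃ C, 0 ≤ C ∧ ∀ t ∈ S, ∫ x, ‖F t x‖ ^ 2 ≤ C := by
  obtain ⟨hF, K, hK⟩ := hF
  exact ⟨K ^ 2 * jbInt, mul_nonneg (sq_nonneg K) jbInt_nonneg, fun t ht =>
    (hK t ht).integral_norm_sq_le hk (hF t ht)⟩

theorem exists_integral_norm_mul_le (hk : 1 ≤ k) (hF : UniformDecay S k F)
    (hG : UniformDecay S k G) : ∃ C, 0 ≤ C ∧ ∀ t ∈ S, ∫ x, ‖F t x * G t x‖ ≤ C := by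
  obtain ⟨K, hK0, hK⟩ := hF.exists_integral_norm_sq_le hk
  obtain ⟨L, hL0, hL⟩ := hG.exists_integral_norm_sq_le hk
  refine ⟨K + L, by positivity, fun t ht => ?_⟩
  have hFi := (hF.1 t ht).integrable_norm_sq
  have hGi := (hG.1 t ht).integrable_norm_sq
  calc ∫ x, ‖F t x * G t x‖ ≤ ∫ x, (‖F t x‖ ^ 2 + ‖G t x‖ ^ 2) := by
        refine integral_mono ((hF.1 t ht).mul (hG.1 t ht)).integrable.norm (hFi.add hGi) fun x => ?_
        simp only [norm_mul]
        nlinarith [sq_nonneg (‖F t x‖ - ‖G t x‖), sq_nonneg ‖F t x‖, sq_nonneg ‖G t x‖]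
    _ ≤ K + L := by
        rw [integral_add hFi hGi]
        exact add_le_add (hK t ht) (hL t ht)

end UniformDecay

theorem IsNLSSolution.uniformDecay_dt {T : ℝ} {u : ℝ → Plane → ℂ} (hu : IsNLSSolution 2 T u)
    {S : Set ℝ} (hS : S ⊆ Set.Icc 0 T) (h : UniformDecay S 4 u) :
    UniformDecay S 3 (dt u) :=
  ((h.lap.const_mul Complex.I).add
    (((h.mono (by norm_num)).cub (by norm_num)).const_mul (-Complex.I))).congr
      fun _ ht => hu.dt_eq (hS ht)

theorem hasDerivAt_norm_sq {f : ℝ → ℂ} {f' : ℂ} {t : ℝ} (h : HasDerivAt f f' t) :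
    HasDerivAt (fun s => ‖f s‖ ^ 2) (2 * ((starRingEnd ℂ) (f t) * f').re) t := by
  have := h.norm_sq
  rw [Complex.inner, mul_comm f'] at this
  exact this

theorem integral_re_complex {f : Plane → ℂ} (hf : Integrable f) :
    ∫ x, (f x).re = (∫ x, f x).re := integral_re hf

/-- The energy density. -/
def energyDensity (f : Plane → ℂ) (x : Plane) : ℝ :=
  1 / 2 * ∑ j, ‖pd j f x‖ ^ 2 + 1 / 4 * ‖f x‖ ^ 4

theorem IsSchwartz.integrable_energyDensity {f : Plane → ℂ} (hf : IsSchwartz f) :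
    Integrable (energyDensity f) := by
  refine Integrable.add (Integrable.const_mul ?_ _) (Integrable.const_mul ?_ _)
  · exact integrable_finsetSum _ fun j _ => (hf.pd j).integrable_norm_sq
  · refine (hf.mul hf).integrable_norm_sq.congr (.of_forall fun x => ?_)
    simp only [norm_mul]
    ring

section Conservation

variable {T s t : ℝ} {u : ℝ → Plane → ℂ}

theorem IsNLSSolution.mass_eq (hu : IsNLSSolution 2 T u) (hs : 0 ≤ s) (hst : s ≤ t) (ht : t ≤ T)
    (h : UniformDecay (Set.Icc s t) 4 u) : ∫ x, ‖u t x‖ ^ 2 = ∫ x, ‖u s x‖ ^ 2 := by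
  have hsub : Set.Icc s t ⊆ Set.Icc 0 T := Set.Icc_subset_Icc hs ht
  have hS := h.1
  have hSd : ∀ τ ∈ Set.Icc s t, IsSchwartz (dt u τ) := fun τ hτ => hu.isSchwartz_dt (hsub hτ)
  have hdc := (contDiff_uncurry_dt hu.1).continuous
  have huc := hu.1.continuous
  obtain ⟨K, hK0, hK⟩ := (h.mono (by norm_num : 1 ≤ 4)).conj.exists_integral_norm_mul_le le_rfl
    ((hu.uniformDecay_dt hsub h).mono (by norm_num))
  have hF'c : Continuous (Function.uncurry fun τ x =>
      2 * ((starRingEnd ℂ) (u τ x) * dt u τ x).re) :=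
    continuous_const.mul (Complex.continuous_re.comp ((Complex.continuous_conj.comp huc).mul hdc))
  have hint : ∀ τ ∈ Set.Icc s t, Integrable fun x => (starRingEnd ℂ) (u τ x) * dt u τ x :=
    fun τ hτ => ((hS τ hτ).conj.mul (hSd τ hτ)).integrable
  have key := integral_sub_eq_integral_deriv (μ := (volume : Measure Plane)) (K := 2 * K)
    (F := fun τ x => ‖u τ x‖ ^ 2) (F' := fun τ x => 2 * ((starRingEnd ℂ) (u τ x) * dt u τ x).re)
    hst (fun x τ _ => hasDerivAt_norm_sq (hasDerivAt_dt hu.1 τ x))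
    (fun x => ((huc.comp (continuous_id.prodMk continuous_const)).norm.pow 2).continuousOn)
    (fun x => (hF'c.comp (continuous_id.prodMk continuous_const)).continuousOn)
    hF'c.aestronglyMeasurable
    (fun τ hτ => (hint τ (Set.Ioc_subset_Icc_self hτ)).re.const_mul 2)
    (fun τ hτ => ?_) (hS s ⟨le_rfl, hst⟩).integrable_norm_sq (hS t ⟨hst, le_rfl⟩).integrable_norm_sq
  · have hz : ∀ τ ∈ Set.Ioc s t, ∫ x, 2 * ((starRingEnd ℂ) (u τ x) * dt u τ x).re = 0 := by
      intro τ hτ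
      have hτ' := Set.Ioc_subset_Icc_self hτ
      have hSτ := hS τ hτ'
      rw [integral_const_mul]
      have e1 : ∀ x, ((starRingEnd ℂ) (u τ x) * dt u τ x).re =
          (Complex.I * ((starRingEnd ℂ) (u τ x) * lap (u τ) x)).re := fun x => by
        rw [hu.dt_eq (hsub hτ')]
        have : (starRingEnd ℂ) (u τ x) * (Complex.I * lap (u τ) x + -Complex.I * cub (u τ) x) =
            Complex.I * ((starRingEnd ℂ) (u τ x) * lap (u τ) x)
              - ((‖u τ x‖ ^ 4 : ℝ) : ℂ) * Complex.I := by
          have : (starRingEnd ℂ) (u τ x) * cub (u τ) x = ((‖u τ x‖ ^ 4 : ℝ) : ℂ) := by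
            rw [cub, mul_left_comm, Complex.conj_mul']
            push_cast
            ring
          linear_combination (-Complex.I) * this
        rw [this, Complex.sub_re, Complex.re_ofReal_mul, Complex.I_re, mul_zero, sub_zero]
      simp only [e1]
      rw [integral_re_complex ((hSτ.conj.mul hSτ.lap).const_mul Complex.I).integrable,
        integral_const_mul, integral_mul_lap hSτ.conj hSτ]
      have e2 : ∀ x, ∑ j, pd j (fun x => (starRingEnd ℂ) (u τ x)) x * pd j (u τ) x =
          ((∑ j, ‖pd j (u τ) x‖ ^ 2 : ℝ) : ℂ) := fun x => by
        simp only [pd_conj, Complex.conj_mul']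
        push_cast
        rfl
      simp only [e2]
      rw [integral_complex_ofReal]
      simp
    rw [setIntegral_congr_fun measurableSet_Ioc hz] at key
    simp only [integral_zero] at key
    linarith
  · have hτ' := Set.Ioc_subset_Icc_self hτ
    refine le_trans ?_ (mul_le_mul_of_nonneg_left (hK τ hτ') two_pos.le)
    rw [← integral_const_mul]
    refine integral_mono ((hint τ hτ').re.const_mul 2).norm ((hint τ hτ').norm.const_mul 2)
      fun x => ?_
    rw [Real.norm_eq_abs, abs_mul, abs_two]
    exact mul_le_mul_of_nonneg_left (Complex.abs_re_le_norm _) two_pos.le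

theorem hasDerivAt_energyDensity (hu : ContDiff ℝ ∞ (Function.uncurry u)) (t : ℝ) (x : Plane) :
    HasDerivAt (fun τ => energyDensity (u τ) x)
      (∑ j, (starRingEnd ℂ) (pd j (u t) x) * pd j (dt u t) x
        + (starRingEnd ℂ) (cub (u t) x) * dt u t x).re t := by
  have h1 : ∀ j ∈ Finset.univ, HasDerivAt (fun τ => ‖pd j (u τ) x‖ ^ 2)
      (2 * ((starRingEnd ℂ) (pd j (u t) x) * pd j (dt u t) x).re) t := fun j _ => by
    have := hasDerivAt_norm_sq (hasDerivAt_dt (contDiff_uncurry_pd hu j) t x)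
    rwa [dt_pd_comm hu] at this
  have h2 := (hasDerivAt_norm_sq (hasDerivAt_dt hu t x)).pow 2
  have h3 := ((HasDerivAt.fun_sum h1).const_mul (1 / 2)).add (h2.const_mul (1 / 4))
  refine (h3.congr_deriv ?_).congr_of_eventuallyEq (.of_forall fun τ => ?_)
  · rw [Complex.add_re, Complex.re_sum, ← Finset.mul_sum]
    have : ((starRingEnd ℂ) (cub (u t) x) * dt u t x) =
        ((‖u t x‖ ^ 2 : ℝ) : ℂ) * ((starRingEnd ℂ) (u t x) * dt u t x) := by
      simp only [cub, map_mul, Complex.conj_ofReal]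
      ring
    rw [this, Complex.re_ofReal_mul]
    push_cast
    ring
  · simp only [energyDensity, Pi.add_apply, Pi.pow_apply]
    ring

theorem IsNLSSolution.energy_eq (hu : IsNLSSolution 2 T u) (hs : 0 ≤ s) (hst : s ≤ t) (ht : t ≤ T)
    (h : UniformDecay (Set.Icc s t) 4 u) :
    ∫ x, energyDensity (u t) x = ∫ x, energyDensity (u s) x := by
  have hsub : Set.Icc s t ⊆ Set.Icc 0 T := Set.Icc_subset_Icc hs ht
  have hS := h.1
  have hSd : ∀ τ ∈ Set.Icc s t, IsSchwartz (dt u τ) := fun τ hτ => hu.isSchwartz_dt (hsub hτ)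
  have hdC := contDiff_uncurry_dt hu.1
  have hdc := hdC.continuous
  have huc := hu.1.continuous
  have hcc : Continuous (Function.uncurry fun τ x => cub (u τ) x) :=
    (Complex.continuous_ofReal.comp (huc.norm.pow 2)).mul huc
  have hdd := hu.uniformDecay_dt hsub h
  choose K hK0 hK using fun j => (UniformDecay.pd h j).conj.mono (by norm_num : 1 ≤ 3)
    |>.exists_integral_norm_mul_le le_rfl ((UniformDecay.pd hdd j).mono (by norm_num))
  obtain ⟨L, hL0, hL⟩ := (h.cub (by norm_num)).conj.mono (by norm_num : 1 ≤ 4)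
    |>.exists_integral_norm_mul_le le_rfl (hdd.mono (by norm_num))
  obtain ⟨G, hG⟩ : ∃ G : ℝ → Plane → ℂ, G = fun τ x =>
    ∑ j, (starRingEnd ℂ) (pd j (u τ) x) * pd j (dt u τ) x
        + (starRingEnd ℂ) (cub (u τ) x) * dt u τ x := ⟨_, rfl⟩
  have hGc : Continuous (Function.uncurry G) := by
    rw [hG]
    refine Continuous.add (continuous_finsetSum _ fun j _ => ?_)
      ((Complex.continuous_conj.comp hcc).mul hdc)
    exact (Complex.continuous_conj.comp (contDiff_uncurry_pd hu.1 j).continuous).mul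
      (contDiff_uncurry_pd hdC j).continuous
  have hi1 : ∀ τ ∈ Set.Icc s t, ∀ j, Integrable fun x =>
      (starRingEnd ℂ) (pd j (u τ) x) * pd j (dt u τ) x := fun τ hτ j =>
    (((hS τ hτ).pd j).conj.mul ((hSd τ hτ).pd j)).integrable
  have hi2 : ∀ τ ∈ Set.Icc s t, Integrable fun x => (starRingEnd ℂ) (cub (u τ) x) * dt u τ x :=
    fun τ hτ => ((hS τ hτ).cub.conj.mul (hSd τ hτ)).integrable
  have hGi : ∀ τ ∈ Set.Icc s t, Integrable (G τ) := fun τ hτ => by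
    rw [hG]
    exact (integrable_finsetSum _ fun j _ => hi1 τ hτ j).add (hi2 τ hτ)
  have hGK : ∀ τ ∈ Set.Icc s t, ∫ x, ‖G τ x‖ ≤ ∑ j, K j + L := fun τ hτ => by
    calc ∫ x, ‖G τ x‖ ≤ ∫ x, (∑ j, ‖(starRingEnd ℂ) (pd j (u τ) x) * pd j (dt u τ) x‖
            + ‖(starRingEnd ℂ) (cub (u τ) x) * dt u τ x‖) := by
          refine integral_mono (hGi τ hτ).norm ((integrable_finsetSum _ fun j _ =>
            (hi1 τ hτ j).norm).add (hi2 τ hτ).norm) fun x => ?_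
          rw [hG]
          exact (norm_add_le _ _).trans (add_le_add_left (norm_sum_le _ _) _)
      _ ≤ ∑ j, K j + L := by
          rw [integral_add (integrable_finsetSum _ fun j _ => (hi1 τ hτ j).norm) (hi2 τ hτ).norm,
            integral_finsetSum _ fun j _ => (hi1 τ hτ j).norm]
          exact add_le_add (Finset.sum_le_sum fun j _ => hK j τ hτ) (hL τ hτ)
  have hed : ∀ x, Continuous fun τ => energyDensity (u τ) x := fun x =>
    continuous_iff_continuousAt.2 fun τ => (hasDerivAt_energyDensity hu.1 τ x).continuousAt
  have key := integral_sub_eq_integral_deriv (μ := (volume : Measure Plane)) (K := ∑ j, K j + L)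
    (F := fun τ x => energyDensity (u τ) x) (F' := fun τ x => (G τ x).re)
    hst (fun x τ _ => by
      rw [hG]
      exact hasDerivAt_energyDensity hu.1 τ x)
    (fun x => (hed x).continuousOn)
    (fun x => ((Complex.continuous_re.comp hGc).comp
      (continuous_id.prodMk continuous_const)).continuousOn)
    (Complex.continuous_re.comp hGc).aestronglyMeasurable
    (fun τ hτ => (hGi τ (Set.Ioc_subset_Icc_self hτ)).re)
    (fun τ hτ => ?_) (hS s ⟨le_rfl, hst⟩).integrable_energyDensity
    (hS t ⟨hst, le_rfl⟩).integrable_energyDensity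
  · have hz : ∀ τ ∈ Set.Ioc s t, ∫ x, (G τ x).re = 0 := by
      intro τ hτ
      have hτ' := Set.Ioc_subset_Icc_self hτ
      have hSτ := hS τ hτ'
      have hdτ := hSd τ hτ'
      rw [integral_re_complex (hGi τ hτ'), hG]
      simp only
      rw [integral_add (integrable_finsetSum _ fun j _ => hi1 τ hτ' j) (hi2 τ hτ')]
      have e1 := integral_mul_lap hdτ hSτ.conj
      have e2 : ∀ x, ∑ j, pd j (dt u τ) x * pd j (fun x => (starRingEnd ℂ) (u τ x)) x =
          ∑ j, (starRingEnd ℂ) (pd j (u τ) x) * pd j (dt u τ) x := fun x =>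
        Finset.sum_congr rfl fun j _ => by rw [pd_conj, mul_comm]
      simp only [e2] at e1
      rw [eq_neg_iff_add_eq_zero.2 ((add_comm _ _).trans (eq_neg_iff_add_eq_zero.1 e1)),
        ← integral_neg, ← integral_add
          (f := fun x => -(dt u τ x * lap (fun x => (starRingEnd ℂ) (u τ x)) x))
          (hdτ.mul hSτ.conj.lap).integrable.neg (hi2 τ hτ')]
      have e3 : ∀ x, -(dt u τ x * lap (fun x => (starRingEnd ℂ) (u τ x)) x) +
          (starRingEnd ℂ) (cub (u τ) x) * dt u τ x =
            -Complex.I * ((‖dt u τ x‖ ^ 2 : ℝ) : ℂ) := fun x => by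
        have h1 : cub (u τ) x = lap (u τ) x + Complex.I * dt u τ x := by
          rw [hu.dt_eq (hsub hτ')]
          linear_combination (cub (u τ) x - lap (u τ) x) * Complex.I_mul_I
        have h2 : (starRingEnd ℂ) (dt u τ x) * dt u τ x = ((‖dt u τ x‖ ^ 2 : ℝ) : ℂ) := by
          rw [Complex.conj_mul']
          push_cast
          rfl
        rw [h1, lap_conj, map_add, map_mul, Complex.conj_I, ← h2]
        ring
      simp only [e3]
      rw [integral_const_mul, integral_complex_ofReal]
      simp
    rw [setIntegral_congr_fun measurableSet_Ioc hz] at key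
    simp only [integral_zero] at key
    linarith
  · have hτ' := Set.Ioc_subset_Icc_self hτ
    exact (integral_mono (hGi τ hτ').re.norm (hGi τ hτ').norm fun x =>
      Complex.abs_re_le_norm _).trans (hGK τ hτ')

end Conservation

/-- The volume of the unit ball of the plane. -/
def discVol : ℝ := (volume : Measure Plane).real (Metric.ball 0 1)

theorem integrable_jb_rpow_neg {ε : ℝ} (hε : 0 < ε) :
    Integrable fun ξ : Plane => jb ξ ^ (-(1 + ε)) := by
  have h := integrable_rpow_neg_one_add_norm_sq (E := Plane) (r := 2 * (1 + ε)) (μ := volume) (by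
    simp
    linarith)
  refine h.congr (.of_forall fun ξ => ?_)
  simp only [jb]
  congr 1
  ring

theorem integral_jb_rpow_neg {ε : ℝ} (hε : 0 < ε) :
    ∫ ξ : Plane, jb ξ ^ (-(1 + ε)) = discVol / ε := by
  have h1 := integral_fun_norm_addHaar (volume : Measure Plane)
    (fun r : ℝ => (1 + r ^ 2) ^ (-(1 + ε)))
  have hd : Module.finrank ℝ Plane = 2 := by simp
  rw [hd] at h1
  have h2 : ∫ r in Set.Ioi (0 : ℝ), r ^ (2 - 1) • (1 + r ^ 2) ^ (-(1 + ε)) = 1 / (2 * ε) := by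
    have hder : ∀ r ∈ Set.Ici (0 : ℝ), HasDerivAt (fun r : ℝ => -(1 + r ^ 2) ^ (-ε) / (2 * ε))
        (r ^ (2 - 1) • (1 + r ^ 2) ^ (-(1 + ε))) r := fun r _ => by
      have hb : HasDerivAt (fun r : ℝ => 1 + r ^ 2) (2 * r) r := by
        simpa using (hasDerivAt_pow 2 r).const_add 1
      have := (hb.rpow_const (p := -ε) (Or.inl (by positivity))).neg.div_const (2 * ε)
      refine this.congr_deriv ?_
      rw [show -ε - 1 = -(1 + ε) by ring]
      simp only [Nat.add_one_sub_one, pow_one, smul_eq_mul]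
      field_simp
    have ht : Filter.Tendsto (fun r : ℝ => -(1 + r ^ 2) ^ (-ε) / (2 * ε)) Filter.atTop
        (nhds 0) := by
      have hb : Filter.Tendsto (fun r : ℝ => 1 + r ^ 2) Filter.atTop Filter.atTop :=
        Filter.tendsto_atTop_add_const_left _ _ (Filter.tendsto_pow_atTop two_ne_zero)
      have := ((tendsto_rpow_neg_atTop hε).comp hb).neg.div_const (2 * ε)
      simpa using this
    rw [integral_Ioi_of_hasDerivAt_of_nonneg' hder (fun r hr => ?_) ht]
    · simp
      ring
    · have : (0 : ℝ) < r := hr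
      simp only [smul_eq_mul]
      positivity
  rw [h2] at h1
  unfold jb discVol
  rw [h1]
  simp only [nsmul_eq_mul, smul_eq_mul]
  push_cast
  field_simp

theorem IsSchwartz.integrable_norm_sq_mul_jb {f : Plane → ℂ} (hf : IsSchwartz f) :
    Integrable fun ξ => jb ξ * ‖𝓕 f ξ‖ ^ 2 := by
  have h1 := hf.fourier.integrable_norm_sq
  have h2 : ∀ j, Integrable fun ξ => ‖𝓕 (_root_.pd j f) ξ‖ ^ 2 := fun j =>
    (hf.pd j).fourier.integrable_norm_sq
  have h3 := h1.add ((integrable_finsetSum Finset.univ fun j _ => h2 j).const_mul (4 * π ^ 2)⁻¹)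
  refine h3.congr (.of_forall fun ξ => ?_)
  simp only [Pi.add_apply, hf.fourier_pd, norm_mul, mul_pow, jb, ← Finset.sum_mul, ← Finset.mul_sum]
  simp only [EuclideanSpace.norm_sq_eq, Complex.norm_real, Complex.norm_I, Complex.norm_ofNat]
  rw [Real.norm_of_nonneg Real.pi_pos.le]
  field_simp
  ring

theorem IsSchwartz.integral_norm_sq_mul_jb {f : Plane → ℂ} (hf : IsSchwartz f) :
    ∫ ξ, jb ξ * ‖𝓕 f ξ‖ ^ 2 =
      (∫ x, ‖f x‖ ^ 2) + (4 * π ^ 2)⁻¹ * ∫ x, ∑ j, ‖_root_.pd j f x‖ ^ 2 := by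
  rw [integral_finsetSum _ fun j _ => (hf.pd j).integrable_norm_sq]
  simp only [← (hf.pd _).integral_norm_sq_fourier, ← hf.integral_norm_sq_fourier]
  have h2 : ∀ j ∈ Finset.univ, Integrable fun ξ => ‖𝓕 (_root_.pd j f) ξ‖ ^ 2 := fun j _ =>
    (hf.pd j).fourier.integrable_norm_sq
  rw [← integral_finsetSum _ h2, ← integral_const_mul, ← integral_add hf.fourier.integrable_norm_sq
    ((integrable_finsetSum _ h2).const_mul _)]
  refine integral_congr_ae (.of_forall fun ξ => ?_)
  simp only [hf.fourier_pd, norm_mul, mul_pow, jb, ← Finset.sum_mul, ← Finset.mul_sum]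
  simp only [EuclideanSpace.norm_sq_eq, Complex.norm_real, Complex.norm_I, Complex.norm_ofNat]
  rw [Real.norm_of_nonneg Real.pi_pos.le]
  field_simp
  ring

/-- The constant in the logarithmic Sobolev-type inequality. -/
def bgConst (H : ℝ) : ℝ := (2 * (H + jbInt) + discVol) ^ 2

theorem FourierDecay.sq_wienerNorm_le {f : Plane → ℂ} (hf : IsSchwartz f) {K H : ℝ}
    (hK : FourierDecay K 4 f) (hH : ∫ ξ, jb ξ * ‖𝓕 f ξ‖ ^ 2 ≤ H) :
    wienerNorm f ^ 2 ≤ bgConst H * Real.log (3 + K) := by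
  have hK0 := hK.nonneg
  have hl1 : 1 ≤ Real.log (3 + K) := by
    rw [Real.le_log_iff_exp_le (by positivity)]
    linarith [Real.exp_one_lt_d9]
  obtain ⟨l, hl⟩ : ∃ l, l = Real.log (3 + K) := ⟨_, rfl⟩
  obtain ⟨ε, hε⟩ : ∃ ε, ε = 1 / (2 * l) := ⟨_, rfl⟩
  rw [← hl] at hl1 ⊢
  have hl0 : 0 < l := by linarith
  have hε0 : 0 < ε := by rw [hε]; positivity
  have hε1 : ε ≤ 1 := by
    rw [hε, div_le_one (by positivity)]
    linarith
  have hr0 : 0 < √l := Real.sqrt_pos.2 hl0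
  have hrr : √l * √l = l := Real.mul_self_sqrt hl0.le
  have hw : ∀ ξ, jb ξ ^ (1 + ε) * ‖𝓕 f ξ‖ ^ 2 ≤ 4 * (jb ξ * ‖𝓕 f ξ‖ ^ 2 + (jb ξ ^ 2)⁻¹) := by
    intro ξ
    have hj := jb_pos ξ
    have hj1 := one_le_jb ξ
    have hΛ : ((3 + K) ^ 2 : ℝ) ^ ε ≤ 4 := by
      rw [← Real.rpow_natCast, ← Real.rpow_mul (by positivity),
        Real.rpow_def_of_pos (by positivity), ← hl, hε]
      have : l * (((2 : ℕ) : ℝ) * (1 / (2 * l))) = 1 := by push_cast; field_simp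
      rw [this]
      linarith [Real.exp_one_lt_d9]
    have hx : (jb ξ / (3 + K) ^ 2) ^ ε ≤ 1 + jb ξ / (3 + K) ^ 2 := by
      have hq : 0 ≤ jb ξ / (3 + K) ^ 2 := by positivity
      rcases le_total (jb ξ / (3 + K) ^ 2) 1 with h | h
      · linarith [Real.rpow_le_one hq h hε0.le]
      · have := Real.rpow_le_rpow_of_exponent_le h hε1
        rw [Real.rpow_one] at this
        linarith
    have hjε : jb ξ ^ ε ≤ 4 * (1 + jb ξ / (3 + K) ^ 2) := by
      have : jb ξ = (3 + K) ^ 2 * (jb ξ / (3 + K) ^ 2) := by field_simp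
      calc jb ξ ^ ε = ((3 + K) ^ 2 : ℝ) ^ ε * (jb ξ / (3 + K) ^ 2) ^ ε := by
            rw [← Real.mul_rpow (by positivity) (by positivity), ← this]
        _ ≤ 4 * (1 + jb ξ / (3 + K) ^ 2) := by gcongr
    rw [Real.rpow_add hj, Real.rpow_one]
    have hdec : jb ξ * (jb ξ / (3 + K) ^ 2) * ‖𝓕 f ξ‖ ^ 2 ≤ (jb ξ ^ 2)⁻¹ := by
      rw [mul_div_assoc', div_mul_eq_mul_div, div_le_iff₀ (by positivity),
        ← div_eq_inv_mul, le_div_iff₀ (by positivity)]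
      have h1 := hK ξ
      have h2 : ‖𝓕 f ξ‖ * jb ξ ^ 2 ≤ 3 + K := by
        have : ‖𝓕 f ξ‖ * jb ξ ^ 2 ≤ ‖𝓕 f ξ‖ * jb ξ ^ 4 :=
          mul_le_mul_of_nonneg_left (pow_le_pow_right₀ hj1 (by norm_num)) (norm_nonneg _)
        linarith
      have := pow_le_pow_left₀ (by positivity) h2 2
      calc _ = (‖𝓕 f ξ‖ * jb ξ ^ 2) ^ 2 := by ring
        _ ≤ _ := this
    calc jb ξ * jb ξ ^ ε * ‖𝓕 f ξ‖ ^ 2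
        ≤ jb ξ * (4 * (1 + jb ξ / (3 + K) ^ 2)) * ‖𝓕 f ξ‖ ^ 2 := by gcongr
      _ = 4 * (jb ξ * ‖𝓕 f ξ‖ ^ 2 + jb ξ * (jb ξ / (3 + K) ^ 2) * ‖𝓕 f ξ‖ ^ 2) := by ring
      _ ≤ _ := by gcongr
  have hp : ∀ ξ, ‖𝓕 f ξ‖ ≤ √l * 2 * (jb ξ * ‖𝓕 f ξ‖ ^ 2 + (jb ξ ^ 2)⁻¹)
      + (2 * √l)⁻¹ * jb ξ ^ (-(1 + ε)) := by
    intro ξ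
    have hj := jb_pos ξ
    have h1 := hw ξ
    obtain ⟨q, hq⟩ : ∃ q, q = jb ξ ^ (1 + ε) := ⟨_, rfl⟩
    have hq0 : 0 < q := by rw [hq]; positivity
    rw [Real.rpow_neg hj.le]
    rw [← hq] at h1 ⊢
    have h2 : ‖𝓕 f ξ‖ ≤ √l / 2 * (q * ‖𝓕 f ξ‖ ^ 2) + (2 * √l)⁻¹ * q⁻¹ := by
      have h3 : 0 ≤ (√l * q * ‖𝓕 f ξ‖ - 1) ^ 2 / (2 * √l * q) := by positivity
      have h4 : (√l * q * ‖𝓕 f ξ‖ - 1) ^ 2 / (2 * √l * q) =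
          √l / 2 * (q * ‖𝓕 f ξ‖ ^ 2) + (2 * √l)⁻¹ * q⁻¹ - ‖𝓕 f ξ‖ := by
        field_simp
        ring
      linarith
    have h3 := mul_le_mul_of_nonneg_left h1 (by positivity : 0 ≤ √l / 2)
    linarith
  have hA : wienerNorm f ≤ √l * (2 * (H + jbInt) + discVol) := by
    have i1 : Integrable fun ξ => √l * 2 * (jb ξ * ‖𝓕 f ξ‖ ^ 2 + (jb ξ ^ 2)⁻¹) :=
      (hf.integrable_norm_sq_mul_jb.add (integrable_inv_jb_pow le_rfl)).const_mul _
    have i2 := (integrable_jb_rpow_neg hε0).const_mul (2 * √l)⁻¹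
    have := integral_mono_of_nonneg (.of_forall fun ξ => norm_nonneg _) (i1.add i2) (.of_forall hp)
    refine this.trans ?_
    simp only [Pi.add_apply]
    rw [integral_add i1 i2, integral_const_mul, integral_const_mul, integral_jb_rpow_neg hε0]
    rw [integral_add hf.integrable_norm_sq_mul_jb (integrable_inv_jb_pow le_rfl)]
    have e : (2 * √l)⁻¹ * (discVol / ε) = √l * discVol := by
      rw [hε]
      field_simp
      rw [sq, hrr, mul_comm]
    rw [e]
    unfold jbInt
    nlinarith
  calc wienerNorm f ^ 2 ≤ (√l * (2 * (H + jbInt) + discVol)) ^ 2 :=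
        pow_le_pow_left₀ (wienerNorm_nonneg f) hA 2
    _ = bgConst H * l := by
        rw [bgConst, mul_pow, sq √l, hrr]
        ring

theorem log_gronwall {y : ℝ → ℝ} {s t D : ℝ} (hst : s ≤ t) (hD : 0 ≤ D)
    (hy : ContinuousOn y (Set.Icc s t))
    (hy0 : ∀ τ ∈ Set.Icc s t, 0 ≤ y τ)
    (h : ∀ τ ∈ Set.Icc s t, y τ ≤ y s + ∫ σ in s..τ, D * Real.log (3 + y σ) * y σ) :
    Real.log (3 + y t) ≤ Real.log (3 + y s) * Real.exp (D * (t - s)) := by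
  obtain ⟨ψ, hψ⟩ : ∃ ψ : ℝ → ℝ, ψ = fun σ => D * Real.log (3 + y σ) * y σ := ⟨_, rfl⟩
  obtain ⟨Z, hZ⟩ : ∃ Z : ℝ → ℝ, Z = fun τ => y s + ∫ σ in s..τ, ψ σ := ⟨_, rfl⟩
  have hψc : ContinuousOn ψ (Set.Icc s t) := by
    rw [hψ]
    refine (continuousOn_const.mul ((continuousOn_const.add hy).log fun σ hσ => ?_)).mul hy
    exact (show 0 < 3 + y σ by linarith [hy0 σ hσ]).ne'
  have hψ0 : ∀ σ ∈ Set.Icc s t, 0 ≤ ψ σ := fun σ hσ => by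
    rw [hψ]
    have := hy0 σ hσ
    exact mul_nonneg (mul_nonneg hD (Real.log_nonneg (by linarith))) this
  have hyZ : ∀ τ ∈ Set.Icc s t, y τ ≤ Z τ := fun τ hτ => by
    rw [hZ, hψ]
    exact h τ hτ
  have hZ0 : ∀ τ ∈ Set.Icc s t, 0 ≤ Z τ := fun τ hτ => (hy0 τ hτ).trans (hyZ τ hτ)
  have hZs : Z s = y s := by rw [hZ]; simp
  have hint : IntegrableOn ψ (Set.uIcc s t) := by
    rw [Set.uIcc_of_le hst]
    exact hψc.integrableOn_compact isCompact_Icc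
  have hZc : ContinuousOn Z (Set.Icc s t) := by
    rw [hZ, ← Set.uIcc_of_le hst]
    exact continuousOn_const.add (intervalIntegral.continuousOn_primitive_interval hint)
  have hZd : ∀ τ ∈ Set.Ioo s t, HasDerivAt Z (ψ τ) τ := fun τ hτ => by
    rw [hZ]
    refine HasDerivAt.const_add _ (intervalIntegral.integral_hasDerivAt_right ?_ ?_ ?_)
    · refine ContinuousOn.intervalIntegrable ?_
      rw [Set.uIcc_of_le hτ.1.le]
      exact hψc.mono (Set.Icc_subset_Icc_right hτ.2.le)
    · exact (hψc.mono Set.Ioo_subset_Icc_self).stronglyMeasurableAtFilter isOpen_Ioo τ hτ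
    · exact hψc.continuousAt (Icc_mem_nhds hτ.1 hτ.2)
  have hl1 : ∀ z : ℝ, 0 ≤ z → 1 ≤ Real.log (3 + z) := fun z hz => by
    rw [Real.le_log_iff_exp_le (by positivity)]
    linarith [Real.exp_one_lt_d9]
  have hLd : ∀ τ ∈ Set.Ioo s t, HasDerivAt (fun τ => Real.log (Real.log (3 + Z τ)) - D * τ)
      (ψ τ / (3 + Z τ) / Real.log (3 + Z τ) - D) τ := fun τ hτ => by
    have h0 := hZ0 τ (Set.Ioo_subset_Icc_self hτ)
    have h1 := hl1 _ h0
    have := (((hZd τ hτ).const_add 3).log (by positivity)).log (by positivity)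
    exact (this.sub ((hasDerivAt_id τ).const_mul D)).congr_deriv (by ring)
  have hanti : AntitoneOn (fun τ => Real.log (Real.log (3 + Z τ)) - D * τ) (Set.Icc s t) := by
    refine antitoneOn_of_deriv_nonpos (convex_Icc s t) ?_ ?_ ?_
    · refine ContinuousOn.sub ?_ (by fun_prop)
      refine ContinuousOn.log ((continuousOn_const.add hZc).log fun τ hτ => ?_) fun τ hτ => ?_
      · exact (show 0 < 3 + Z τ by linarith [hZ0 τ hτ]).ne'
      · exact (show 0 < Real.log (3 + Z τ) by linarith [hl1 _ (hZ0 τ hτ)]).ne'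
    · rw [interior_Icc]
      exact fun τ hτ => (hLd τ hτ).differentiableAt.differentiableWithinAt
    · rw [interior_Icc]
      intro τ hτ
      have hτ' := Set.Ioo_subset_Icc_self hτ
      rw [(hLd τ hτ).deriv, sub_nonpos]
      have h0 := hZ0 τ hτ'
      have h1 := hl1 _ h0
      have h2 := hyZ τ hτ'
      have h3 := hy0 τ hτ'
      rw [div_le_iff₀ (by positivity), div_le_iff₀ (by positivity), hψ]
      have h4 : Real.log (3 + y τ) ≤ Real.log (3 + Z τ) :=
        Real.log_le_log (by positivity) (by linarith)
      have h5 := hl1 _ h3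
      simp only
      gcongr
      linarith
  have key := hanti ⟨le_rfl, hst⟩ ⟨hst, le_rfl⟩ hst
  simp only [hZs] at key
  have h1 := hl1 _ (hy0 s ⟨le_rfl, hst⟩)
  have h2 := hl1 _ (hZ0 t ⟨hst, le_rfl⟩)
  have h3 := hyZ t ⟨hst, le_rfl⟩
  have h4 : Real.log (3 + y t) ≤ Real.log (3 + Z t) :=
    Real.log_le_log (by linarith [hy0 t ⟨hst, le_rfl⟩]) (by linarith)
  refine h4.trans ?_
  rw [← Real.exp_log (by linarith : 0 < Real.log (3 + y s)), ← Real.exp_add,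
    ← Real.log_le_iff_le_exp (by linarith)]
  linarith

theorem IsSchwartz.integral_norm_sq_mul_jb_le {f : Plane → ℂ} (hf : IsSchwartz f) :
    ∫ ξ, jb ξ * ‖𝓕 f ξ‖ ^ 2 ≤ (∫ x, ‖f x‖ ^ 2) + ∫ x, energyDensity f x := by
  rw [hf.integral_norm_sq_mul_jb, ← integral_const_mul]
  have i1 := integrable_finsetSum Finset.univ fun j _ => (hf.pd j).integrable_norm_sq
  refine add_le_add_right (integral_mono (i1.const_mul _) hf.integrable_energyDensity fun x => ?_) _
  have h1 : (4 * π ^ 2)⁻¹ ≤ 1 / 2 := by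
    rw [inv_le_comm₀ (by positivity) (by norm_num)]
    nlinarith [Real.pi_gt_three]
  have h2 : 0 ≤ ∑ j, ‖_root_.pd j f x‖ ^ 2 := Finset.sum_nonneg fun j _ => by positivity
  have h3 : 0 ≤ 1 / 4 * ‖f x‖ ^ 4 := by positivity
  have h4 := mul_le_mul_of_nonneg_right h1 h2
  simp only [energyDensity]
  linarith

/-- A bound for the energy of a function in terms of its Fourier decay. -/
def energyConst (K : ℝ) : ℝ :=
  1 / 2 * ∑ _j : Fin 2, (2 * π * K) ^ 2 * jbInt + 1 / 4 * ((K * jbInt) ^ 2 * (K ^ 2 * jbInt))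

theorem FourierDecay.energy_le {f : Plane → ℂ} (hf : IsSchwartz f) {K : ℝ}
    (hK : FourierDecay K 4 f) : ∫ x, energyDensity f x ≤ energyConst K := by
  have i1 := fun j (_ : j ∈ Finset.univ) => (hf.pd j).integrable_norm_sq
  have i2 : Integrable fun x => ‖f x‖ ^ 4 :=
    (hf.mul hf).integrable_norm_sq.congr (.of_forall fun x => by
      simp only [norm_mul]
      ring)
  unfold energyDensity energyConst
  rw [integral_add ((integrable_finsetSum _ i1).const_mul _) (i2.const_mul _), integral_const_mul,
    integral_const_mul, integral_finsetSum _ i1]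
  have h1 := fun j => (FourierDecay.pd (k := 3) hf hK j).integral_norm_sq_le (by norm_num) (hf.pd j)
  have h2 : ∫ x, ‖f x‖ ^ 4 ≤ (K * jbInt) ^ 2 * (K ^ 2 * jbInt) := by
    calc ∫ x, ‖f x‖ ^ 4 ≤ ∫ x, (K * jbInt) ^ 2 * ‖f x‖ ^ 2 := by
          refine integral_mono i2 (hf.integrable_norm_sq.const_mul _) fun x => ?_
          have := pow_le_pow_left₀ (norm_nonneg _) (hK.norm_apply_le (by norm_num) hf x) 2
          have := mul_le_mul_of_nonneg_right this (sq_nonneg ‖f x‖)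
          simp only
          linarith [show ‖f x‖ ^ 4 = ‖f x‖ ^ 2 * ‖f x‖ ^ 2 by ring]
      _ ≤ _ := by
          rw [integral_const_mul]
          exact mul_le_mul_of_nonneg_left (hK.integral_norm_sq_le (by norm_num) hf) (sq_nonneg _)
  have h3 := Finset.sum_le_sum fun j (_ : j ∈ (Finset.univ : Finset (Fin 2))) => h1 j
  gcongr

/-- The optimal constant in `FourierDecay _ 4 f`. -/
def decaySup (f : Plane → ℂ) : ℝ := ⨆ ξ, ‖𝓕 f ξ‖ * jb ξ ^ 4

theorem FourierDecay.decaySup_le {f : Plane → ℂ} {K : ℝ} (h : FourierDecay K 4 f) :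
    decaySup f ≤ K := ciSup_le h

theorem FourierDecay.decaySup_self {f : Plane → ℂ} {K : ℝ} (h : FourierDecay K 4 f) :
    FourierDecay (decaySup f) 4 f := fun ξ =>
  le_ciSup (f := fun ξ => ‖𝓕 f ξ‖ * jb ξ ^ 4) ⟨K, by rintro _ ⟨ξ, rfl⟩; exact h ξ⟩ ξ

/-- The growth rate in the logarithmic Gronwall inequality. -/
def growthRate (H : ℝ) : ℝ := 4 ^ 4 * (1 + 2 * 4 ^ 4) * bgConst H

theorem growthRate_nonneg (H : ℝ) : 0 ≤ growthRate H :=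
  mul_nonneg (by norm_num) (sq_nonneg _)

section Propagation

variable {T s t K : ℝ} {u : ℝ → Plane → ℂ}

theorem IsNLSSolution.abs_decaySup_sub_le (hu : IsNLSSolution 2 T u) (hs : 0 ≤ s) (hst : s ≤ t)
    (ht : t ≤ T) (hK : ∀ τ ∈ Set.Icc s t, FourierDecay K 4 (u τ)) {ψ : ℝ → ℝ}
    (hψc : ContinuousOn ψ (Set.Icc s t))
    (hψ : ∀ τ ∈ Set.Icc s t, FourierDecay (ψ τ) 4 (cub (u τ))) :
    |decaySup (u t) - decaySup (u s)| ≤ ∫ τ in s..t, ψ τ := by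
  have hKs := (hK s ⟨le_rfl, hst⟩).decaySup_self
  have hKt := (hK t ⟨hst, le_rfl⟩).decaySup_self
  have key : ∀ ξ, |‖𝓕 (u t) ξ‖ * jb ξ ^ 4 - ‖𝓕 (u s) ξ‖ * jb ξ ^ 4| ≤ ∫ τ in s..t, ψ τ := by
    intro ξ
    have hj : 0 < jb ξ ^ 4 := pow_pos (jb_pos ξ) 4
    rw [← sub_mul, abs_mul, abs_of_pos hj]
    refine (mul_le_mul_of_nonneg_right (hu.abs_norm_fourier_sub_le hs hst ht hK ξ) hj.le).trans ?_
    rw [← intervalIntegral.integral_mul_const]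
    refine intervalIntegral.integral_mono_on hst ?_ ?_ fun τ hτ => hψ τ hτ ξ
    · refine ContinuousOn.intervalIntegrable ?_
      rw [Set.uIcc_of_le hst]
      exact (hu.continuousOn_fourier_cub hs ht hK ξ).norm.mul continuousOn_const
    · refine ContinuousOn.intervalIntegrable ?_
      rwa [Set.uIcc_of_le hst]
  rw [abs_sub_le_iff]
  constructor
  · rw [sub_le_iff_le_add]
    exact ciSup_le fun ξ => by linarith [(abs_sub_le_iff.1 (key ξ)).1, hKs ξ]
  · rw [sub_le_iff_le_add]
    exact ciSup_le fun ξ => by linarith [(abs_sub_le_iff.1 (key ξ)).2, hKt ξ]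

theorem IsNLSSolution.continuousOn_decaySup (hu : IsNLSSolution 2 T u) (hs : 0 ≤ s)
    (ht : t ≤ T) (hK : ∀ τ ∈ Set.Icc s t, FourierDecay K 4 (u τ)) :
    ContinuousOn (fun τ => decaySup (u τ)) (Set.Icc s t) := by
  obtain ⟨L, hL⟩ : ∃ L, L = 4 ^ 4 * (1 + 2 * 4 ^ 4) * ((K * jbInt) ^ 2 * K) := ⟨_, rfl⟩
  have hcub : ∀ τ ∈ Set.Icc s t, FourierDecay L 4 (cub (u τ)) := fun τ hτ => by
    refine ((hK τ hτ).cub (hu.2.1 τ ⟨hs.trans hτ.1, hτ.2.trans ht⟩)).mono_const ?_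
    rw [hL]
    have h1 := (hK τ hτ).wienerNorm_le (by norm_num)
    have h2 := (hK τ hτ).nonneg
    have h3 := wienerNorm_nonneg (u τ)
    gcongr
  have hle : ∀ a ∈ Set.Icc s t, ∀ b ∈ Set.Icc s t, a ≤ b →
      |decaySup (u b) - decaySup (u a)| ≤ L * (b - a) := fun a ha b hb hab => by
    have hsub : Set.Icc a b ⊆ Set.Icc s t := Set.Icc_subset_Icc ha.1 hb.2
    have := hu.abs_decaySup_sub_le (hs.trans ha.1) hab (hb.2.trans ht)
      (fun τ hτ => hK τ (hsub hτ)) (continuousOn_const (c := L)) fun τ hτ => hcub τ (hsub hτ)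
    rwa [intervalIntegral.integral_const, smul_eq_mul, mul_comm] at this
  by_cases hst : (Set.Icc s t).Nonempty
  · obtain ⟨τ₀, h₀⟩ := hst
    have hL0 : 0 ≤ L := (hcub τ₀ h₀).nonneg
    refine (LipschitzOnWith.of_dist_le_mul (K := ⟨L, hL0⟩) fun a ha b hb => ?_).continuousOn
    simp only [Real.dist_eq]
    rcases le_total a b with h | h
    · rw [abs_sub_comm, abs_sub_comm a, abs_of_nonneg (sub_nonneg.2 h)]
      exact hle a ha b hb h
    · rw [abs_of_nonneg (sub_nonneg.2 h)]
      exact hle b hb a ha h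
  · rw [Set.not_nonempty_iff_eq_empty.1 hst]
    exact continuousOn_empty _

theorem IsNLSSolution.log_decaySup_le (hu : IsNLSSolution 2 T u) (hs : 0 ≤ s) (hst : s ≤ t)
    (ht : t ≤ T) (hK : ∀ τ ∈ Set.Icc s t, FourierDecay K 4 (u τ)) {H : ℝ}
    (hH : (∫ x, ‖u s x‖ ^ 2) + ∫ x, energyDensity (u s) x ≤ H) :
    Real.log (3 + decaySup (u t)) ≤
        Real.log (3 + decaySup (u s)) * Real.exp (growthRate H * (t - s)) ∧
      Real.log (3 + decaySup (u s)) ≤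
        Real.log (3 + decaySup (u t)) * Real.exp (growthRate H * (t - s)) := by
  have hS : ∀ τ ∈ Set.Icc s t, IsSchwartz (u τ) := fun τ hτ =>
    hu.2.1 τ ⟨hs.trans hτ.1, hτ.2.trans ht⟩
  have hyc := hu.continuousOn_decaySup hs ht hK
  have hy0 : ∀ τ ∈ Set.Icc s t, 0 ≤ decaySup (u τ) := fun τ hτ => (hK τ hτ).decaySup_self.nonneg
  obtain ⟨ψ, hψ⟩ : ∃ ψ : ℝ → ℝ, ψ = fun σ =>
    growthRate H * Real.log (3 + decaySup (u σ)) * decaySup (u σ) := ⟨_, rfl⟩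
  have hψc : ContinuousOn ψ (Set.Icc s t) := by
    rw [hψ]
    refine (continuousOn_const.mul ((continuousOn_const.add hyc).log fun σ hσ => ?_)).mul hyc
    exact (show 0 < 3 + decaySup (u σ) by linarith [hy0 σ hσ]).ne'
  have hcub : ∀ τ ∈ Set.Icc s t, FourierDecay (ψ τ) 4 (cub (u τ)) := fun τ hτ => by
    have hd := (hK τ hτ).decaySup_self
    have hsub : Set.Icc s τ ⊆ Set.Icc s t := Set.Icc_subset_Icc_right hτ.2
    have hud : UniformDecay (Set.Icc s τ) 4 u :=
      ⟨fun σ hσ => hS σ (hsub hσ), K, fun σ hσ => hK σ (hsub hσ)⟩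
    have hH' := (hS τ hτ).integral_norm_sq_mul_jb_le
    rw [hu.mass_eq hs hτ.1 (hτ.2.trans ht) hud, hu.energy_eq hs hτ.1 (hτ.2.trans ht) hud] at hH'
    have h1 := hd.sq_wienerNorm_le (hS τ hτ) (hH'.trans hH)
    refine (hd.cub (hS τ hτ)).mono_const ?_
    rw [hψ]
    have h2 := mul_le_mul_of_nonneg_right h1 (hy0 τ hτ)
    simp only [growthRate]
    linarith
  have hab : ∀ a ∈ Set.Icc s t, ∀ b ∈ Set.Icc s t, a ≤ b →
      |decaySup (u b) - decaySup (u a)| ≤ ∫ τ in a..b, ψ τ := fun a ha b hb hle => by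
    have hsub : Set.Icc a b ⊆ Set.Icc s t := Set.Icc_subset_Icc ha.1 hb.2
    exact hu.abs_decaySup_sub_le (hs.trans ha.1) hle (hb.2.trans ht)
      (fun τ hτ => hK τ (hsub hτ)) (hψc.mono hsub) fun τ hτ => hcub τ (hsub hτ)
  constructor
  · refine log_gronwall hst (growthRate_nonneg H) hyc hy0 fun τ hτ => ?_
    have := (abs_sub_le_iff.1 (hab s ⟨le_rfl, hst⟩ τ hτ hτ.1)).1
    rw [hψ] at this
    linarith
  · have hmap : ∀ τ ∈ Set.Icc s t, s + t - τ ∈ Set.Icc s t := fun τ hτ =>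
      ⟨by linarith [hτ.2], by linarith [hτ.1]⟩
    have := log_gronwall (y := fun τ => decaySup (u (s + t - τ))) hst (growthRate_nonneg H)
      (hyc.comp (by fun_prop) hmap) (fun τ hτ => hy0 _ (hmap τ hτ)) fun τ hτ => by
        rw [intervalIntegral.integral_comp_sub_left (fun σ =>
          growthRate H * Real.log (3 + decaySup (u σ)) * decaySup (u σ))]
        have := (abs_sub_le_iff.1 (hab _ (hmap τ hτ) _ (hmap s ⟨le_rfl, hst⟩)
          (by linarith [hτ.1]))).2
        rw [hψ] at this
        linarith
    simpa using this

/-- A bound for `decaySup` propagated over a time interval of length at most `T`. -/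
def propBound (T K : ℝ) : ℝ :=
  Real.exp (Real.log (3 + K) * Real.exp (growthRate (K ^ 2 * jbInt + energyConst K) * T))

theorem le_propBound {d : ℝ} {y K : ℝ} (hy0 : 0 ≤ y) (hdT : d ≤ T) {x : ℝ} (hx0 : 0 ≤ x)
    (hxK : x ≤ K)
    (h : Real.log (3 + y) ≤
      Real.log (3 + x) * Real.exp (growthRate (K ^ 2 * jbInt + energyConst K) * d)) :
    y ≤ propBound T K := by
  have h1 : Real.log (3 + x) ≤ Real.log (3 + K) := Real.log_le_log (by positivity) (by linarith)
  have h2 := growthRate_nonneg (K ^ 2 * jbInt + energyConst K)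
  have h3 : 0 ≤ Real.log (3 + x) := Real.log_nonneg (by linarith)
  have h5 := h3.trans h1
  have h4 : Real.log (3 + y) ≤ Real.log (3 + K) *
      Real.exp (growthRate (K ^ 2 * jbInt + energyConst K) * T) := h.trans (by gcongr)
  rw [Real.log_le_iff_le_exp (by positivity)] at h4
  exact le_trans (by linarith) h4

theorem IsNLSSolution.fourierDecay_forward (hu : IsNLSSolution 2 T u) (hs : 0 ≤ s) (hst : s ≤ t)
    (ht : t ≤ T) (hK : ∀ τ ∈ Set.Icc s t, FourierDecay K 4 (u τ)) {K₀ : ℝ}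
    (h₀ : FourierDecay K₀ 4 (u s)) : FourierDecay (propBound T K₀) 4 (u t) := by
  have hSs := hu.2.1 s ⟨hs, hst.trans ht⟩
  have hH := add_le_add (h₀.integral_norm_sq_le (by norm_num) hSs) (h₀.energy_le hSs)
  have ht' := (hK t ⟨hst, le_rfl⟩).decaySup_self
  exact ht'.mono_const (le_propBound ht'.nonneg (by linarith) h₀.decaySup_self.nonneg
    h₀.decaySup_le (hu.log_decaySup_le hs hst ht hK hH).1)

theorem IsNLSSolution.fourierDecay_backward (hu : IsNLSSolution 2 T u) (hs : 0 ≤ s) (hst : s ≤ t)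
    (ht : t ≤ T) (hK : ∀ τ ∈ Set.Icc s t, FourierDecay K 4 (u τ)) {K₀ : ℝ}
    (h₀ : FourierDecay K₀ 4 (u t)) : FourierDecay (propBound T K₀) 4 (u s) := by
  have hSt := hu.2.1 t ⟨hs.trans hst, ht⟩
  have hud : UniformDecay (Set.Icc s t) 4 u :=
    ⟨fun τ hτ => hu.2.1 τ ⟨hs.trans hτ.1, hτ.2.trans ht⟩, K, hK⟩
  have hH := add_le_add (h₀.integral_norm_sq_le (by norm_num) hSt) (h₀.energy_le hSt)
  rw [hu.mass_eq hs hst ht hud, hu.energy_eq hs hst ht hud] at hH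
  have hs' := (hK s ⟨le_rfl, hst⟩).decaySup_self
  exact hs'.mono_const (le_propBound hs'.nonneg (by linarith) h₀.decaySup_self.nonneg
    h₀.decaySup_le (hu.log_decaySup_le hs hst ht hK hH).2)

end Propagation

theorem norm_le_of_forall_bump {f : Plane → ℂ} {B : Plane → ℝ} (hf : Continuous f)
    (hB : Continuous B) (ξ : Plane)
    (h : ∀ η : ContDiffBump ξ, ‖∫ x, f x * (η x : ℂ)‖ ≤ ∫ x, B x * η x) : ‖f ξ‖ ≤ B ξ := by
  refine le_of_forall_pos_le_add fun ε hε => ?_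
  obtain ⟨δ₁, hδ₁, h₁⟩ := Metric.continuous_iff.1 hf ξ (ε / 2) (by positivity)
  obtain ⟨δ₂, hδ₂, h₂⟩ := Metric.continuous_iff.1 hB ξ (ε / 2) (by positivity)
  let η : ContDiffBump ξ := ⟨min δ₁ δ₂ / 2, min δ₁ δ₂, by positivity, by
    linarith [lt_min hδ₁ hδ₂]⟩
  have hη : Integrable η := η.continuous.integrable_of_hasCompactSupport η.hasCompactSupport
  have hηp : 0 < ∫ x, η x := η.integral_pos
  have hηC : Integrable fun x => (η x : ℂ) := hη.ofReal
  have hfη : Integrable fun x => f x * (η x : ℂ) :=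
    (hf.mul (Complex.continuous_ofReal.comp η.continuous)).integrable_of_hasCompactSupport
      (η.hasCompactSupport.comp_left Complex.ofReal_zero).mul_left
  have hBη : Integrable fun x => B x * η x :=
    (hB.mul η.continuous).integrable_of_hasCompactSupport η.hasCompactSupport.mul_left
  have hz : ∀ x, η x = 0 ∨ dist x ξ < min δ₁ δ₂ := fun x => by
    rcases le_or_gt (min δ₁ δ₂) (dist x ξ) with hx | hx
    · exact Or.inl (η.zero_of_le_dist hx)
    · exact Or.inr hx
  have e1 : ∫ x, B x * η x ≤ (B ξ + ε / 2) * ∫ x, η x := by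
    rw [← integral_const_mul]
    refine integral_mono hBη (hη.const_mul _) fun x => ?_
    rcases hz x with hx | hx
    · simp [hx]
    · have := h₂ x (hx.trans_le (min_le_right _ _))
      rw [Real.dist_eq, abs_sub_lt_iff] at this
      exact mul_le_mul_of_nonneg_right (by linarith) η.nonneg
  have e2 : (‖f ξ‖ - ε / 2) * ∫ x, η x ≤ ‖∫ x, f x * (η x : ℂ)‖ := by
    have h3 : ‖f ξ * ∫ x, (η x : ℂ)‖ ≤ ‖∫ x, f x * (η x : ℂ)‖ + ε / 2 * ∫ x, η x := by
      have : f ξ * ∫ x, (η x : ℂ) = (∫ x, f x * (η x : ℂ)) - ∫ x, (f x - f ξ) * (η x : ℂ) := by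
        rw [← integral_const_mul]
        simp only [sub_mul]
        rw [integral_sub hfη (hηC.const_mul _)]
        ring
      rw [this]
      refine (norm_sub_le _ _).trans (add_le_add_right ?_ _)
      rw [← integral_const_mul]
      refine norm_integral_le_of_norm_le (hη.const_mul _) (.of_forall fun x => ?_)
      rw [norm_mul, Complex.norm_real, Real.norm_of_nonneg η.nonneg]
      rcases hz x with hx | hx
      · simp [hx]
      · have := h₁ x (hx.trans_le (min_le_left _ _))
        rw [dist_eq_norm] at this
        exact mul_le_mul_of_nonneg_right this.le η.nonneg
    rw [norm_mul, integral_complex_ofReal, Complex.norm_real, Real.norm_of_nonneg hηp.le] at h3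
    linarith
  have := (e2.trans (h η)).trans e1
  have := le_of_mul_le_mul_right this hηp
  linarith

section Compactness

variable {T K : ℝ} {u : ℝ → Plane → ℂ}

theorem IsNLSSolution.fourierDecay_of_tendsto (hu : IsNLSSolution 2 T u) {τ : ℕ → ℝ} {t : ℝ}
    (hτ : ∀ n, τ n ∈ Set.Icc 0 T) (ht : t ∈ Set.Icc 0 T)
    (hlim : Filter.Tendsto τ Filter.atTop (nhds t))
    (hK : ∀ n, FourierDecay K 4 (u (τ n))) : FourierDecay K 4 (u t) := by
  intro ξ
  have hc : Continuous fun ξ => K * (jb ξ ^ 4)⁻¹ :=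
    continuous_const.mul ((continuous_jb.pow 4).inv₀ fun ξ => (pow_pos (jb_pos ξ) 4).ne')
  have key := norm_le_of_forall_bump (hu.2.1 t ht).fourier.continuous hc ξ fun η => ?_
  · rwa [← div_eq_mul_inv, le_div_iff₀ (pow_pos (jb_pos ξ) 4)] at key
  have hη : Integrable η := η.continuous.integrable_of_hasCompactSupport η.hasCompactSupport
  have hS : IsSchwartz fun x => (η x : ℂ) :=
    ⟨(η.hasCompactSupport.comp_left Complex.ofReal_zero).toSchwartzMap
      (Complex.ofRealCLM.contDiff.comp η.contDiff), rfl⟩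
  rw [(hu.2.1 t ht).integral_fourier_mul hS]
  have hb : ∀ n, ‖∫ x, u (τ n) x * 𝓕 (fun x => (η x : ℂ)) x‖ ≤
      ∫ x, K * (jb x ^ 4)⁻¹ * η x := fun n => by
    rw [← (hu.2.1 _ (hτ n)).integral_fourier_mul hS]
    refine norm_integral_le_of_norm_le ?_ (.of_forall fun x => ?_)
    · exact (hc.mul η.continuous).integrable_of_hasCompactSupport η.hasCompactSupport.mul_left
    · rw [norm_mul, Complex.norm_real, Real.norm_of_nonneg η.nonneg]
      exact mul_le_mul_of_nonneg_right ((hK n).norm_le x) η.nonneg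
  suffices htend : Filter.Tendsto (fun n => ∫ x, u (τ n) x * 𝓕 (fun x => (η x : ℂ)) x) Filter.atTop
      (nhds (∫ x, u t x * 𝓕 (fun x => (η x : ℂ)) x)) from le_of_tendsto htend.norm (.of_forall hb)
  refine tendsto_integral_of_dominated_convergence
    (fun x => K * jbInt * ‖𝓕 (fun x => (η x : ℂ)) x‖)
    (fun n => ((hu.2.1 _ (hτ n)).mul hS.fourier).continuous.aestronglyMeasurable)
    (hS.fourier.integrable.norm.const_mul _) (fun n => .of_forall fun x => ?_)
    (.of_forall fun x => ?_)
  · rw [norm_mul]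
    exact mul_le_mul_of_nonneg_right ((hK n).norm_apply_le (by norm_num) (hu.2.1 _ (hτ n)) x)
      (norm_nonneg _)
  · refine Filter.Tendsto.mul_const _ ?_
    exact ((hu.1.continuous.comp (continuous_id.prodMk continuous_const)).tendsto t).comp hlim

theorem exists_fourierDecay_of_locally {S : Set ℝ} (hS : IsCompact S)
    (h : ∀ t ∈ S, ∃ K, ∀ᶠ τ in nhdsWithin t S, FourierDecay K 4 (u τ)) :
    ∃ K, ∀ τ ∈ S, FourierDecay K 4 (u τ) := by
  refine hS.induction_on (p := fun S => ∃ K, ∀ τ ∈ S, FourierDecay K 4 (u τ)) ⟨0, by simp⟩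
    (fun s t hst ⟨K, hK⟩ => ⟨K, fun τ hτ => hK τ (hst hτ)⟩) ?_ fun t ht => ?_
  · rintro s t ⟨K, hK⟩ ⟨L, hL⟩
    refine ⟨max K L, fun τ hτ => ?_⟩
    rcases hτ with hτ | hτ
    · exact (hK τ hτ).mono_const (le_max_left _ _)
    · exact (hL τ hτ).mono_const (le_max_right _ _)
  · obtain ⟨K, hK⟩ := h t ht
    exact ⟨_, hK, K, fun τ hτ => hτ⟩

theorem IsSchwartz.exists_fourierDecay {f : Plane → ℂ} (hf : IsSchwartz f) :
    ∃ K, FourierDecay K 4 f := by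
  have hstep : ∀ g : Plane → ℂ, IsSchwartz g →
      ∃ h, IsSchwartz h ∧ ∀ ξ, 𝓕 h ξ = (jb ξ : ℂ) * 𝓕 g ξ := fun g hg => by
    refine ⟨fun x => g x + (-(4 * (π : ℂ) ^ 2)⁻¹) * _root_.lap g x, hg.add (hg.lap.const_mul _),
      fun ξ => ?_⟩
    rw [fourier_add hg (hg.lap.const_mul _), IsSchwartz.fourier_const_mul, hg.fourier_lap, jb]
    have : (π : ℂ) ≠ 0 := mod_cast Real.pi_ne_zero
    push_cast
    field_simp
  obtain ⟨f1, h1, e1⟩ := hstep f hf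
  obtain ⟨f2, h2, e2⟩ := hstep f1 h1
  obtain ⟨f3, h3, e3⟩ := hstep f2 h2
  obtain ⟨f4, h4, e4⟩ := hstep f3 h3
  obtain ⟨C, hC⟩ := h4.fourier.exists_norm_le
  refine ⟨C, fun ξ => (le_of_eq ?_).trans (hC ξ)⟩
  rw [e4, e3, e2, e1]
  simp only [norm_mul, Complex.norm_real, Real.norm_of_nonneg (jb_pos ξ).le]
  ring

theorem IsNLSSolution.fourierDecay_of_left (hu : IsNLSSolution 2 T u) {α β : ℝ} (hα : 0 ≤ α)
    (hβ : β ≤ T) (hαβ : α < β)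
    (h : ∀ α' ∈ Set.Ioo α β, ∃ K, ∀ τ ∈ Set.Icc α' β, FourierDecay K 4 (u τ))
    (hK : FourierDecay K 4 (u α)) : FourierDecay (propBound T K) 4 (u β) := by
  obtain ⟨L, hL⟩ := (hu.2.1 β ⟨hα.trans hαβ.le, hβ⟩).exists_fourierDecay
  refine hu.fourierDecay_forward (K := max (max K L) (propBound T L)) hα hαβ.le hβ
    (fun τ hτ => ?_) hK
  rcases eq_or_lt_of_le hτ.1 with rfl | h1
  · exact hK.mono_const ((le_max_left _ _).trans (le_max_left _ _))
  rcases eq_or_lt_of_le hτ.2 with rfl | h2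
  · exact hL.mono_const ((le_max_right _ _).trans (le_max_left _ _))
  obtain ⟨K', hK'⟩ := h τ ⟨h1, h2⟩
  exact (hu.fourierDecay_backward (hα.trans hτ.1) hτ.2 hβ hK' hL).mono_const (le_max_right _ _)

theorem IsNLSSolution.fourierDecay_of_right (hu : IsNLSSolution 2 T u) {α β : ℝ} (hα : 0 ≤ α)
    (hβ : β ≤ T) (hαβ : α < β)
    (h : ∀ β' ∈ Set.Ioo α β, ∃ K, ∀ τ ∈ Set.Icc α β', FourierDecay K 4 (u τ))
    (hK : FourierDecay K 4 (u β)) : FourierDecay (propBound T K) 4 (u α) := by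
  obtain ⟨L, hL⟩ := (hu.2.1 α ⟨hα, hαβ.le.trans hβ⟩).exists_fourierDecay
  refine hu.fourierDecay_backward (K := max (max K L) (propBound T L)) hα hαβ.le hβ
    (fun τ hτ => ?_) hK
  rcases eq_or_lt_of_le hτ.2 with rfl | h1
  · exact hK.mono_const ((le_max_left _ _).trans (le_max_left _ _))
  rcases eq_or_lt_of_le hτ.1 with rfl | h2
  · exact hL.mono_const ((le_max_right _ _).trans (le_max_left _ _))
  obtain ⟨K', hK'⟩ := h τ ⟨h2, h1⟩
  exact (hu.fourierDecay_forward hα hτ.1 (hτ.2.trans hβ) hK' hL).mono_const (le_max_right _ _)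

/-- Every solution with Schwartz time slices enjoys uniform Fourier decay on `[0, T]`. -/
theorem IsNLSSolution.uniformDecay (hu : IsNLSSolution 2 T u) :
    UniformDecay (Set.Icc 0 T) 4 u := by
  obtain ⟨good, hgood⟩ : ∃ good : ℝ → Prop, good = fun t =>
    ∃ K, ∀ᶠ τ in nhds t, τ ∈ Set.Icc 0 T → FourierDecay K 4 (u τ) := ⟨_, rfl⟩
  have hopen : IsOpen {t | good t} := by
    rw [isOpen_iff_mem_nhds]
    intro t ht
    rw [hgood] at ht ⊢
    obtain ⟨K, hK⟩ := ht
    exact (eventually_eventually_nhds.2 hK).mono fun σ hσ => ⟨K, hσ⟩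
  have hcpt : ∀ a b, 0 ≤ a → b ≤ T → (∀ τ ∈ Set.Icc a b, good τ) →
      ∃ K, ∀ τ ∈ Set.Icc a b, FourierDecay K 4 (u τ) := fun a b ha hb hg => by
    refine exists_fourierDecay_of_locally isCompact_Icc fun t ht => ?_
    have := hg t ht
    rw [hgood] at this
    obtain ⟨K, hK⟩ := this
    refine ⟨K, ?_⟩
    rw [eventually_nhdsWithin_iff]
    exact hK.mono fun τ hτ hτ' => hτ ⟨ha.trans hτ'.1, hτ'.2.trans hb⟩
  suffices hall : ∀ t ∈ Set.Icc 0 T, good t from ⟨hu.2.1, hcpt 0 T le_rfl le_rfl hall⟩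
  by_contra hne
  push Not at hne
  obtain ⟨P, hP⟩ : ∃ P : Set ℝ, P = Set.Icc 0 T ∩ {t | good t}ᶜ := ⟨_, rfl⟩
  have hPc : IsClosed P := by
    rw [hP]
    exact isClosed_Icc.inter hopen.isClosed_compl
  have hPsub : P ⊆ Set.Icc 0 T := by
    rw [hP]
    exact Set.inter_subset_left
  have hgoodP : ∀ t ∈ Set.Icc 0 T, t ∉ P → good t := fun t ht htP => by
    by_contra hb
    exact htP (hP ▸ ⟨ht, hb⟩)
  obtain ⟨t₀, ht₀, hb₀⟩ := hne
  have : Nonempty P := ⟨⟨t₀, hP ▸ ⟨ht₀, hb₀⟩⟩⟩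
  have : CompleteSpace P := hPc.completeSpace_coe
  have hclosed : ∀ n : ℕ, IsClosed {t : P | FourierDecay n 4 (u t)} := fun n => by
    refine IsSeqClosed.isClosed fun τ t hτ hlim => ?_
    exact hu.fourierDecay_of_tendsto (fun k => hPsub (τ k).2) (hPsub t.2)
      ((continuous_subtype_val.tendsto t).comp hlim) hτ
  have hun : ⋃ n : ℕ, {t : P | FourierDecay n 4 (u t)} = Set.univ := by
    refine Set.eq_univ_of_forall fun t => Set.mem_iUnion.2 ?_
    obtain ⟨K, hK⟩ := (hu.2.1 t (hPsub t.2)).exists_fourierDecay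
    obtain ⟨n, hn⟩ := exists_nat_ge K
    exact ⟨n, hK.mono_const hn⟩
  obtain ⟨n, ⟨⟨p, hpP⟩, hpint⟩⟩ := nonempty_interior_of_iUnion_of_closed hclosed hun
  rw [mem_interior_iff_mem_nhds, mem_nhds_subtype] at hpint
  obtain ⟨U, hU, hUsub⟩ := hpint
  obtain ⟨δ, hδ, hball⟩ := Metric.mem_nhds_iff.1 hU
  have hnP : ∀ τ ∈ P, |τ - p| < δ → FourierDecay n 4 (u τ) := fun τ hτ hd =>
    hUsub (show (⟨τ, hτ⟩ : P) ∈ Subtype.val ⁻¹' U from hball hd)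
  have hp0 := hPsub hpP
  have hbad : ¬ good p := (hP ▸ hpP : p ∈ Set.Icc 0 T ∩ {t | good t}ᶜ).2
  refine hbad ?_
  rw [hgood]
  refine ⟨max n (propBound T n), ?_⟩
  filter_upwards [Metric.ball_mem_nhds p hδ] with τ hτ hτT
  have hτ' : |τ - p| < δ := hτ
  by_cases hτP : τ ∈ P
  · exact (hnP τ hτP hτ').mono_const (le_max_left _ _)
  have hτp : τ ≠ p := fun h => hτP (h ▸ hpP)
  refine FourierDecay.mono_const ?_ (le_max_right _ _)
  rcases lt_or_gt_of_ne hτp with hlt | hgt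
  · have hne : (P ∩ Set.Icc τ p).Nonempty := ⟨p, hpP, hlt.le, le_rfl⟩
    have hbd : BddBelow (P ∩ Set.Icc τ p) := ⟨τ, fun x hx => hx.2.1⟩
    obtain ⟨β, hβ⟩ : ∃ β, β = sInf (P ∩ Set.Icc τ p) := ⟨_, rfl⟩
    have hβm : β ∈ P ∩ Set.Icc τ p := hβ ▸ (hPc.inter isClosed_Icc).csInf_mem hne hbd
    have hτβ : τ < β := lt_of_le_of_ne hβm.2.1 fun h => hτP (h ▸ hβm.1)
    refine hu.fourierDecay_of_right hτT.1 (hPsub hβm.1).2 hτβ (fun β' hβ' => ?_)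
      (hnP β hβm.1 ?_)
    · refine hcpt τ β' hτT.1 (hβ'.2.le.trans (hPsub hβm.1).2) fun σ hσ => hgoodP σ
        ⟨hτT.1.trans hσ.1, hσ.2.trans (hβ'.2.le.trans (hPsub hβm.1).2)⟩ fun hσP => ?_
      have := csInf_le hbd ⟨hσP, hσ.1, hσ.2.trans (hβ'.2.le.trans hβm.2.2)⟩
      rw [← hβ] at this
      linarith [hσ.2, hβ'.2]
    · rw [abs_lt] at hτ' ⊢
      constructor <;> linarith [hβm.2.1, hβm.2.2]
  · have hne : (P ∩ Set.Icc p τ).Nonempty := ⟨p, hpP, le_rfl, hgt.le⟩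
    have hbd : BddAbove (P ∩ Set.Icc p τ) := ⟨τ, fun x hx => hx.2.2⟩
    obtain ⟨α, hα⟩ : ∃ α, α = sSup (P ∩ Set.Icc p τ) := ⟨_, rfl⟩
    have hαm : α ∈ P ∩ Set.Icc p τ := hα ▸ (hPc.inter isClosed_Icc).csSup_mem hne hbd
    have hατ : α < τ := lt_of_le_of_ne hαm.2.2 fun h => hτP (h ▸ hαm.1)
    refine hu.fourierDecay_of_left (hPsub hαm.1).1 hτT.2 hατ (fun α' hα' => ?_)
      (hnP α hαm.1 ?_)
    · refine hcpt α' τ ((hPsub hαm.1).1.trans hα'.1.le) hτT.2 fun σ hσ => hgoodP σ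
        ⟨((hPsub hαm.1).1.trans hα'.1.le).trans hσ.1, hσ.2.trans hτT.2⟩ fun hσP => ?_
      have := le_csSup hbd ⟨hσP, (hαm.2.1.trans hα'.1.le).trans hσ.1, hσ.2⟩
      rw [← hα] at this
      linarith [hσ.1, hα'.1]
    · rw [abs_lt] at hτ' ⊢
      constructor <;> linarith [hαm.2.1, hαm.2.2]

end Compactness

/-- The radial symbol as a function of `ρ = ‖ξ‖²`, extended by `1` to `ρ ≤ 0`. -/
def radialProfile (φ : ℝ → ℝ) (ρ : ℝ) : ℝ := if ρ ≤ 0 then 1 else φ (√ρ)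

/-- The symbol of `Iop φ`, with the value at the origin normalised. -/
def symb (φ : ℝ → ℝ) (ξ : Plane) : ℝ := radialProfile φ (‖ξ‖ ^ 2)

theorem symb_eq {φ : ℝ → ℝ} {ξ : Plane} (hξ : ξ ≠ 0) : symb φ ξ = φ ‖ξ‖ := by
  have : 0 < ‖ξ‖ := norm_pos_iff.2 hξ
  rw [symb, radialProfile, if_neg (not_le.2 (by positivity)), Real.sqrt_sq this.le]

namespace IMultiplier

variable {s N : ℝ} {Ck : ℕ → ℝ} {φ : ℝ → ℝ}

theorem radialProfile_eq_one (h : IMultiplier s N Ck φ) (hN : 1 ≤ N) {ρ : ℝ} (hρ : ρ < N ^ 2) :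
    radialProfile φ ρ = 1 := by
  unfold radialProfile
  split_ifs with h0
  · rfl
  · exact h.eq_one _ (Real.sqrt_pos.2 (not_le.1 h0)) (Real.sqrt_le_iff.2 ⟨by linarith, hρ.le⟩)

theorem radialProfile_eq_pow (h : IMultiplier s N Ck φ) (hN : 1 ≤ N) {ρ : ℝ} (hρ : 4 * N ^ 2 ≤ ρ) :
    radialProfile φ ρ = N ^ (1 - s) * ρ ^ ((s - 1) / 2) := by
  have hρ0 : 0 < ρ := lt_of_lt_of_le (by positivity) hρ
  have h2 : 2 * N ≤ √ρ := Real.le_sqrt_of_sq_le (by nlinarith)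
  rw [radialProfile, if_neg (not_le.2 hρ0), h.eq_pow _ h2, Real.div_rpow (Real.sqrt_nonneg _)
    (by linarith), Real.sqrt_eq_rpow, ← Real.rpow_mul hρ0.le, div_eq_mul_inv,
    ← Real.rpow_neg (by linarith)]
  rw [mul_comm]
  congr 2 <;> ring

theorem contDiff_radialProfile (h : IMultiplier s N Ck φ) (hN : 1 ≤ N) :
    ContDiff ℝ ∞ (radialProfile φ) := by
  refine contDiff_iff_contDiffAt.2 fun ρ => ?_
  rcases lt_or_ge ρ (N ^ 2) with hρ | hρ
  · refine (contDiffAt_const (c := (1 : ℝ))).congr_of_eventuallyEq ?_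
    filter_upwards [gt_mem_nhds hρ] with σ hσ using h.radialProfile_eq_one hN hσ
  · have hρ0 : 0 < ρ := lt_of_lt_of_le (by positivity) hρ
    have h1 : ContDiffAt ℝ ∞ φ (√ρ) :=
      h.contDiff.contDiffAt (Ioi_mem_nhds (Real.sqrt_pos.2 hρ0))
    refine (h1.comp ρ (Real.contDiffAt_sqrt hρ0.ne')).congr_of_eventuallyEq ?_
    filter_upwards [lt_mem_nhds hρ0] with σ hσ
    simp [radialProfile, not_le.2 hσ]

theorem exists_iteratedDeriv_radialProfile_le (h : IMultiplier s N Ck φ) (hs : s < 1) (hN : 1 ≤ N)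
    (n : ℕ) : ∃ C, ∀ ρ, ‖iteratedDeriv n (radialProfile φ) ρ‖ ≤ C := by
  have hcont : Continuous (iteratedDeriv n (radialProfile φ)) :=
    (h.contDiff_radialProfile hN).continuous_iteratedDeriv n (mod_cast le_top)
  obtain ⟨C, hC⟩ := (isCompact_Icc (a := 0) (b := 4 * N ^ 2)).exists_bound_of_continuousOn
    hcont.continuousOn
  obtain ⟨D, hD⟩ : ∃ D, D = |N ^ (1 - s) * (descPochhammer ℝ n).eval ((s - 1) / 2)| := ⟨_, rfl⟩
  have hD0 : 0 ≤ D := hD ▸ abs_nonneg _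
  refine ⟨max 1 (max C D), fun ρ => ?_⟩
  rcases lt_or_ge ρ 0 with h0 | h0
  · refine le_trans ?_ (le_max_left _ _)
    have : radialProfile φ =ᶠ[nhds ρ] fun _ => (1 : ℝ) := by
      filter_upwards [gt_mem_nhds h0] with σ hσ
      exact h.radialProfile_eq_one hN (hσ.trans (by positivity))
    rw [(this.iteratedDeriv n).eq_of_nhds, iteratedDeriv_const]
    split_ifs <;> simp
  rcases le_or_gt ρ (4 * N ^ 2) with h1 | h1
  · exact (hC ρ ⟨h0, h1⟩).trans ((le_max_left _ _).trans (le_max_right _ _))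
  · refine le_trans ?_ ((le_max_right _ _).trans (le_max_right _ _))
    have : radialProfile φ =ᶠ[nhds ρ] fun ρ => N ^ (1 - s) * ρ ^ ((s - 1) / 2) := by
      filter_upwards [lt_mem_nhds h1] with σ hσ using h.radialProfile_eq_pow hN hσ.le
    have h1ρ : 1 ≤ ρ := by nlinarith
    rw [(this.iteratedDeriv n).eq_of_nhds, iteratedDeriv_const_mul_field, iteratedDeriv_eq_iterate,
      Real.iter_deriv_rpow_const, ← mul_assoc, norm_mul, Real.norm_eq_abs, ← hD,
      Real.norm_of_nonneg (by positivity)]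
    refine mul_le_of_le_one_right hD0 (Real.rpow_le_one_of_one_le_of_nonpos h1ρ ?_)
    have : (0 : ℝ) ≤ n := n.cast_nonneg
    linarith

theorem hasTemperateGrowth_symb (h : IMultiplier s N Ck φ) (hs : s < 1) (hN : 1 ≤ N) :
    (symb φ).HasTemperateGrowth := by
  have h1 : (radialProfile φ).HasTemperateGrowth := by
    refine ⟨h.contDiff_radialProfile hN, fun n => ?_⟩
    obtain ⟨C, hC⟩ := h.exists_iteratedDeriv_radialProfile_le hs hN n
    exact ⟨0, C, fun x => by simpa [norm_iteratedFDeriv_eq_norm_iteratedDeriv] using hC x⟩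
  exact h1.comp (Function.hasTemperateGrowth_norm_sq (H := Plane))

theorem symb_nonneg (h : IMultiplier s N Ck φ) (ξ : Plane) : 0 ≤ symb φ ξ := by
  rw [symb, radialProfile]
  split_ifs with h0
  · exact zero_le_one
  · exact (h.pos _ (Real.sqrt_pos.2 (not_le.1 h0))).le

theorem symb_le_one (h : IMultiplier s N Ck φ) (ξ : Plane) : symb φ ξ ≤ 1 := by
  rw [symb, radialProfile]
  split_ifs with h0
  · exact le_rfl
  · exact h.le_one _ (Real.sqrt_pos.2 (not_le.1 h0))

theorem isSchwartz_symb_mul (h : IMultiplier s N Ck φ) (hs : s < 1) (hN : 1 ≤ N) {f : Plane → ℂ}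
    (hf : IsSchwartz f) : IsSchwartz fun ξ => (symb φ ξ : ℂ) * f ξ := by
  obtain ⟨F, rfl⟩ := hf
  have hg : (fun ξ => (symb φ ξ : ℂ)).HasTemperateGrowth :=
    Function.HasTemperateGrowth.comp Function.Complex.hasTemperateGrowth_ofReal
        (h.hasTemperateGrowth_symb hs hN)
  exact ⟨SchwartzMap.smulLeftCLM ℂ (fun ξ => (symb φ ξ : ℂ)) F, by
    ext x
    simp [SchwartzMap.smulLeftCLM_apply_apply hg]⟩

end IMultiplier

theorem Iop_eq (φ : ℝ → ℝ) (f : Plane → ℂ) :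
    Iop φ f = 𝓕⁻ fun ξ => (symb φ ξ : ℂ) * 𝓕 f ξ := by
  ext x
  rw [Iop, fourierMult, Real.fourierInv_eq, Real.fourierInv_eq]
  refine integral_congr_ae ?_
  have h0 : ∀ᵐ ξ : Plane, ξ ≠ 0 := by simp [ae_iff]
  filter_upwards [h0] with ξ hξ
  rw [symb_eq hξ]

namespace IMultiplier

variable {s N : ℝ} {Ck : ℕ → ℝ} {φ : ℝ → ℝ} {f : Plane → ℂ}

theorem isSchwartz_Iop (h : IMultiplier s N Ck φ) (hs : s < 1) (hN : 1 ≤ N) (hf : IsSchwartz f) :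
    IsSchwartz (Iop φ f) := by
  rw [Iop_eq]
  exact (h.isSchwartz_symb_mul hs hN hf.fourier).fourierInv

theorem fourier_Iop (h : IMultiplier s N Ck φ) (hs : s < 1) (hN : 1 ≤ N) (hf : IsSchwartz f)
    (ξ : Plane) : 𝓕 (Iop φ f) ξ = (symb φ ξ : ℂ) * 𝓕 f ξ := by
  rw [Iop_eq, (h.isSchwartz_symb_mul hs hN hf.fourier).fourier_fourierInv]

theorem norm_fourier_Iop_le (h : IMultiplier s N Ck φ) (hs : s < 1) (hN : 1 ≤ N)
    (hf : IsSchwartz f) (ξ : Plane) : ‖𝓕 (Iop φ f) ξ‖ ≤ ‖𝓕 f ξ‖ := by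
  rw [h.fourier_Iop hs hN hf, norm_mul, Complex.norm_real, Real.norm_of_nonneg (h.symb_nonneg ξ)]
  exact mul_le_of_le_one_left (norm_nonneg _) (h.symb_le_one ξ)

theorem integral_norm_sq_Iop_le (h : IMultiplier s N Ck φ) (hs : s < 1) (hN : 1 ≤ N)
    (hf : IsSchwartz f) : ∫ x, ‖Iop φ f x‖ ^ 2 ≤ ∫ x, ‖f x‖ ^ 2 := by
  have hw := h.isSchwartz_Iop hs hN hf
  rw [← hw.integral_norm_sq_fourier, ← hf.integral_norm_sq_fourier]
  exact integral_mono hw.fourier.integrable_norm_sq hf.fourier.integrable_norm_sq fun ξ =>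
    pow_le_pow_left₀ (norm_nonneg _) (h.norm_fourier_Iop_le hs hN hf ξ) 2

theorem fourierDecay_Iop (h : IMultiplier s N Ck φ) (hs : s < 1) (hN : 1 ≤ N) {K : ℝ} {k : ℕ}
    (hf : IsSchwartz f) (hK : FourierDecay K k f) : FourierDecay K k (Iop φ f) := fun ξ =>
  (mul_le_mul_of_nonneg_right (h.norm_fourier_Iop_le hs hN hf ξ) (pow_nonneg (jb_pos ξ).le k)).trans
    (hK ξ)

end IMultiplier

theorem IsSchwartz.ext_fourier {f g : Plane → ℂ} (hf : IsSchwartz f) (hg : IsSchwartz g)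
    (h : ∀ ξ, 𝓕 f ξ = 𝓕 g ξ) : f = g := by
  rw [← hf.fourierInv_fourier, ← hg.fourierInv_fourier, show 𝓕 f = 𝓕 g from funext h]

/-- A time-family of Schwartz functions with uniform Fourier decay and Fourier transforms
continuous in time. -/
structure TimeRegular (S : Set ℝ) (k : ℕ) (F : ℝ → Plane → ℂ) : Prop where
  decay : UniformDecay S k F
  cont : ∀ ξ, ContinuousOn (fun t => 𝓕 (F t) ξ) S

namespace TimeRegular

variable {S : Set ℝ} {k : ℕ} {F G : ℝ → Plane → ℂ}

theorem isSchwartz (h : TimeRegular S k F) {t : ℝ} (ht : t ∈ S) : IsSchwartz (F t) :=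
  h.decay.1 t ht

theorem mono {l : ℕ} (h : TimeRegular S k F) (hl : l ≤ k) : TimeRegular S l F :=
  ⟨h.decay.mono hl, h.cont⟩

theorem congr (h : TimeRegular S k F) (hFG : ∀ t ∈ S, G t = F t) : TimeRegular S k G :=
  ⟨h.decay.congr hFG, fun ξ => (h.cont ξ).congr fun t ht => by simp only [hFG t ht]⟩

theorem add (hF : TimeRegular S k F) (hG : TimeRegular S k G) :
    TimeRegular S k (fun t x => F t x + G t x) :=
  ⟨hF.decay.add hG.decay, fun ξ => ((hF.cont ξ).add (hG.cont ξ)).congr fun _ ht =>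
    (hF.isSchwartz ht).fourier_add (hG.isSchwartz ht) ξ⟩

theorem const_mul (c : ℂ) (hF : TimeRegular S k F) : TimeRegular S k (fun t x => c * F t x) :=
  ⟨hF.decay.const_mul c, fun ξ => (continuousOn_const.mul (hF.cont ξ)).congr fun _ _ =>
    IsSchwartz.fourier_const_mul c ξ⟩

theorem sub (hF : TimeRegular S k F) (hG : TimeRegular S k G) :
    TimeRegular S k (fun t x => F t x - G t x) :=
  (hF.add (hG.const_mul (-1))).congr fun _ _ => by
    ext x
    ring

theorem conj (hF : TimeRegular S k F) : TimeRegular S k (fun t x => (starRingEnd ℂ) (F t x)) :=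
  ⟨hF.decay.conj, fun ξ => (Complex.continuous_conj.comp_continuousOn (hF.cont (-ξ))).congr
    fun _ _ => IsSchwartz.fourier_conj ξ⟩

theorem pd (hF : TimeRegular S (k + 1) F) (j : Fin 2) :
    TimeRegular S k (fun t => _root_.pd j (F t)) :=
  ⟨hF.decay.pd j, fun ξ => (continuousOn_const.mul (hF.cont ξ)).congr fun _ ht =>
    (hF.isSchwartz ht).fourier_pd j ξ⟩

theorem lap (hF : TimeRegular S (k + 1) F) : TimeRegular S k (fun t => _root_.lap (F t)) :=
  ⟨hF.decay.lap, fun ξ => (continuousOn_const.mul (hF.cont ξ)).congr fun _ ht =>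
    (hF.isSchwartz ht).fourier_lap ξ⟩

theorem mul (hk : 2 ≤ k) (hF : TimeRegular S k F) (hG : TimeRegular S k G) :
    TimeRegular S k (fun t x => F t x * G t x) := by
  refine ⟨hF.decay.mul hk hG.decay, ?_⟩
  obtain ⟨K, hK⟩ := hF.decay.2
  obtain ⟨L, hL⟩ := hG.decay.2
  exact continuousOn_fourier_mul hF.decay.1 hG.decay.1 (fun t ht => (hK t ht).mono hk)
    (fun t ht => (hL t ht).mono (Nat.zero_le k)) hF.cont hG.cont

theorem cub (hk : 2 ≤ k) (hF : TimeRegular S k F) : TimeRegular S k (fun t => cub (F t)) := by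
  simp only [cub_eq]
  exact (hF.mul hk hF.conj).mul hk hF

theorem continuousOn_uncurry (hk : 2 ≤ k) (hF : TimeRegular S k F) :
    ContinuousOn (Function.uncurry F) (S ×ˢ Set.univ) := by
  obtain ⟨K, hK⟩ := hF.decay.2
  have e : Set.EqOn (Function.uncurry F)
      (fun p => ∫ ξ, Real.fourierChar (inner ℝ ξ p.2) • 𝓕 (F p.1) ξ) (S ×ˢ Set.univ) :=
    fun p hp => by
    change F p.1 p.2 = _
    conv_lhs => rw [← (hF.isSchwartz hp.1).fourierInv_fourier]
    rw [Real.fourierInv_eq]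
  refine ContinuousOn.congr ?_ e
  refine continuousOn_of_dominated (bound := fun ξ => K * (jb ξ ^ 2)⁻¹) (fun p hp => ?_)
    (fun p hp => .of_forall fun ξ => ?_) ((integrable_inv_jb_pow le_rfl).const_mul K)
    (.of_forall fun ξ => ?_)
  · simp only [Circle.smul_def, smul_eq_mul]
    refine (Continuous.mul ?_ (hF.isSchwartz hp.1).fourier.continuous).aestronglyMeasurable
    exact continuous_subtype_val.comp (Real.continuous_fourierChar.comp (by fun_prop))
  · rw [Circle.norm_smul]
    exact ((hK p.1 hp.1).mono hk).norm_le ξ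
  · simp only [Circle.smul_def, smul_eq_mul]
    refine ContinuousOn.mul ?_ ((hF.cont ξ).comp continuousOn_fst fun p hp => hp.1)
    refine (continuous_subtype_val.comp (Real.continuous_fourierChar.comp ?_)).continuousOn
    fun_prop

theorem _root_.UniformDecay.hasDerivAt {a b : ℝ} (hF : UniformDecay (Set.Ioo a b) 2 F)
    (hG : UniformDecay (Set.Ioo a b) 2 G)
    (hd : ∀ ξ, ∀ t ∈ Set.Ioo a b, HasDerivAt (fun t => 𝓕 (F t) ξ) (𝓕 (G t) ξ) t) {t : ℝ}
    (ht : t ∈ Set.Ioo a b) (x : Plane) : HasDerivAt (fun t => F t x) (G t x) t := by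
  obtain ⟨K, hK⟩ := hG.2
  have e : ∀ H : ℝ → Plane → ℂ, UniformDecay (Set.Ioo a b) 2 H → ∀ t ∈ Set.Ioo a b,
      H t x = ∫ ξ, Real.fourierChar (inner ℝ ξ x) • 𝓕 (H t) ξ := fun H hH t ht => by
    conv_lhs => rw [← (hH.1 t ht).fourierInv_fourier]
    rw [Real.fourierInv_eq]
  have hcont : ∀ H : ℝ → Plane → ℂ, UniformDecay (Set.Ioo a b) 2 H → ∀ t ∈ Set.Ioo a b,
      Continuous fun ξ => Real.fourierChar (inner ℝ ξ x) • 𝓕 (H t) ξ := fun H hH t ht => by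
    simp only [Circle.smul_def, smul_eq_mul]
    refine Continuous.mul ?_ (hH.1 t ht).fourier.continuous
    exact continuous_subtype_val.comp (Real.continuous_fourierChar.comp (by fun_prop))
  rw [e G hG t ht]
  have hnhds : Set.Ioo a b ∈ nhds t := Ioo_mem_nhds ht.1 ht.2
  refine HasDerivAt.congr_of_eventuallyEq (f := fun t => ∫ ξ,
    Real.fourierChar (inner ℝ ξ x) • 𝓕 (F t) ξ) ?_
    (Filter.mem_of_superset hnhds fun t ht => e F hF t ht)
  refine (hasDerivAt_integral_of_dominated_loc_of_deriv_le (bound := fun ξ => K * (jb ξ ^ 2)⁻¹)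
    (F := fun t ξ => Real.fourierChar (inner ℝ ξ x) • 𝓕 (F t) ξ)
    (F' := fun t ξ => Real.fourierChar (inner ℝ ξ x) • 𝓕 (G t) ξ) hnhds
    (Filter.mem_of_superset hnhds fun t ht => (hcont F hF t ht).aestronglyMeasurable) ?_
    (hcont G hG t ht).aestronglyMeasurable (.of_forall fun ξ s hs => ?_)
    ((integrable_inv_jb_pow le_rfl).const_mul K) (.of_forall fun ξ s hs => ?_)).2
  · refine (hF.1 t ht).fourier.integrable.norm.mono' (hcont F hF t ht).aestronglyMeasurable
      (.of_forall fun ξ => ?_)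
    rw [Circle.norm_smul]
  · rw [Circle.norm_smul]
    exact (hK s hs).norm_le ξ
  · simp only [Circle.smul_def, smul_eq_mul]
    exact (hd ξ s hs).const_mul _

end TimeRegular

/-- `v` solves `i ∂ₜ v + Δ v = G` on `(0, T)` in a uniformly regular class. -/
structure ForcedSchrodinger (T : ℝ) (v G : ℝ → Plane → ℂ) : Prop where
  reg : TimeRegular (Set.Icc 0 T) 4 v
  reg_forcing : TimeRegular (Set.Icc 0 T) 4 G
  hasDerivAt : ∀ t ∈ Set.Ioo 0 T, ∀ x, HasDerivAt (fun t => v t x)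
    (Complex.I * lap (v t) x + -Complex.I * G t x) t
  hasDerivAt_pd : ∀ j, ∀ t ∈ Set.Ioo 0 T, ∀ x, HasDerivAt (fun t => pd j (v t) x)
    (pd j (fun x => Complex.I * lap (v t) x + -Complex.I * G t x) x) t

section Iop

variable {s N T : ℝ} {Ck : ℕ → ℝ} {φ : ℝ → ℝ} {u : ℝ → Plane → ℂ}

theorem TimeRegular.Iop (h : IMultiplier s N Ck φ) (hs : s < 1) (hN : 1 ≤ N) {S : Set ℝ} {k : ℕ}
    {F : ℝ → Plane → ℂ} (hF : TimeRegular S k F) : TimeRegular S k (fun t => Iop φ (F t)) := by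
  refine ⟨⟨fun t ht => h.isSchwartz_Iop hs hN (hF.isSchwartz ht), ?_⟩, fun ξ =>
    (continuousOn_const.mul (hF.cont ξ)).congr fun t ht => h.fourier_Iop hs hN (hF.isSchwartz ht) ξ⟩
  obtain ⟨K, hK⟩ := hF.decay.2
  exact ⟨K, fun t ht => h.fourierDecay_Iop hs hN (hF.isSchwartz ht) (hK t ht)⟩

theorem IsNLSSolution.timeRegular (hu : IsNLSSolution 2 T u) : TimeRegular (Set.Icc 0 T) 4 u := by
  obtain ⟨K, hK⟩ := hu.uniformDecay.2
  exact ⟨hu.uniformDecay, fun ξ => hu.continuousOn_fourier le_rfl le_rfl hK ξ⟩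

theorem IsNLSSolution.forcedSchrodinger (hu : IsNLSSolution 2 T u) (h : IMultiplier s N Ck φ)
    (hs : s < 1) (hN : 1 ≤ N) :
    ForcedSchrodinger T (fun t => Iop φ (u t)) (fun t => Iop φ (cub (u t))) := by
  have hu4 := hu.timeRegular
  have hv := hu4.Iop h hs hN
  have hG := (hu4.cub (by norm_num)).Iop h hs hN
  have hR : TimeRegular (Set.Icc 0 T) 3 (fun t x => Complex.I * lap (Iop φ (u t)) x +
      -Complex.I * Iop φ (cub (u t)) x) :=
    (hv.lap.const_mul _).add ((hG.mono (by norm_num)).const_mul _)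
  have hsub : Set.Ioo 0 T ⊆ Set.Icc 0 T := Set.Ioo_subset_Icc_self
  obtain ⟨K, hK⟩ := hu.uniformDecay.2
  have hdF : ∀ ξ, ∀ t ∈ Set.Ioo 0 T, HasDerivAt (fun t => 𝓕 (Iop φ (u t)) ξ)
      (𝓕 (fun x => Complex.I * lap (Iop φ (u t)) x + -Complex.I * Iop φ (cub (u t)) x) ξ) t :=
    fun ξ t ht => by
    have hut := hu4.isSchwartz (hsub ht)
    have h1 := (hu.hasDerivAt_fourier le_rfl le_rfl hK ξ ht).const_mul (symb φ ξ : ℂ)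
    have e : (fun t => 𝓕 (Iop φ (u t)) ξ) =ᶠ[nhds t] fun t => (symb φ ξ : ℂ) * 𝓕 (u t) ξ :=
      Filter.mem_of_superset (Ioo_mem_nhds ht.1 ht.2) fun σ hσ =>
        h.fourier_Iop hs hN (hu4.isSchwartz (hsub hσ)) ξ
    refine (h1.congr_of_eventuallyEq e).congr_deriv ?_
    rw [((hv.isSchwartz (hsub ht)).lap.const_mul _).fourier_add
      ((hG.isSchwartz (hsub ht)).const_mul _), IsSchwartz.fourier_const_mul,
      IsSchwartz.fourier_const_mul, (hv.isSchwartz (hsub ht)).fourier_lap,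
      h.fourier_Iop hs hN hut, h.fourier_Iop hs hN hut.cub, hu.fourier_dt (hsub ht)]
    push_cast
    ring
  refine ⟨hv, hG, fun t ht x => ?_, fun j t ht x => ?_⟩
  · exact UniformDecay.hasDerivAt ((hv.decay.mono (by norm_num)).mono_set hsub)
      ((hR.decay.mono (by norm_num)).mono_set hsub) hdF ht x
  · refine UniformDecay.hasDerivAt (F := fun t => pd j (Iop φ (u t)))
      (((hv.pd j).decay.mono (by norm_num)).mono_set hsub)
      ((hR.pd j).decay.mono_set hsub) (fun ξ σ hσ => ?_) ht x
    rw [(hR.isSchwartz (hsub hσ)).fourier_pd]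
    refine ((hdF ξ σ hσ).const_mul (2 * π * Complex.I * ξ j)).congr_of_eventuallyEq ?_
    exact Filter.mem_of_superset (Ioo_mem_nhds hσ.1 hσ.2) fun τ hτ =>
      (hv.isSchwartz (hsub hτ)).fourier_pd j ξ

end Iop

namespace IsSchwartzR

variable {f g : Plane → ℝ}

theorem mul (hf : IsSchwartzR f) (hg : IsSchwartzR g) : IsSchwartzR (fun x => f x * g x) := by
  obtain ⟨F, rfl⟩ := hf
  obtain ⟨G, rfl⟩ := hg
  exact ⟨SchwartzMap.pairing (ContinuousLinearMap.mul ℝ ℝ) F G, by ext x; simp⟩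

theorem add (hf : IsSchwartzR f) (hg : IsSchwartzR g) : IsSchwartzR (fun x => f x + g x) := by
  obtain ⟨F, rfl⟩ := hf
  obtain ⟨G, rfl⟩ := hg
  exact ⟨F + G, by ext x; simp⟩

theorem const_mul (c : ℝ) (hf : IsSchwartzR f) : IsSchwartzR (fun x => c * f x) := by
  obtain ⟨F, rfl⟩ := hf
  exact ⟨c • F, by ext x; simp⟩

theorem zero : IsSchwartzR (fun _ : Plane => (0 : ℝ)) := ⟨0, by ext x; simp⟩

theorem sum {ι : Type*} (s : Finset ι) {F : ι → Plane → ℝ}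
    (h : ∀ i ∈ s, IsSchwartzR (F i)) : IsSchwartzR (fun x => ∑ i ∈ s, F i x) := by
  classical
  induction s using Finset.induction_on with
  | empty => simpa using zero
  | insert a s ha ih =>
    simp only [Finset.sum_insert ha]
    exact (h a (Finset.mem_insert_self a s)).add
      (ih fun i hi => h i (Finset.mem_insert_of_mem hi))

theorem pd (hf : IsSchwartzR f) (j : Fin 2) : IsSchwartzR (_root_.pd j f) := by
  obtain ⟨F, rfl⟩ := hf
  refine ⟨LineDeriv.lineDerivOp (EuclideanSpace.single j (1 : ℝ)) F, ?_⟩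
  ext x
  exact SchwartzMap.lineDerivOp_apply_eq_fderiv _ F x

theorem lap (hf : IsSchwartzR f) : IsSchwartzR (_root_.lap f) :=
  sum _ fun j _ => (hf.pd j).pd j

theorem differentiable (hf : IsSchwartzR f) : Differentiable ℝ f := by
  obtain ⟨F, rfl⟩ := hf
  exact F.differentiable

theorem integrable (hf : IsSchwartzR f) : Integrable f := by
  obtain ⟨F, rfl⟩ := hf
  exact F.integrable

end IsSchwartzR

theorem IsSchwartz.re {f : Plane → ℂ} (hf : IsSchwartz f) : IsSchwartzR fun x => (f x).re := by
  obtain ⟨F, rfl⟩ := hf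
  exact ⟨SchwartzMap.postcompCLM (𝕜 := ℝ) Complex.reCLM F, by ext x; simp⟩

theorem IsSchwartz.im {f : Plane → ℂ} (hf : IsSchwartz f) : IsSchwartzR fun x => (f x).im := by
  obtain ⟨F, rfl⟩ := hf
  exact ⟨SchwartzMap.postcompCLM (𝕜 := ℝ) Complex.imCLM F, by ext x; simp⟩

theorem pd_re {f : Plane → ℂ} (hf : Differentiable ℝ f) (j : Fin 2) :
    pd j (fun x => (f x).re) = fun x => (pd j f x).re := by
  ext x
  have := (Complex.reCLM.hasFDerivAt.comp x (hf x).hasFDerivAt).fderiv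
  rw [pd, show (fun x => (f x).re) = ⇑Complex.reCLM ∘ f from rfl, this]
  rfl

theorem pd_im {f : Plane → ℂ} (hf : Differentiable ℝ f) (j : Fin 2) :
    pd j (fun x => (f x).im) = fun x => (pd j f x).im := by
  ext x
  have := (Complex.imCLM.hasFDerivAt.comp x (hf x).hasFDerivAt).fderiv
  rw [pd, show (fun x => (f x).im) = ⇑Complex.imCLM ∘ f from rfl, this]
  rfl

/-- Bounded continuous real functions on the plane. -/
def IsBddCont (h : Plane → ℝ) : Prop := Continuous h ∧ ∃ C, ∀ x, ‖h x‖ ≤ C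

theorem IsBddCont.integrable_mul {h : Plane → ℝ} (hh : IsBddCont h) {f : Plane × Plane → ℝ}
    (hf : Integrable f) : Integrable fun p => h (p.1 - p.2) * f p := by
  obtain ⟨hc, C, hC⟩ := hh
  exact hf.bdd_mul (c := C) (hc.comp (continuous_fst.sub continuous_snd)).aestronglyMeasurable
    (.of_forall fun p => hC _)

/-- The bilinear interaction `∬ h(x - y) f(x) g(y) dx dy`. -/
def interaction (h f g : Plane → ℝ) : ℝ := ∫ p : Plane × Plane, h (p.1 - p.2) * (f p.1 * g p.2)

section Interaction

variable {h f f' g g' : Plane → ℝ}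

theorem IsBddCont.integrable_interaction (hh : IsBddCont h) (hf : Integrable f)
    (hg : Integrable g) :
    Integrable fun p : Plane × Plane => h (p.1 - p.2) * (f p.1 * g p.2) :=
  hh.integrable_mul (hf.mul_prod hg)

theorem interaction_add_left (hh : IsBddCont h) (hf : Integrable f) (hf' : Integrable f')
    (hg : Integrable g) :
    interaction h (fun x => f x + f' x) g = interaction h f g + interaction h f' g := by
  unfold interaction
  rw [← integral_add (hh.integrable_interaction hf hg) (hh.integrable_interaction hf' hg)]
  exact integral_congr_ae (.of_forall fun p => by ring)

theorem interaction_add_right (hh : IsBddCont h) (hf : Integrable f) (hg : Integrable g)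
    (hg' : Integrable g') :
    interaction h f (fun x => g x + g' x) = interaction h f g + interaction h f g' := by
  unfold interaction
  rw [← integral_add (hh.integrable_interaction hf hg) (hh.integrable_interaction hf hg')]
  exact integral_congr_ae (.of_forall fun p => by ring)

theorem interaction_const_mul_left (c : ℝ) :
    interaction h (fun x => c * f x) g = c * interaction h f g := by
  unfold interaction
  rw [← integral_const_mul]
  exact integral_congr_ae (.of_forall fun p => by ring)

theorem interaction_const_mul_right (c : ℝ) :
    interaction h f (fun x => c * g x) = c * interaction h f g := by
  unfold interaction
  rw [← integral_const_mul]
  exact integral_congr_ae (.of_forall fun p => by ring)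

theorem interaction_sum_left {ι : Type*} (s : Finset ι) {F : ι → Plane → ℝ} (hh : IsBddCont h)
    (hF : ∀ i ∈ s, Integrable (F i)) (hg : Integrable g) :
    interaction h (fun x => ∑ i ∈ s, F i x) g = ∑ i ∈ s, interaction h (F i) g := by
  unfold interaction
  rw [← integral_finsetSum _ fun i hi => hh.integrable_interaction (hF i hi) hg]
  refine integral_congr_ae (.of_forall fun p => ?_)
  simp only [Finset.sum_mul, Finset.mul_sum]

theorem interaction_sum_right {ι : Type*} (s : Finset ι) {F : ι → Plane → ℝ} (hh : IsBddCont h)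
    (hf : Integrable f) (hF : ∀ i ∈ s, Integrable (F i)) :
    interaction h f (fun x => ∑ i ∈ s, F i x) = ∑ i ∈ s, interaction h f (F i) := by
  unfold interaction
  rw [← integral_finsetSum _ fun i hi => hh.integrable_interaction hf (hF i hi)]
  refine integral_congr_ae (.of_forall fun p => ?_)
  simp only [Finset.mul_sum]

theorem interaction_swap : interaction h f g = interaction (fun z => h (-z)) g f := by
  unfold interaction
  rw [Measure.volume_eq_prod, ← integral_prod_swap]
  refine integral_congr_ae (.of_forall fun p => ?_)
  simp only [Prod.fst_swap, Prod.snd_swap, neg_sub]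
  ring

theorem integral_mul_pd_eq_neg (hd : Differentiable ℝ h) (hh : IsBddCont h) (k : Fin 2)
    (hh' : IsBddCont (pd k h)) (hf : IsSchwartzR f) :
    ∫ x, h x * pd k f x = -∫ x, pd k h x * f x := by
  obtain ⟨hc, C, hC⟩ := hh
  obtain ⟨hc', C', hC'⟩ := hh'
  exact integral_mul_fderiv_eq_neg_fderiv_mul_of_integrable
    (hf.integrable.bdd_mul hc'.aestronglyMeasurable (.of_forall hC'))
    ((hf.pd k).integrable.bdd_mul hc.aestronglyMeasurable (.of_forall hC))
    (hf.integrable.bdd_mul hc.aestronglyMeasurable (.of_forall hC))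
    (fun x _ => hd x) (fun x _ => hf.differentiable x)

theorem interaction_pd_left (hd : Differentiable ℝ h) (hh : IsBddCont h) (k : Fin 2)
    (hh' : IsBddCont (pd k h)) (hf : IsSchwartzR f) (hg : Integrable g) :
    interaction h (pd k f) g = -interaction (pd k h) f g := by
  unfold interaction
  have i1 := hh.integrable_interaction (hf.pd k).integrable hg
  have i2 := hh'.integrable_interaction hf.integrable hg
  rw [Measure.volume_eq_prod] at i1 i2 ⊢
  rw [integral_prod_symm _ i1, integral_prod_symm _ i2, ← integral_neg]
  refine integral_congr_ae (.of_forall fun y => ?_)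
  have e : ∀ x, pd k (fun x => h (x - y)) x = pd k h (x - y) := fun x => by
    simp only [pd, fderiv_comp_sub]
  have key := integral_mul_pd_eq_neg (h := fun x => h (x - y)) (f := f)
    (hd.comp (differentiable_id.sub_const y))
    ⟨hh.1.comp (continuous_id.sub continuous_const), hh.2.imp fun C hC x => hC _⟩ k
    (by
      rw [show pd k (fun x => h (x - y)) = fun x => pd k h (x - y) from funext e]
      exact ⟨hh'.1.comp (continuous_id.sub continuous_const), hh'.2.imp fun C hC x => hC _⟩) hf
  simp only [e] at key
  simp only [← mul_assoc, integral_mul_const, key]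
  ring

theorem pd_comp_neg (k : Fin 2) : pd k (fun z => h (-z)) = fun z => -pd k h (-z) := by
  ext z
  simp only [pd]
  rw [show (fun z => h (-z)) = h ∘ ⇑(ContinuousLinearEquiv.neg ℝ : Plane ≃L[ℝ] Plane) from rfl,
    ContinuousLinearEquiv.comp_right_fderiv]
  simp

theorem IsBddCont.comp_neg (hh : IsBddCont h) : IsBddCont fun z => h (-z) :=
  ⟨hh.1.comp continuous_neg, hh.2.imp fun _ hC _ => hC _⟩

theorem IsBddCont.neg (hh : IsBddCont h) : IsBddCont fun z => -h z :=
  ⟨hh.1.neg, hh.2.imp fun _ hC x => by simpa using hC x⟩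

theorem interaction_neg : interaction (fun z => -h z) f g = -interaction h f g := by
  unfold interaction
  rw [← integral_neg]
  exact integral_congr_ae (.of_forall fun p => by ring)

theorem interaction_pd_right (hd : Differentiable ℝ h) (hh : IsBddCont h) (k : Fin 2)
    (hh' : IsBddCont (pd k h)) (hf : Integrable f) (hg : IsSchwartzR g) :
    interaction h f (pd k g) = interaction (pd k h) f g := by
  rw [interaction_swap, interaction_pd_left (h := fun z => h (-z)) (hd.comp differentiable_id.neg)
    hh.comp_neg k (by rw [pd_comp_neg]; exact hh'.comp_neg.neg) hg hf, pd_comp_neg,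
    interaction_neg, neg_neg]
  exact (interaction_swap).symm

end Interaction

theorem pd_add {f g : Plane → ℂ} (hf : IsSchwartz f) (hg : IsSchwartz g) (j : Fin 2) :
    pd j (fun x => f x + g x) = fun x => pd j f x + pd j g x := by
  ext x
  have := fderiv_add (hf.differentiable x) (hg.differentiable x)
  simp only [pd]
  rw [show (fun x => f x + g x) = f + g from rfl, this]
  rfl

theorem pd_const_mul {f : Plane → ℂ} (hf : IsSchwartz f) (c : ℂ) (j : Fin 2) :
    pd j (fun x => c * f x) = fun x => c * pd j f x := by
  ext x
  simp only [pd]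
  rw [fderiv_const_mul (hf.differentiable x)]
  rfl

theorem IsSchwartz.lap_pd {f : Plane → ℂ} (hf : IsSchwartz f) (j : Fin 2) :
    _root_.lap (_root_.pd j f) = _root_.pd j (_root_.lap f) :=
  ((hf.pd j).lap).ext_fourier (hf.lap.pd j) fun ξ => by
    rw [(hf.pd j).fourier_lap, hf.lap.fourier_pd, hf.fourier_lap, hf.fourier_pd]
    ring

theorem lap_mul {f g : Plane → ℂ} (hf : IsSchwartz f) (hg : IsSchwartz g) :
    lap (fun x => f x * g x) =
      fun x => lap f x * g x + 2 * ∑ k, pd k f x * pd k g x + f x * lap g x := by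
  ext x
  have h : ∀ k, pd k (pd k fun x => f x * g x) x =
      pd k (pd k f) x * g x + 2 * (pd k f x * pd k g x) + f x * pd k (pd k g) x := fun k => by
    rw [pd_mul hf hg, pd_add ((hf.pd k).mul hg) (hf.mul (hg.pd k)), pd_mul (hf.pd k) hg,
      pd_mul hf (hg.pd k)]
    ring
  simp only [lap, h, Fin.sum_univ_two]
  ring

theorem lap_re {f : Plane → ℂ} (hf : IsSchwartz f) :
    lap (fun x => (f x).re) = fun x => (lap f x).re := by
  ext x
  simp only [lap, pd_re hf.differentiable, pd_re (hf.pd _).differentiable, Complex.re_sum]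

/-- The mass density `|v|²`. -/
def massDensity (v : Plane → ℂ) (x : Plane) : ℝ := ‖v x‖ ^ 2

/-- The momentum density `Im (v̄ ∂ⱼ v)`. -/
def momDensity (v : Plane → ℂ) (j : Fin 2) (x : Plane) : ℝ :=
  ((starRingEnd ℂ) (v x) * pd j v x).im

/-- The stress `Re (∂ⱼ v ∂ₖ v̄)`. -/
def stress (v : Plane → ℂ) (j k : Fin 2) (x : Plane) : ℝ :=
  (pd j v x * (starRingEnd ℂ) (pd k v x)).re

/-- The rate of change of the mass density when `∂ₜ v = w`. -/
def massRate (v w : Plane → ℂ) (x : Plane) : ℝ := 2 * ((starRingEnd ℂ) (v x) * w x).re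

/-- The rate of change of the momentum density when `∂ₜ v = w`. -/
def momRate (v w : Plane → ℂ) (j : Fin 2) (x : Plane) : ℝ :=
  ((starRingEnd ℂ) (w x) * pd j v x + (starRingEnd ℂ) (v x) * pd j w x).im

/-- The mass production `2 Im (v̄ W)` of a forcing term `W`. -/
def massForce (v W : Plane → ℂ) (x : Plane) : ℝ := 2 * ((starRingEnd ℂ) (v x) * W x).im

/-- The momentum bracket `{W, v}ⱼ`. -/
def momForce (v W : Plane → ℂ) (j : Fin 2) (x : Plane) : ℝ :=
  (W x * (starRingEnd ℂ) (pd j v x) - v x * (starRingEnd ℂ) (pd j W x)).re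

theorem massDensity_eq (v : Plane → ℂ) :
    massDensity v = fun x => ((starRingEnd ℂ) (v x) * v x).re := by
  ext x
  rw [massDensity, mul_comm, Complex.mul_conj, Complex.normSq_eq_norm_sq, Complex.ofReal_re]

namespace IsSchwartz

variable {v w : Plane → ℂ}

theorem massDensity (hv : IsSchwartz v) : IsSchwartzR (massDensity v) := by
  rw [massDensity_eq]
  exact (hv.conj.mul hv).re

theorem momDensity (hv : IsSchwartz v) (j : Fin 2) : IsSchwartzR (momDensity v j) :=
  (hv.conj.mul (hv.pd j)).im

theorem stress (hv : IsSchwartz v) (j k : Fin 2) : IsSchwartzR (stress v j k) :=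
  ((hv.pd j).mul (hv.pd k).conj).re

theorem massForce (hv : IsSchwartz v) (hw : IsSchwartz w) : IsSchwartzR (massForce v w) :=
  (hv.conj.mul hw).im.const_mul 2

theorem momForce (hv : IsSchwartz v) (hw : IsSchwartz w) (j : Fin 2) :
    IsSchwartzR (momForce v w j) :=
  ((hw.mul (hv.pd j).conj).sub (hv.mul (hw.pd j).conj)).re

theorem massRate_eq (hv : IsSchwartz v) (G : Plane → ℂ) (x : Plane) :
    massRate v (fun x => Complex.I * _root_.lap v x + -Complex.I * G x) x =
      -2 * ∑ k, _root_.pd k (_root_.momDensity v k) x +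
        _root_.massForce v (fun x => G x - _root_.cub v x) x := by
  have h1 : ∀ k, _root_.pd k (_root_.momDensity v k) x =
      ((starRingEnd ℂ) (_root_.pd k v x) * _root_.pd k v x +
        (starRingEnd ℂ) (v x) * _root_.pd k (_root_.pd k v) x).im := fun k => by
    have e : _root_.momDensity v k = fun x => ((starRingEnd ℂ) (v x) * _root_.pd k v x).im := rfl
    rw [e, pd_im (hv.conj.mul (hv.pd k)).differentiable, pd_mul hv.conj (hv.pd k), pd_conj]
  simp only [h1, massRate, _root_.massForce, _root_.lap, cub_eq, Fin.sum_univ_two,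
    Complex.add_re, Complex.add_im, Complex.mul_re, Complex.mul_im, Complex.sub_re,
    Complex.sub_im, Complex.neg_re, Complex.neg_im, Complex.I_re, Complex.I_im, Complex.conj_re,
    Complex.conj_im]
  ring

theorem momRate_eq (hv : IsSchwartz v) {G : Plane → ℂ} (hG : IsSchwartz G) (j : Fin 2)
    (x : Plane) :
    momRate v (fun x => Complex.I * _root_.lap v x + -Complex.I * G x) j x =
      -2 * ∑ k, _root_.pd k (_root_.stress v j k) x +
        1 / 2 * _root_.pd j (_root_.lap (_root_.massDensity v)) x +
        -(1 / 2) * _root_.pd j (fun x => _root_.massDensity v x * _root_.massDensity v x) x +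
        _root_.momForce v (fun x => G x - _root_.cub v x) j x := by
  have hvj := hv.pd j
  have hvv := hv.conj.mul hv
  have h1 : ∀ k, _root_.pd k (_root_.stress v j k) x =
      (_root_.pd k (_root_.pd j v) x * (starRingEnd ℂ) (_root_.pd k v x) +
        _root_.pd j v x * (starRingEnd ℂ) (_root_.pd k (_root_.pd k v) x)).re := fun k => by
    have e : _root_.stress v j k =
      fun x => (_root_.pd j v x * (starRingEnd ℂ) (_root_.pd k v x)).re := rfl
    rw [e, pd_re (hvj.mul (hv.pd k).conj).differentiable, pd_mul hvj (hv.pd k).conj, pd_conj]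
  have h2 : _root_.pd j (_root_.lap (_root_.massDensity v)) x =
      ((starRingEnd ℂ) (_root_.pd j (_root_.lap v) x) * v x +
        2 * ∑ k, (starRingEnd ℂ) (_root_.pd k (_root_.pd j v) x) * _root_.pd k v x +
        (starRingEnd ℂ) (_root_.pd j v x) * _root_.lap v x +
        ((starRingEnd ℂ) (_root_.lap v x) * _root_.pd j v x +
        2 * ∑ k, (starRingEnd ℂ) (_root_.pd k v x) * _root_.pd k (_root_.pd j v) x +
        (starRingEnd ℂ) (v x) * _root_.pd j (_root_.lap v) x)).re := by
    rw [massDensity_eq, lap_re hvv, pd_re hvv.lap.differentiable, ← hvv.lap_pd,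
      pd_mul hv.conj hv, pd_conj]
    have e : _root_.lap (fun x => (starRingEnd ℂ) (_root_.pd j v x) * v x +
        (starRingEnd ℂ) (v x) * _root_.pd j v x) x =
        _root_.lap (fun x => (starRingEnd ℂ) (_root_.pd j v x) * v x) x +
        _root_.lap (fun x => (starRingEnd ℂ) (v x) * _root_.pd j v x) x := by
      have h : ∀ k, _root_.pd k (_root_.pd k (fun x => (starRingEnd ℂ) (_root_.pd j v x) * v x +
          (starRingEnd ℂ) (v x) * _root_.pd j v x)) x = _root_.pd k (_root_.pd k (fun x =>
          (starRingEnd ℂ) (_root_.pd j v x) * v x)) x + _root_.pd k (_root_.pd k (fun x =>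
          (starRingEnd ℂ) (v x) * _root_.pd j v x)) x := fun k => by
        rw [pd_add (hvj.conj.mul hv) (hv.conj.mul hvj),
          pd_add ((hvj.conj.mul hv).pd k) ((hv.conj.mul hvj).pd k)]
      simp only [_root_.lap, h, Finset.sum_add_distrib]
    simp only [e]
    rw [_root_.lap_mul hvj.conj hv, _root_.lap_mul hv.conj hvj]
    simp only [lap_conj, hv.lap_pd, pd_conj]
  have h3 : _root_.pd j (fun x => _root_.massDensity v x * _root_.massDensity v x) x =
      (2 * ((starRingEnd ℂ) (_root_.pd j v x) * v x + (starRingEnd ℂ) (v x) * _root_.pd j v x) *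
        ((starRingEnd ℂ) (v x) * v x)).re := by
    have e : (fun x => _root_.massDensity v x * _root_.massDensity v x) = fun x =>
        (((starRingEnd ℂ) (v x) * v x) * ((starRingEnd ℂ) (v x) * v x)).re := by
      ext x
      simp only [massDensity_eq, Complex.mul_re, Complex.mul_im, Complex.conj_re, Complex.conj_im]
      ring
    rw [e, pd_re (hvv.mul hvv).differentiable, pd_mul hvv hvv, pd_mul hv.conj hv, pd_conj]
    simp only [Complex.mul_re, Complex.mul_im, Complex.add_re, Complex.add_im, Complex.conj_re,
      Complex.conj_im, Complex.re_ofNat, Complex.im_ofNat]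
    ring
  have h4 : _root_.pd j (fun x => Complex.I * _root_.lap v x + -Complex.I * G x) x =
      Complex.I * _root_.pd j (_root_.lap v) x + -Complex.I * _root_.pd j G x := by
    rw [pd_add (hv.lap.const_mul _) (hG.const_mul _), pd_const_mul hv.lap, pd_const_mul hG]
  have h5 : _root_.pd j (fun x => G x - _root_.cub v x) x = _root_.pd j G x -
      ((_root_.pd j v x * (starRingEnd ℂ) (v x) + v x * (starRingEnd ℂ) (_root_.pd j v x)) * v x +
      v x * (starRingEnd ℂ) (v x) * _root_.pd j v x) := by
    have e : (fun x => G x - _root_.cub v x) = fun x => G x + -1 * _root_.cub v x := by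
      ext x
      ring
    rw [e, pd_add hG (hv.cub.const_mul _), pd_const_mul hv.cub, cub_eq,
      pd_mul (hv.mul hv.conj) hv, pd_mul hv hv.conj, pd_conj]
    ring
  simp only [h1, h2, h3, momRate, _root_.momForce, h4, h5]
  simp only [cub_eq, _root_.lap, Fin.sum_univ_two, Complex.re_ofNat, Complex.im_ofNat,
    Complex.add_re, Complex.add_im, Complex.mul_re, Complex.mul_im, Complex.sub_re,
    Complex.sub_im, Complex.neg_re, Complex.neg_im, Complex.I_re, Complex.I_im, Complex.conj_re,
    Complex.conj_im]
  ring

end IsSchwartz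

theorem IsBddCont.mul {f g : Plane → ℝ} (hf : IsBddCont f) (hg : IsBddCont g) :
    IsBddCont fun x => f x * g x := by
  obtain ⟨hf, C, hC⟩ := hf
  obtain ⟨hg, D, hD⟩ := hg
  refine ⟨hf.mul hg, C * D, fun x => ?_⟩
  rw [norm_mul]
  exact mul_le_mul (hC x) (hD x) (norm_nonneg _) ((norm_nonneg _).trans (hC x))

theorem IsBddCont.add {f g : Plane → ℝ} (hf : IsBddCont f) (hg : IsBddCont g) :
    IsBddCont fun x => f x + g x := by
  obtain ⟨hf, C, hC⟩ := hf
  obtain ⟨hg, D, hD⟩ := hg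
  exact ⟨hf.add hg, C + D, fun x => (norm_add_le _ _).trans (add_le_add (hC x) (hD x))⟩

theorem IsBddCont.const (c : ℝ) : IsBddCont fun _ => c := ⟨continuous_const, ‖c‖, fun _ => le_rfl⟩

theorem IsBddCont.sub {f g : Plane → ℝ} (hf : IsBddCont f) (hg : IsBddCont g) :
    IsBddCont fun x => f x - g x := by
  obtain ⟨hf, C, hC⟩ := hf
  obtain ⟨hg, D, hD⟩ := hg
  exact ⟨hf.sub hg, C + D, fun x => (norm_sub_le _ _).trans (add_le_add (hC x) (hD x))⟩

theorem IsBddCont.pow {f : Plane → ℝ} (hf : IsBddCont f) (n : ℕ) :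
    IsBddCont fun x => f x ^ n := by
  obtain ⟨hf, C, hC⟩ := hf
  refine ⟨hf.pow n, C ^ n, fun x => ?_⟩
  rw [norm_pow]
  exact pow_le_pow_left₀ (norm_nonneg _) (hC x) n

section RealDerivatives

variable {f g : Plane → ℝ}

theorem pd_mul_real (hf : Differentiable ℝ f) (hg : Differentiable ℝ g) (j : Fin 2) :
    pd j (fun x => f x * g x) = fun x => pd j f x * g x + f x * pd j g x := by
  ext x
  have := fderiv_mul (hf x) (hg x)
  simp only [pd]
  rw [show (fun x => f x * g x) = f * g from rfl, this]
  simp only [_root_.add_apply, _root_.smul_apply, smul_eq_mul]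
  ring

theorem pd_add_real (hf : Differentiable ℝ f) (hg : Differentiable ℝ g) (j : Fin 2) :
    pd j (fun x => f x + g x) = fun x => pd j f x + pd j g x := by
  ext x
  have := fderiv_add (hf x) (hg x)
  simp only [pd]
  rw [show (fun x => f x + g x) = f + g from rfl, this]
  rfl

theorem pd_const_mul_real (hf : Differentiable ℝ f) (c : ℝ) (j : Fin 2) :
    pd j (fun x => c * f x) = fun x => c * pd j f x := by
  ext x
  simp only [pd]
  rw [fderiv_const_mul (hf x)]
  rfl

theorem pd_pow_real (hf : Differentiable ℝ f) (n : ℕ) (j : Fin 2) :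
    pd j (fun x => f x ^ n) = fun x => n * f x ^ (n - 1) * pd j f x := by
  ext x
  have := ((hf x).hasFDerivAt.pow n).fderiv
  simp only [pd]
  rw [this]
  simp

theorem pd_coord (j k : Fin 2) (x : Plane) :
    pd k (fun x : Plane => x j) x = if j = k then 1 else 0 := by
  have : fderiv ℝ (fun x : Plane => x j) x = EuclideanSpace.proj j :=
    (EuclideanSpace.proj (𝕜 := ℝ) j).fderiv
  rw [pd, this]
  simp

end RealDerivatives

/-- The inverse regularised distance `(r² + ‖x‖²)^{-1/2}`. -/
def invRad (r : ℝ) (x : Plane) : ℝ := (√(r ^ 2 + ‖x‖ ^ 2))⁻¹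

/-- The regularised radial direction `x / (r² + ‖x‖²)^{1/2}`, the gradient of the regularised
distance. -/
def radDir (r : ℝ) (j : Fin 2) (x : Plane) : ℝ := x j * invRad r x

/-- The Hessian of the regularised distance. -/
def radHess (r : ℝ) (j k : Fin 2) (x : Plane) : ℝ :=
  ((if j = k then 1 else 0) - radDir r j x * radDir r k x) * invRad r x

/-- The Laplacian of the regularised distance. -/
def radLap (r : ℝ) (x : Plane) : ℝ := invRad r x + r ^ 2 * invRad r x ^ 3

/-- Minus the bilaplacian of the regularised distance. -/
def radKernel (r : ℝ) (x : Plane) : ℝ :=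
  -(invRad r x ^ 3 + 6 * r ^ 2 * invRad r x ^ 5 - 15 * r ^ 4 * invRad r x ^ 7)

/-- The negative of a primitive of `radKernel` in the regularisation parameter. -/
def radPrim (r : ℝ) (x : Plane) : ℝ := r * invRad r x ^ 3 + 3 * r ^ 3 * invRad r x ^ 5

section Weights

variable {r : ℝ}

theorem norm_sq_eq_coord (x : Plane) : ‖x‖ ^ 2 = x 0 ^ 2 + x 1 ^ 2 := by
  rw [EuclideanSpace.norm_sq_eq, Fin.sum_univ_two]
  simp

theorem rad_sq_pos (hr : 0 < r) (x : Plane) : 0 < r ^ 2 + ‖x‖ ^ 2 := by positivity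

theorem invRad_pos (hr : 0 < r) (x : Plane) : 0 < invRad r x :=
  inv_pos.2 (Real.sqrt_pos.2 (rad_sq_pos hr x))

theorem invRad_sq (hr : 0 < r) (x : Plane) : invRad r x ^ 2 * (r ^ 2 + ‖x‖ ^ 2) = 1 := by
  rw [invRad, inv_pow, Real.sq_sqrt (rad_sq_pos hr x).le]
  exact inv_mul_cancel₀ (rad_sq_pos hr x).ne'

theorem mul_invRad_le_one (hr : 0 < r) (x : Plane) : r * invRad r x ≤ 1 := by
  have := invRad_sq hr x
  nlinarith [mul_nonneg (sq_nonneg (invRad r x)) (sq_nonneg ‖x‖),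
    mul_pos hr (invRad_pos hr x)]

theorem invRad_le (hr : 0 < r) (x : Plane) : invRad r x ≤ r⁻¹ := by
  rw [le_inv_comm₀ (invRad_pos hr x) hr, le_inv_comm₀ hr (invRad_pos hr x), inv_eq_one_div,
    le_div_iff₀ hr, mul_comm]
  exact mul_invRad_le_one hr x

theorem radDir_sq_add (hr : 0 < r) (x : Plane) :
    radDir r 0 x ^ 2 + radDir r 1 x ^ 2 + r ^ 2 * invRad r x ^ 2 = 1 := by
  have := invRad_sq hr x
  rw [norm_sq_eq_coord] at this
  simp only [radDir]
  linarith

theorem abs_radDir_le_one (hr : 0 < r) (j : Fin 2) (x : Plane) : |radDir r j x| ≤ 1 := by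
  have := radDir_sq_add hr x
  refine abs_le_one_iff_mul_self_le_one.2 ?_
  fin_cases j <;> simp only [Fin.zero_eta, Fin.mk_one] <;>
    nlinarith [sq_nonneg (radDir r 0 x), sq_nonneg (radDir r 1 x), sq_nonneg (r * invRad r x)]

theorem differentiable_invRad (hr : 0 < r) : Differentiable ℝ (invRad r) := fun x =>
  ((((differentiable_id.norm_sq ℝ).const_add (r ^ 2)) x).sqrt (rad_sq_pos hr x).ne').inv
    (Real.sqrt_pos.2 (rad_sq_pos hr x)).ne'

theorem differentiable_coord (j : Fin 2) : Differentiable ℝ fun x : Plane => x j :=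
  (EuclideanSpace.proj (𝕜 := ℝ) j).differentiable

theorem differentiable_radDir (hr : 0 < r) (j : Fin 2) : Differentiable ℝ (radDir r j) :=
  (differentiable_coord j).mul (differentiable_invRad hr)

theorem differentiable_radLap (hr : 0 < r) : Differentiable ℝ (radLap r) :=
  (differentiable_invRad hr).add (((differentiable_invRad hr).pow 3).const_mul _)

theorem isBddCont_invRad (hr : 0 < r) : IsBddCont (invRad r) :=
  ⟨(differentiable_invRad hr).continuous, r⁻¹, fun x => by
    rw [Real.norm_of_nonneg (invRad_pos hr x).le]
    exact invRad_le hr x⟩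

theorem isBddCont_radDir (hr : 0 < r) (j : Fin 2) : IsBddCont (radDir r j) :=
  ⟨(differentiable_radDir hr j).continuous, 1, abs_radDir_le_one hr j⟩

theorem isBddCont_radHess (hr : 0 < r) (j k : Fin 2) : IsBddCont (radHess r j k) :=
  ((IsBddCont.const _).sub ((isBddCont_radDir hr j).mul (isBddCont_radDir hr k))).mul
    (isBddCont_invRad hr)

theorem isBddCont_radLap (hr : 0 < r) : IsBddCont (radLap r) :=
  (isBddCont_invRad hr).add ((IsBddCont.const _).mul ((isBddCont_invRad hr).pow 3))

theorem isBddCont_radKernel (hr : 0 < r) : IsBddCont (radKernel r) := by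
  have h := isBddCont_invRad hr
  have := (IsBddCont.const (-1)).mul ((((h.pow 3).add ((IsBddCont.const (6 * r ^ 2)).mul
    (h.pow 5))).sub ((IsBddCont.const (15 * r ^ 4)).mul (h.pow 7))))
  convert this using 2 with x
  simp only [radKernel]
  ring

theorem isBddCont_radPrim (hr : 0 < r) : IsBddCont (radPrim r) :=
  ((IsBddCont.const _).mul ((isBddCont_invRad hr).pow 3)).add
    ((IsBddCont.const _).mul ((isBddCont_invRad hr).pow 5))

theorem pd_invRad (hr : 0 < r) (k : Fin 2) :
    pd k (invRad r) = fun x => -radDir r k x * invRad r x ^ 2 := by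
  have hg := differentiable_invRad hr
  have h : (fun x : Plane => invRad r x ^ 2 * (r ^ 2 + (x 0 ^ 2 + x 1 ^ 2))) = fun _ => 1 := by
    ext x
    rw [← norm_sq_eq_coord, invRad_sq hr]
  have h0 : ∀ j, Differentiable ℝ fun x : Plane => x j ^ 2 := fun j =>
    (differentiable_coord j).pow 2
  have hc : Differentiable ℝ fun _ : Plane => r ^ 2 := differentiable_const _
  have e : pd k (fun _ : Plane => r ^ 2) = fun _ => (0 : ℝ) := by
    ext x
    simp [pd]
  have e' : pd k (fun _ : Plane => (1 : ℝ)) = fun _ => (0 : ℝ) := by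
    ext x
    simp [pd]
  have h1 := congrArg (pd k) h
  rw [e', pd_mul_real (hg.fun_pow 2) (hc.fun_add ((h0 0).fun_add (h0 1))), pd_pow_real hg,
    pd_add_real hc ((h0 0).fun_add (h0 1)), pd_add_real (h0 0) (h0 1), e,
    pd_pow_real (differentiable_coord 0), pd_pow_real (differentiable_coord 1)] at h1
  ext x
  have h2 := congrFun h1 x
  have h3 := invRad_sq hr x
  rw [norm_sq_eq_coord] at h3
  simp only [pd_coord] at h2
  have h4 : 2 * invRad r x * pd k (invRad r) x * (r ^ 2 + (x 0 ^ 2 + x 1 ^ 2)) +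
      invRad r x ^ 2 * (2 * x k) = 0 := by
    rw [← h2]
    fin_cases k <;> simp
  have hp := invRad_pos hr x
  have h5 : 2 * pd k (invRad r) x = 2 * (-radDir r k x * invRad r x ^ 2) := by
    calc 2 * pd k (invRad r) x = 2 * pd k (invRad r) x *
          (invRad r x ^ 2 * (r ^ 2 + (x 0 ^ 2 + x 1 ^ 2))) := by rw [h3, mul_one]
      _ = invRad r x * (2 * invRad r x * pd k (invRad r) x * (r ^ 2 + (x 0 ^ 2 + x 1 ^ 2)) +
          invRad r x ^ 2 * (2 * x k)) - 2 * x k * invRad r x ^ 3 := by ring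
      _ = _ := by
        rw [h4, radDir]
        ring
  linarith

theorem pd_radDir (hr : 0 < r) (j k : Fin 2) : pd k (radDir r j) = radHess r j k := by
  ext x
  rw [show radDir r j = fun x => x j * invRad r x from rfl,
    pd_mul_real (differentiable_coord j) (differentiable_invRad hr), pd_invRad hr]
  simp only [pd_coord, radHess, radDir]
  ring

theorem sum_radHess (hr : 0 < r) (x : Plane) :
    radHess r 0 0 x + radHess r 1 1 x = radLap r x := by
  have := radDir_sq_add hr x
  simp only [radHess, radLap, if_true]
  linear_combination (-invRad r x) * this

theorem pd_radLap (hr : 0 < r) (k : Fin 2) :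
    pd k (radLap r) =
      fun x => -1 * (radDir r k x * (invRad r x ^ 2 + 3 * r ^ 2 * invRad r x ^ 4)) := by
  have hg := differentiable_invRad hr
  ext x
  rw [show radLap r = fun x => invRad r x + r ^ 2 * invRad r x ^ 3 from rfl,
    pd_add_real hg ((hg.fun_pow 3).const_mul _), pd_const_mul_real (hg.fun_pow 3), pd_pow_real hg,
    pd_invRad hr]
  push_cast
  ring

theorem differentiable_pd_radLap (hr : 0 < r) (k : Fin 2) : Differentiable ℝ (pd k (radLap r)) := by
  have hg := differentiable_invRad hr
  rw [pd_radLap hr]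
  exact ((differentiable_radDir hr k).mul
    ((hg.fun_pow 2).fun_add ((hg.fun_pow 4).const_mul _))).const_mul _

theorem isBddCont_pd_radLap (hr : 0 < r) (k : Fin 2) : IsBddCont (pd k (radLap r)) := by
  have hg := isBddCont_invRad hr
  rw [pd_radLap hr]
  exact (IsBddCont.const _).mul ((isBddCont_radDir hr k).mul
    ((hg.pow 2).add ((IsBddCont.const _).mul (hg.pow 4))))

theorem pd_pd_radLap (hr : 0 < r) (k : Fin 2) :
    pd k (pd k (radLap r)) = fun x => -1 * (radHess r k k x *
      (invRad r x ^ 2 + 3 * r ^ 2 * invRad r x ^ 4) -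
        radDir r k x ^ 2 * (2 * invRad r x ^ 3 + 12 * r ^ 2 * invRad r x ^ 5)) := by
  have hg := differentiable_invRad hr
  ext x
  rw [pd_radLap hr, pd_const_mul_real ((differentiable_radDir hr k).fun_mul
    ((hg.fun_pow 2).fun_add ((hg.fun_pow 4).const_mul _))), pd_mul_real (differentiable_radDir hr k)
    ((hg.fun_pow 2).fun_add ((hg.fun_pow 4).const_mul _)),
    pd_add_real (hg.fun_pow 2) ((hg.fun_pow 4).const_mul _),
    pd_const_mul_real (hg.fun_pow 4), pd_pow_real hg, pd_pow_real hg, pd_invRad hr, pd_radDir hr]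
  push_cast
  ring

theorem isBddCont_pd_pd_radLap (hr : 0 < r) (k : Fin 2) : IsBddCont (pd k (pd k (radLap r))) := by
  have hg := isBddCont_invRad hr
  rw [pd_pd_radLap hr]
  exact (IsBddCont.const _).mul (((isBddCont_radHess hr k k).mul
    ((hg.pow 2).add ((IsBddCont.const _).mul (hg.pow 4)))).sub (((isBddCont_radDir hr k).pow 2).mul
    (((IsBddCont.const _).mul (hg.pow 3)).add ((IsBddCont.const _).mul (hg.pow 5)))))

theorem lap_radLap (hr : 0 < r) (x : Plane) :
    pd 0 (pd 0 (radLap r)) x + pd 1 (pd 1 (radLap r)) x = -radKernel r x := by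
  have h := radDir_sq_add hr x
  rw [pd_pd_radLap hr, pd_pd_radLap hr]
  simp only [radHess, radKernel, if_true]
  linear_combination (3 * invRad r x ^ 3 + 15 * r ^ 2 * invRad r x ^ 5) * h

theorem radLap_nonneg (hr : 0 < r) (x : Plane) : 0 ≤ radLap r x := by
  have := invRad_pos hr x
  unfold radLap
  positivity

theorem radPrim_nonneg (hr : 0 < r) (x : Plane) : 0 ≤ radPrim r x := by
  have := invRad_pos hr x
  unfold radPrim
  positivity

theorem radPrim_le (hr : 0 < r) (x : Plane) : radPrim r x ≤ 4 * (r⁻¹) ^ 2 := by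
  have h0 := (invRad_pos hr x).le
  have h1 := invRad_le hr x
  have h2 := mul_invRad_le_one hr x
  have h3 : radPrim r x = (r * invRad r x + 3 * (r * invRad r x) ^ 3) * invRad r x ^ 2 := by
    rw [radPrim]
    ring
  rw [h3]
  have h4 : 0 ≤ r * invRad r x := mul_nonneg hr.le h0
  refine mul_le_mul ?_ (pow_le_pow_left₀ h0 h1 2) (sq_nonneg _) (by norm_num)
  nlinarith [pow_le_one₀ h4 h2 (n := 3)]

theorem le_radPrim (hr : 0 < r) {x : Plane} (hx : ‖x‖ ≤ r) : 1 / 4 * (r⁻¹) ^ 2 ≤ radPrim r x := by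
  have h0 := invRad_pos hr x
  have h1 := invRad_sq hr x
  have hx2 : ‖x‖ ^ 2 ≤ r ^ 2 := pow_le_pow_left₀ (norm_nonneg x) hx 2
  have h2 : 1 / 2 ≤ (r * invRad r x) ^ 2 := by
    nlinarith [mul_le_mul_of_nonneg_left hx2 (sq_nonneg (invRad r x))]
  have h4 : 0 < r * invRad r x := mul_pos hr h0
  have h5 := mul_invRad_le_one hr x
  have h3 : radPrim r x = ((r * invRad r x) ^ 3 + 3 * (r * invRad r x) ^ 5) * (r⁻¹) ^ 2 := by
    rw [radPrim]
    field_simp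
  rw [h3]
  refine mul_le_mul_of_nonneg_right ?_ (sq_nonneg _)
  have h6 : (1 : ℝ) / 4 ≤ (r * invRad r x) ^ 3 := by
    nlinarith [mul_le_mul_of_nonneg_left h2 h4.le]
  have : 0 ≤ (r * invRad r x) ^ 5 := by positivity
  linarith

end Weights

theorem interaction_add_weight {h h' f g : Plane → ℝ} (hh : IsBddCont h) (hh' : IsBddCont h')
    (hf : Integrable f) (hg : Integrable g) :
    interaction (fun z => h z + h' z) f g = interaction h f g + interaction h' f g := by
  unfold interaction
  rw [← integral_add (hh.integrable_interaction hf hg) (hh'.integrable_interaction hf hg)]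
  exact integral_congr_ae (.of_forall fun p => by ring)

theorem invRad_neg (r : ℝ) (x : Plane) : invRad r (-x) = invRad r x := by
  rw [invRad, invRad, norm_neg]

theorem radDir_neg (r : ℝ) (j : Fin 2) (x : Plane) : radDir r j (-x) = -radDir r j x := by
  rw [radDir, radDir, invRad_neg, PiLp.neg_apply, neg_mul]

theorem radHess_neg (r : ℝ) (j k : Fin 2) (x : Plane) : radHess r j k (-x) = radHess r j k x := by
  rw [radHess, radHess, radDir_neg, radDir_neg, invRad_neg, neg_mul_neg]

theorem radHess_comm (r : ℝ) (j k : Fin 2) : radHess r j k = radHess r k j := by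
  ext x
  simp only [radHess, eq_comm (a := j), mul_comm (radDir r j x)]

theorem radHess_quadratic_nonneg {r : ℝ} (hr : 0 < r) (z : Plane) (w : Fin 2 → ℝ) :
    0 ≤ ∑ j, ∑ k, radHess r j k z * (w j * w k) := by
  have h := radDir_sq_add hr z
  have hp := invRad_pos hr z
  have key : ∑ j, ∑ k, radHess r j k z * (w j * w k) = invRad r z *
      ((1 - radDir r 0 z ^ 2 - radDir r 1 z ^ 2) * (w 0 ^ 2 + w 1 ^ 2) +
        (radDir r 1 z * w 0 - radDir r 0 z * w 1) ^ 2) := by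
    simp only [Fin.sum_univ_two, radHess, if_true, Fin.zero_eq_one_iff, Fin.one_eq_zero_iff,
      OfNat.ofNat_ne_one, if_false]
    ring
  rw [key]
  have : 0 ≤ 1 - radDir r 0 z ^ 2 - radDir r 1 z ^ 2 := by
    nlinarith [sq_nonneg (r * invRad r z)]
  positivity

theorem radHess_tensor_nonneg {r : ℝ} (hr : 0 < r) (z : Plane) (α β : ℂ) (a c : Fin 2 → ℂ) :
    0 ≤ ∑ j, ∑ k, radHess r j k z * ((a j * (starRingEnd ℂ) (a k)).re * ‖β‖ ^ 2 +
      ‖α‖ ^ 2 * (c j * (starRingEnd ℂ) (c k)).re -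
      2 * (((starRingEnd ℂ) α * a j).im * ((starRingEnd ℂ) β * c k).im)) := by
  have h1 := radHess_quadratic_nonneg hr z
    fun j => ((starRingEnd ℂ) β * a j + α * (starRingEnd ℂ) (c j)).re
  have h2 := radHess_quadratic_nonneg hr z
    fun j => ((starRingEnd ℂ) β * a j + α * (starRingEnd ℂ) (c j)).im
  have h3 := radHess_quadratic_nonneg hr z fun j => (β * a j - α * c j).re
  have h4 := radHess_quadratic_nonneg hr z fun j => (β * a j - α * c j).im
  have hn : ∀ w : ℂ, ‖w‖ ^ 2 = w.re * w.re + w.im * w.im := fun w => by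
    rw [← Complex.normSq_eq_norm_sq, Complex.normSq_apply]
  have hc := congrFun (radHess_comm r 1 0) z
  refine le_of_le_of_eq (mul_nonneg (by norm_num : (0 : ℝ) ≤ 1 / 2)
    (add_nonneg (add_nonneg h1 h2) (add_nonneg h3 h4))) ?_
  simp only [Fin.sum_univ_two, hn, hc, Complex.add_re, Complex.add_im, Complex.mul_re,
    Complex.mul_im, Complex.sub_re, Complex.sub_im, Complex.conj_re, Complex.conj_im]
  ring

/-- The time derivative of the interaction Morawetz action when `∂ₜ v = w`. -/
def morRate (r : ℝ) (v w : Plane → ℂ) : ℝ :=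
  ∑ j, (interaction (radDir r j) (momRate v w j) (massDensity v) +
    interaction (radDir r j) (momDensity v j) (massRate v w))

/-- The contribution of the forcing `W` to the interaction Morawetz identity, with the gradient of
the weight replaced by `h`. -/
def morErr (h : Fin 2 → Plane → ℝ) (v W : Plane → ℂ) : ℝ :=
  ∑ j, (interaction (h j) (momForce v W j) (massDensity v) +
    interaction (h j) (momDensity v j) (massForce v W))

theorem massDensity_nonneg (v : Plane → ℂ) (x : Plane) : 0 ≤ massDensity v x := sq_nonneg _

theorem interaction_nonneg {h f g : Plane → ℝ} (hh : ∀ z, 0 ≤ h z) (hf : ∀ z, 0 ≤ f z)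
    (hg : ∀ z, 0 ≤ g z) : 0 ≤ interaction h f g :=
  integral_nonneg fun _ => mul_nonneg (hh _) (mul_nonneg (hf _) (hg _))

theorem IsSchwartz.interaction_radHess_nonneg {v : Plane → ℂ} (hv : IsSchwartz v) {r : ℝ}
    (hr : 0 < r) : 0 ≤ ∑ j, ∑ k, (interaction (radHess r j k) (_root_.stress v j k)
      (_root_.massDensity v) -
      interaction (radHess r j k) (_root_.momDensity v j) (_root_.momDensity v k)) := by
  have hswap : ∀ j k, interaction (radHess r j k) (_root_.stress v j k) (_root_.massDensity v) =
      interaction (radHess r j k) (_root_.massDensity v) (_root_.stress v j k) := fun j k => by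
    rw [interaction_swap]
    simp only [radHess_neg]
  have i1 : ∀ j k, Integrable fun p : Plane × Plane => radHess r j k (p.1 - p.2) *
      (_root_.stress v j k p.1 * _root_.massDensity v p.2) := fun j k =>
    (isBddCont_radHess hr j k).integrable_interaction (hv.stress j k).integrable
      hv.massDensity.integrable
  have i2 : ∀ j k, Integrable fun p : Plane × Plane => radHess r j k (p.1 - p.2) *
      (_root_.massDensity v p.1 * _root_.stress v j k p.2) := fun j k =>
    (isBddCont_radHess hr j k).integrable_interaction hv.massDensity.integrable
      (hv.stress j k).integrable
  have i3 : ∀ j k, Integrable fun p : Plane × Plane => radHess r j k (p.1 - p.2) *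
      (_root_.momDensity v j p.1 * _root_.momDensity v k p.2) := fun j k =>
    (isBddCont_radHess hr j k).integrable_interaction (hv.momDensity j).integrable
      (hv.momDensity k).integrable
  have key : 2 * ∑ j, ∑ k, (interaction (radHess r j k) (_root_.stress v j k)
      (_root_.massDensity v) -
      interaction (radHess r j k) (_root_.momDensity v j) (_root_.momDensity v k)) =
      ∫ p : Plane × Plane, ∑ j, ∑ k, radHess r j k (p.1 - p.2) *
        (_root_.stress v j k p.1 * _root_.massDensity v p.2 +
          _root_.massDensity v p.1 * _root_.stress v j k p.2 -
          2 * (_root_.momDensity v j p.1 * _root_.momDensity v k p.2)) := by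
    have e : ∀ j k, ∀ p : Plane × Plane, radHess r j k (p.1 - p.2) *
        (_root_.stress v j k p.1 * _root_.massDensity v p.2 +
          _root_.massDensity v p.1 * _root_.stress v j k p.2 -
          2 * (_root_.momDensity v j p.1 * _root_.momDensity v k p.2)) =
        radHess r j k (p.1 - p.2) * (_root_.stress v j k p.1 * _root_.massDensity v p.2) +
        radHess r j k (p.1 - p.2) * (_root_.massDensity v p.1 * _root_.stress v j k p.2) -
        2 * (radHess r j k (p.1 - p.2) *
          (_root_.momDensity v j p.1 * _root_.momDensity v k p.2)) := fun j k p => by ring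
    have i4 : ∀ j k, Integrable fun p : Plane × Plane => radHess r j k (p.1 - p.2) *
        (_root_.stress v j k p.1 * _root_.massDensity v p.2) +
        radHess r j k (p.1 - p.2) * (_root_.massDensity v p.1 * _root_.stress v j k p.2) -
        2 * (radHess r j k (p.1 - p.2) *
          (_root_.momDensity v j p.1 * _root_.momDensity v k p.2)) := fun j k =>
      ((i1 j k).add (i2 j k)).sub ((i3 j k).const_mul 2)
    simp only [e]
    rw [integral_finsetSum _ fun j _ => integrable_finsetSum _ fun k _ => i4 j k,
      Finset.mul_sum]
    refine Finset.sum_congr rfl fun j _ => ?_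
    rw [integral_finsetSum _ fun k _ => i4 j k, Finset.mul_sum]
    refine Finset.sum_congr rfl fun k _ => ?_
    have e1 := integral_sub ((i1 j k).add (i2 j k)) ((i3 j k).const_mul 2)
    have e2 := integral_add (i1 j k) (i2 j k)
    have e3 := hswap j k
    simp only [Pi.add_apply, integral_const_mul] at e1
    rw [e1, e2]
    simp only [interaction] at e3 ⊢
    linarith
  have : 0 ≤ ∫ p : Plane × Plane, ∑ j, ∑ k, radHess r j k (p.1 - p.2) *
        (_root_.stress v j k p.1 * _root_.massDensity v p.2 +
          _root_.massDensity v p.1 * _root_.stress v j k p.2 -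
          2 * (_root_.momDensity v j p.1 * _root_.momDensity v k p.2)) :=
    integral_nonneg fun p => radHess_tensor_nonneg hr (p.1 - p.2) (v p.1) (v p.2)
      (fun j => _root_.pd j v p.1) (fun j => _root_.pd j v p.2)
  linarith

theorem IsSchwartz.le_morRate {v G : Plane → ℂ} (hv : IsSchwartz v) (hG : IsSchwartz G) {r : ℝ}
    (hr : 0 < r) :
    1 / 2 * interaction (radKernel r) (_root_.massDensity v) (_root_.massDensity v) +
        morErr (radDir r) v (fun x => G x - _root_.cub v x) ≤
      morRate r v (fun x => Complex.I * _root_.lap v x + -Complex.I * G x) := by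
  have hW : IsSchwartz fun x => G x - _root_.cub v x := hG.sub hv.cub
  obtain ⟨ρ, hρ⟩ : ∃ ρ, ρ = _root_.massDensity v := ⟨_, rfl⟩
  have hρS : IsSchwartzR ρ := hρ ▸ hv.massDensity
  have hρi := hρS.integrable
  have hb := fun j k => isBddCont_radHess hr j k
  have hpd : ∀ j k, IsBddCont (_root_.pd k (radDir r j)) := fun j k => by
    rw [pd_radDir hr]; exact hb j k
  have hB := fun j => isBddCont_radDir hr j
  have hBd := fun j => differentiable_radDir hr j
  have hmom : ∀ j, interaction (radDir r j)
      (momRate v (fun x => Complex.I * _root_.lap v x + -Complex.I * G x) j) ρ =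
      2 * ∑ k, interaction (radHess r j k) (_root_.stress v j k) ρ +
        -(1 / 2) * interaction (radHess r j j) (_root_.lap ρ) ρ +
        1 / 2 * interaction (radHess r j j) (fun x => ρ x * ρ x) ρ +
        interaction (radDir r j) (_root_.momForce v (fun x => G x - _root_.cub v x) j) ρ := by
    intro j
    have hσ := fun k => (hv.stress j k).pd k
    have s1 := (IsSchwartzR.sum Finset.univ fun k _ => hσ k).const_mul (-2)
    have s2 := (hρS.lap.pd j).const_mul (1 / 2)
    have s3 := ((hρS.mul hρS).pd j).const_mul (-(1 / 2))
    have s4 := hv.momForce hW j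
    rw [show momRate v (fun x => Complex.I * _root_.lap v x + -Complex.I * G x) j = _ from
      funext (hv.momRate_eq hG j), ← hρ,
      interaction_add_left (hB j) ((s1.add s2).add s3).integrable s4.integrable hρi,
      interaction_add_left (hB j) (s1.add s2).integrable s3.integrable hρi,
      interaction_add_left (hB j) s1.integrable s2.integrable hρi,
      interaction_const_mul_left, interaction_const_mul_left, interaction_const_mul_left,
      interaction_sum_left _ (hB j) (fun k _ => (hσ k).integrable) hρi,
      interaction_pd_left (hBd j) (hB j) j (hpd j j) hρS.lap hρi,
      interaction_pd_left (hBd j) (hB j) j (hpd j j) (hρS.mul hρS) hρi]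
    simp only [interaction_pd_left (hBd j) (hB j) _ (hpd j _) (hv.stress j _) hρi, pd_radDir hr,
      Finset.sum_neg_distrib]
    ring
  have hmass : ∀ j, interaction (radDir r j) (_root_.momDensity v j)
      (massRate v (fun x => Complex.I * _root_.lap v x + -Complex.I * G x)) =
      -2 * ∑ k, interaction (radHess r j k) (_root_.momDensity v j) (_root_.momDensity v k) +
        interaction (radDir r j) (_root_.momDensity v j)
          (_root_.massForce v (fun x => G x - _root_.cub v x)) := by
    intro j
    have hP := fun k => (hv.momDensity k).pd k
    have hPj := (hv.momDensity j).integrable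
    have s1 := (IsSchwartzR.sum Finset.univ fun k _ => hP k).const_mul (-2)
    have s4 := hv.massForce hW
    rw [show massRate v (fun x => Complex.I * _root_.lap v x + -Complex.I * G x) = _ from
      funext (hv.massRate_eq G), interaction_add_right (hB j) hPj s1.integrable s4.integrable,
      interaction_const_mul_right,
      interaction_sum_right _ (hB j) hPj (fun k _ => (hP k).integrable)]
    simp only [interaction_pd_right (hBd j) (hB j) _ (hpd j _) hPj (hv.momDensity _), pd_radDir hr]
  have hL : ∀ f, Integrable f → interaction (radHess r 0 0) f ρ + interaction (radHess r 1 1) f ρ =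
      interaction (radLap r) f ρ := fun f hf => by
    rw [← interaction_add_weight (hb 0 0) (hb 1 1) hf hρi]
    exact congrArg (fun h => interaction h f ρ) (funext (sum_radHess hr))
  have hLd := differentiable_radLap hr
  have hLb := isBddCont_radLap hr
  have hLL : ∀ k, interaction (radLap r) (_root_.pd k (_root_.pd k ρ)) ρ =
      interaction (_root_.pd k (_root_.pd k (radLap r))) ρ ρ := fun k => by
    rw [interaction_pd_left hLd hLb k (isBddCont_pd_radLap hr k) (hρS.pd k) hρi,
      interaction_pd_left (differentiable_pd_radLap hr k) (isBddCont_pd_radLap hr k) k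
        (isBddCont_pd_pd_radLap hr k) hρS hρi, neg_neg]
  have hlap : interaction (radLap r) (_root_.lap ρ) ρ = -interaction (radKernel r) ρ ρ := by
    have := interaction_sum_left Finset.univ hLb
      (fun k _ => ((hρS.pd k).pd k).integrable) hρi
    rw [show _root_.lap ρ = fun x => ∑ k, _root_.pd k (_root_.pd k ρ) x from rfl, this,
      Fin.sum_univ_two, hLL, hLL, ← interaction_add_weight (isBddCont_pd_pd_radLap hr 0)
        (isBddCont_pd_pd_radLap hr 1) hρi hρi, ← interaction_neg]
    exact congrArg (fun h => interaction h ρ ρ) (funext (lap_radLap hr))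
  have hpos := hv.interaction_radHess_nonneg hr
  rw [← hρ] at hpos ⊢
  have hρ3 : 0 ≤ interaction (radLap r) (fun x => ρ x * ρ x) ρ :=
    interaction_nonneg (radLap_nonneg hr) (fun z => mul_self_nonneg _)
      (fun z => hρ ▸ massDensity_nonneg v z)
  have h1 := hL _ hρS.lap.integrable
  have h2 := hL _ (hρS.mul hρS).integrable
  rw [hlap] at h1
  simp only [morRate, morErr, ← hρ, hmom, hmass, Fin.sum_univ_two] at hpos ⊢
  linarith

/-- A time-dependent real density which is jointly continuous and bounded in `L¹`, uniformly for
times in `S`. -/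
structure RegularDensity (S : Set ℝ) (f : ℝ → Plane → ℝ) : Prop where
  continuousOn : ContinuousOn (Function.uncurry f) (S ×ˢ Set.univ)
  integrable : ∀ t ∈ S, Integrable (f t)
  integral_norm_le : ∃ K, 0 ≤ K ∧ ∀ t ∈ S, ∫ x, ‖f t x‖ ≤ K

section RegularDensity

variable {S : Set ℝ} {k : ℕ} {F G : ℝ → Plane → ℂ} {f g : ℝ → Plane → ℝ}

theorem TimeRegular.regularDensity_re (hk : 2 ≤ k) (hF : TimeRegular S k F)
    (hG : TimeRegular S k G) : RegularDensity S fun t x => (F t x * G t x).re := by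
  obtain ⟨K, hK0, hK⟩ := hF.decay.exists_integral_norm_mul_le (one_le_two.trans hk) hG.decay
  have hi := fun t (ht : t ∈ S) => ((hF.isSchwartz ht).mul (hG.isSchwartz ht)).integrable
  exact ⟨Complex.continuous_re.comp_continuousOn
    ((hF.continuousOn_uncurry hk).mul (hG.continuousOn_uncurry hk)), fun t ht => (hi t ht).re,
    K, hK0, fun t ht => (integral_mono (hi t ht).re.norm (hi t ht).norm fun x =>
      Complex.abs_re_le_norm _).trans (hK t ht)⟩

theorem TimeRegular.regularDensity_im (hk : 2 ≤ k) (hF : TimeRegular S k F)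
    (hG : TimeRegular S k G) : RegularDensity S fun t x => (F t x * G t x).im := by
  obtain ⟨K, hK0, hK⟩ := hF.decay.exists_integral_norm_mul_le (one_le_two.trans hk) hG.decay
  have hi := fun t (ht : t ∈ S) => ((hF.isSchwartz ht).mul (hG.isSchwartz ht)).integrable
  exact ⟨Complex.continuous_im.comp_continuousOn
    ((hF.continuousOn_uncurry hk).mul (hG.continuousOn_uncurry hk)), fun t ht => (hi t ht).im,
    K, hK0, fun t ht => (integral_mono (hi t ht).im.norm (hi t ht).norm fun x =>
      Complex.abs_im_le_norm _).trans (hK t ht)⟩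

theorem RegularDensity.add (hf : RegularDensity S f) (hg : RegularDensity S g) :
    RegularDensity S fun t x => f t x + g t x := by
  obtain ⟨hf, hfi, K, hK0, hK⟩ := hf
  obtain ⟨hg, hgi, L, hL0, hL⟩ := hg
  refine ⟨hf.add hg, fun t ht => (hfi t ht).add (hgi t ht), K + L, add_nonneg hK0 hL0,
    fun t ht => ?_⟩
  refine (integral_mono ((hfi t ht).add (hgi t ht)).norm ((hfi t ht).norm.add (hgi t ht).norm)
    fun x => norm_add_le _ _).trans ?_
  rw [integral_add' (hfi t ht).norm (hgi t ht).norm]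
  exact add_le_add (hK t ht) (hL t ht)

theorem RegularDensity.const_mul (c : ℝ) (hf : RegularDensity S f) :
    RegularDensity S fun t x => c * f t x := by
  obtain ⟨hf, hfi, K, hK0, hK⟩ := hf
  refine ⟨continuousOn_const.mul hf, fun t ht => (hfi t ht).const_mul c, ‖c‖ * K,
    mul_nonneg (norm_nonneg c) hK0, fun t ht => ?_⟩
  simp only [norm_mul, integral_const_mul]
  exact mul_le_mul_of_nonneg_left (hK t ht) (norm_nonneg c)

end RegularDensity

/-- Lebesgue measure on `(0, T] × ℝ² × ℝ²`. -/
def slabMeasure (T : ℝ) : Measure (ℝ × Plane × Plane) :=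
  (volume.restrict (Set.Ioc 0 T)).prod volume

/-- The space-time interaction `∫₀ᵀ ∬ h(x - y) f(t, x) g(t, y) dx dy dt`. -/
def slabInteraction (T : ℝ) (h : Plane → ℝ) (f g : ℝ → Plane → ℝ) : ℝ :=
  ∫ q, h (q.2.1 - q.2.2) * (f q.1 q.2.1 * g q.1 q.2.2) ∂slabMeasure T

section Slab

variable {T : ℝ} {f g : ℝ → Plane → ℝ} {h : Plane → ℝ}

theorem RegularDensity.continuousOn_tensor (hf : RegularDensity (Set.Icc 0 T) f)
    (hg : RegularDensity (Set.Icc 0 T) g) :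
    ContinuousOn (fun q : ℝ × Plane × Plane => f q.1 q.2.1 * g q.1 q.2.2)
      (Set.Icc 0 T ×ˢ Set.univ) := by
  have h1 : ContinuousOn (fun q : ℝ × Plane × Plane => Function.uncurry f (q.1, q.2.1))
      (Set.Icc 0 T ×ˢ Set.univ) :=
    hf.continuousOn.comp (by fun_prop) fun q hq => ⟨hq.1, trivial⟩
  have h2 : ContinuousOn (fun q : ℝ × Plane × Plane => Function.uncurry g (q.1, q.2.2))
      (Set.Icc 0 T ×ˢ Set.univ) :=
    hg.continuousOn.comp (by fun_prop) fun q hq => ⟨hq.1, trivial⟩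
  exact h1.mul h2

theorem RegularDensity.continuousOn_apply (hf : RegularDensity (Set.Icc 0 T) f) (x : Plane) :
    ContinuousOn (fun t => f t x) (Set.Icc 0 T) :=
  hf.continuousOn.comp (f := fun t : ℝ => (t, x)) (by fun_prop) fun _ ht => ⟨ht, trivial⟩

theorem RegularDensity.aestronglyMeasurable_tensor (hf : RegularDensity (Set.Icc 0 T) f)
    (hg : RegularDensity (Set.Icc 0 T) g) :
    AEStronglyMeasurable (fun q : ℝ × Plane × Plane => f q.1 q.2.1 * g q.1 q.2.2)
      (slabMeasure T) := by
  have h := ((hf.continuousOn_tensor hg).mono (Set.prod_mono_left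
    Set.Ioc_subset_Icc_self)).aestronglyMeasurable (μ := volume.prod volume)
    (measurableSet_Ioc.prod MeasurableSet.univ)
  rwa [← Measure.prod_restrict, Measure.restrict_univ] at h

theorem RegularDensity.exists_integral_norm_tensor_le (hf : RegularDensity (Set.Icc 0 T) f)
    (hg : RegularDensity (Set.Icc 0 T) g) : ∃ K, 0 ≤ K ∧ ∀ t ∈ Set.Icc 0 T,
      ∫ p : Plane × Plane, ‖f t p.1 * g t p.2‖ ≤ K := by
  obtain ⟨K, hK0, hK⟩ := hf.integral_norm_le
  obtain ⟨L, hL0, hL⟩ := hg.integral_norm_le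
  refine ⟨K * L, mul_nonneg hK0 hL0, fun t ht => ?_⟩
  simp only [norm_mul]
  rw [Measure.volume_eq_prod, integral_prod_mul (fun x => ‖f t x‖) fun x => ‖g t x‖]
  exact mul_le_mul (hK t ht) (hL t ht) (integral_nonneg fun _ => norm_nonneg _) hK0

theorem RegularDensity.integrable_tensor (hf : RegularDensity (Set.Icc 0 T) f)
    (hg : RegularDensity (Set.Icc 0 T) g) :
    Integrable (fun q : ℝ × Plane × Plane => f q.1 q.2.1 * g q.1 q.2.2) (slabMeasure T) := by
  have hm := hf.aestronglyMeasurable_tensor hg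
  obtain ⟨K, -, hK⟩ := hf.exists_integral_norm_tensor_le hg
  rw [slabMeasure] at hm ⊢
  rw [integrable_prod_iff hm]
  refine ⟨(ae_restrict_mem measurableSet_Ioc).mono fun t ht => ?_, ?_⟩
  · exact (hf.integrable t (Set.Ioc_subset_Icc_self ht)).mul_prod
      (hg.integrable t (Set.Ioc_subset_Icc_self ht))
  · refine (integrable_const K).mono' hm.norm.integral_prod_right' ?_
    refine (ae_restrict_mem measurableSet_Ioc).mono fun t ht => ?_
    rw [Real.norm_of_nonneg (integral_nonneg fun _ => norm_nonneg _)]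
    exact hK t (Set.Ioc_subset_Icc_self ht)

theorem RegularDensity.integrable_slab (hh : IsBddCont h) (hf : RegularDensity (Set.Icc 0 T) f)
    (hg : RegularDensity (Set.Icc 0 T) g) :
    Integrable (fun q => h (q.2.1 - q.2.2) * (f q.1 q.2.1 * g q.1 q.2.2)) (slabMeasure T) := by
  obtain ⟨hc, C, hC⟩ := hh
  refine (hf.integrable_tensor hg).bdd_mul (c := C) ?_ (.of_forall fun q => hC _)
  exact (hc.comp (by fun_prop)).aestronglyMeasurable

theorem RegularDensity.slabInteraction_eq (hh : IsBddCont h)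
    (hf : RegularDensity (Set.Icc 0 T) f) (hg : RegularDensity (Set.Icc 0 T) g) :
    slabInteraction T h f g = ∫ t in Set.Ioc 0 T, interaction h (f t) (g t) :=
  integral_prod _ (hf.integrable_slab hh hg)

theorem RegularDensity.integrable_interaction (hh : IsBddCont h)
    (hf : RegularDensity (Set.Icc 0 T) f) (hg : RegularDensity (Set.Icc 0 T) g) :
    Integrable (fun t => interaction h (f t) (g t)) (volume.restrict (Set.Ioc 0 T)) :=
  (hf.integrable_slab hh hg).integral_prod_left

theorem RegularDensity.interaction_sub_eq (hT : 0 ≤ T) (hh : IsBddCont h) {f' g' : ℝ → Plane → ℝ}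
    (hf : RegularDensity (Set.Icc 0 T) f) (hg : RegularDensity (Set.Icc 0 T) g)
    (hf' : RegularDensity (Set.Icc 0 T) f') (hg' : RegularDensity (Set.Icc 0 T) g')
    (hdf : ∀ t ∈ Set.Ioo 0 T, ∀ x, HasDerivAt (fun t => f t x) (f' t x) t)
    (hdg : ∀ t ∈ Set.Ioo 0 T, ∀ x, HasDerivAt (fun t => g t x) (g' t x) t) :
    interaction h (f T) (g T) - interaction h (f 0) (g 0) =
      slabInteraction T h f' g + slabInteraction T h f g' := by
  have h1 := hf'.integrable_slab hh hg
  have h2 := hf.integrable_slab hh hg'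
  obtain ⟨C, hC⟩ := hh.2
  obtain ⟨K, hK0, hK⟩ := hf'.exists_integral_norm_tensor_le hg
  obtain ⟨L, hL0, hL⟩ := hf.exists_integral_norm_tensor_le hg'
  have i1 := fun t (ht : t ∈ Set.Icc 0 T) => (hf'.integrable t ht).mul_prod (hg.integrable t ht)
  have i2 := fun t (ht : t ∈ Set.Icc 0 T) => (hf.integrable t ht).mul_prod (hg'.integrable t ht)
  have key := integral_sub_eq_integral_deriv (μ := (volume : Measure (Plane × Plane)))
    (F := fun t p => h (p.1 - p.2) * (f t p.1 * g t p.2))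
    (F' := fun t p => h (p.1 - p.2) * (f' t p.1 * g t p.2 + f t p.1 * g' t p.2))
    (K := |C| * (K + L)) hT
    (fun p t ht => ((hdf t ht p.1).mul (hdg t ht p.2)).const_mul _)
    (fun p => continuousOn_const.mul ((hf.continuousOn_apply _).mul (hg.continuousOn_apply _)))
    (fun p => continuousOn_const.mul (((hf'.continuousOn_apply _).mul (hg.continuousOn_apply _)).add
      ((hf.continuousOn_apply _).mul (hg'.continuousOn_apply _))))
    ((h1.add h2).aestronglyMeasurable.congr (.of_forall fun q => (mul_add _ _ _).symm))
    (fun t ht => hh.integrable_mul ((i1 t (Set.Ioc_subset_Icc_self ht)).add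
      (i2 t (Set.Ioc_subset_Icc_self ht))))
    (fun t ht => ?_)
    (hh.integrable_interaction (hf.integrable 0 ⟨le_rfl, hT⟩) (hg.integrable 0 ⟨le_rfl, hT⟩))
    (hh.integrable_interaction (hf.integrable T ⟨hT, le_rfl⟩) (hg.integrable T ⟨hT, le_rfl⟩))
  · rw [interaction, interaction, key, hf'.slabInteraction_eq hh hg, hf.slabInteraction_eq hh hg',
      ← integral_add (hf'.integrable_interaction hh hg) (hf.integrable_interaction hh hg')]
    refine setIntegral_congr_fun measurableSet_Ioc fun t ht => ?_
    have ht' := Set.Ioc_subset_Icc_self ht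
    simp only [interaction]
    rw [← integral_add (hh.integrable_mul (i1 t ht')) (hh.integrable_mul (i2 t ht'))]
    exact integral_congr_ae (.of_forall fun p => mul_add _ _ _)
  · have ht' := Set.Ioc_subset_Icc_self ht
    calc ∫ p : Plane × Plane, ‖h (p.1 - p.2) * (f' t p.1 * g t p.2 + f t p.1 * g' t p.2)‖
        ≤ ∫ p : Plane × Plane, |C| * (‖f' t p.1 * g t p.2‖ + ‖f t p.1 * g' t p.2‖) := by
          refine integral_mono (hh.integrable_mul ((i1 t ht').add (i2 t ht'))).norm
            (((i1 t ht').norm.add (i2 t ht').norm).const_mul _) fun p => ?_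
          rw [norm_mul]
          exact mul_le_mul ((hC _).trans (le_abs_self C)) (norm_add_le _ _) (norm_nonneg _)
            (abs_nonneg C)
      _ ≤ |C| * (K + L) := by
          rw [integral_const_mul, Measure.volume_eq_prod,
            integral_add (i1 t ht').norm (i2 t ht').norm]
          exact mul_le_mul_of_nonneg_left (add_le_add (hK t ht') (hL t ht')) (abs_nonneg C)

end Slab

theorem hasDerivAt_massDensity {v : ℝ → Plane → ℂ} {w : ℂ} {t : ℝ} {x : Plane}
    (h : HasDerivAt (fun t => v t x) w t) :
    HasDerivAt (fun t => massDensity (v t) x) (2 * ((starRingEnd ℂ) (v t x) * w).re) t := by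
  simp only [massDensity_eq]
  have h1 : HasDerivAt (fun t => (starRingEnd ℂ) (v t x)) ((starRingEnd ℂ) w) t :=
    Complex.conjCLE.toContinuousLinearMap.hasFDerivAt.comp_hasDerivAt t h
  refine (Complex.reCLM.hasFDerivAt.comp_hasDerivAt t (h1.mul h)).congr_deriv ?_
  simp only [Complex.reCLM_apply, Complex.add_re, Complex.mul_re, Complex.conj_re, Complex.conj_im]
  ring

theorem hasDerivAt_momDensity {v : ℝ → Plane → ℂ} {w w' : ℂ} {t : ℝ} {x : Plane} {j : Fin 2}
    (h : HasDerivAt (fun t => v t x) w t) (h' : HasDerivAt (fun t => pd j (v t) x) w' t) :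
    HasDerivAt (fun t => momDensity (v t) j x)
      ((starRingEnd ℂ) w * pd j (v t) x + (starRingEnd ℂ) (v t x) * w').im t := by
  simp only [momDensity]
  have h1 : HasDerivAt (fun t => (starRingEnd ℂ) (v t x)) ((starRingEnd ℂ) w) t :=
    Complex.conjCLE.toContinuousLinearMap.hasFDerivAt.comp_hasDerivAt t h
  exact Complex.imCLM.hasFDerivAt.comp_hasDerivAt t (h1.mul h')

section Regularity

variable {S : Set ℝ} {k : ℕ} {v w : ℝ → Plane → ℂ}

theorem TimeRegular.massDensity (hv : TimeRegular S 2 v) :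
    RegularDensity S fun t => massDensity (v t) := by
  simp only [massDensity_eq]
  exact hv.conj.regularDensity_re le_rfl hv

theorem TimeRegular.momDensity (hv : TimeRegular S 3 v) (j : Fin 2) :
    RegularDensity S fun t => momDensity (v t) j :=
  (hv.mono (by norm_num)).conj.regularDensity_im le_rfl (TimeRegular.pd hv j)

theorem TimeRegular.massRate (hv : TimeRegular S 2 v) (hw : TimeRegular S 2 w) :
    RegularDensity S fun t => massRate (v t) (w t) :=
  (hv.conj.regularDensity_re le_rfl hw).const_mul 2

theorem TimeRegular.massForce (hv : TimeRegular S 2 v) (hw : TimeRegular S 2 w) :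
    RegularDensity S fun t => massForce (v t) (w t) :=
  (hv.conj.regularDensity_im le_rfl hw).const_mul 2

theorem TimeRegular.momRate (hv : TimeRegular S 3 v) (hw : TimeRegular S 3 w) (j : Fin 2) :
    RegularDensity S fun t => momRate (v t) (w t) j := by
  have h := ((hw.mono (by norm_num)).conj.regularDensity_im le_rfl (TimeRegular.pd hv j)).add
    ((hv.mono (by norm_num)).conj.regularDensity_im le_rfl (TimeRegular.pd hw j))
  have e : (fun t x => ((starRingEnd ℂ) (w t x) * _root_.pd j (v t) x).im +
      ((starRingEnd ℂ) (v t x) * _root_.pd j (w t) x).im) =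
      fun t => _root_.momRate (v t) (w t) j := by
    ext t x
    simp only [_root_.momRate, Complex.add_im]
  exact e ▸ h

theorem TimeRegular.momForce (hv : TimeRegular S 3 v) (hw : TimeRegular S 3 w) (j : Fin 2) :
    RegularDensity S fun t => momForce (v t) (w t) j := by
  have h := ((hw.mono (by norm_num)).regularDensity_re le_rfl (TimeRegular.pd hv j).conj).add
    (((hv.mono (by norm_num)).regularDensity_re le_rfl (TimeRegular.pd hw j).conj).const_mul (-1))
  have e : (fun t x => (w t x * (starRingEnd ℂ) (_root_.pd j (v t) x)).re +
      -1 * (v t x * (starRingEnd ℂ) (_root_.pd j (w t) x)).re) =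
      fun t => _root_.momForce (v t) (w t) j := by
    ext t x
    simp only [_root_.momForce, Complex.sub_re]
    ring
  exact e ▸ h

end Regularity

/-- The space-time contribution of the forcing `W` to the interaction Morawetz identity, with the
gradient of the weight replaced by `h`. -/
def slabErr (T : ℝ) (h : Fin 2 → Plane → ℝ) (v W : ℝ → Plane → ℂ) : ℝ :=
  ∑ j, (slabInteraction T (h j) (fun t => momForce (v t) (W t) j) (fun t => massDensity (v t)) +
    slabInteraction T (h j) (fun t => momDensity (v t) j) (fun t => massForce (v t) (W t)))

/-- The interaction Morawetz action. -/
def morAct (r : ℝ) (v : Plane → ℂ) : ℝ :=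
  ∑ j, interaction (radDir r j) (momDensity v j) (massDensity v)

namespace ForcedSchrodinger

variable {T : ℝ} {v G : ℝ → Plane → ℂ}

theorem reg_commutator (h : ForcedSchrodinger T v G) :
    TimeRegular (Set.Icc 0 T) 4 fun t x => G t x - cub (v t) x :=
  h.reg_forcing.sub (h.reg.cub (by norm_num))

theorem integrable_morErr (h : ForcedSchrodinger T v G) {b : Fin 2 → Plane → ℝ}
    (hb : ∀ j, IsBddCont (b j)) :
    Integrable (fun t => morErr b (v t) fun x => G t x - cub (v t) x)
      (volume.restrict (Set.Ioc 0 T)) := by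
  have hv3 := h.reg.mono (by norm_num : 3 ≤ 4)
  have hW := h.reg_commutator.mono (by norm_num : 3 ≤ 4)
  have hρ := (hv3.mono (by norm_num)).massDensity
  have hm := (hv3.mono (by norm_num)).massForce (hW.mono (by norm_num))
  exact integrable_finsetSum _ fun j _ =>
    ((hv3.momForce hW j).integrable_interaction (hb j) hρ).add
      ((hv3.momDensity j).integrable_interaction (hb j) hm)

theorem slabErr_eq (h : ForcedSchrodinger T v G) {b : Fin 2 → Plane → ℝ}
    (hb : ∀ j, IsBddCont (b j)) :
    slabErr T b v (fun t x => G t x - cub (v t) x) =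
      ∫ t in Set.Ioc 0 T, morErr b (v t) fun x => G t x - cub (v t) x := by
  have hv3 := h.reg.mono (by norm_num : 3 ≤ 4)
  have hW := h.reg_commutator.mono (by norm_num : 3 ≤ 4)
  have hρ := (hv3.mono (by norm_num)).massDensity
  have hm := (hv3.mono (by norm_num)).massForce (hW.mono (by norm_num))
  have i1 := fun j => (hv3.momForce hW j).integrable_interaction (hb j) hρ
  have i2 := fun j => (hv3.momDensity j).integrable_interaction (hb j) hm
  refine ((integral_finsetSum _ fun j _ => (i1 j).add (i2 j)).trans
    (Finset.sum_congr rfl fun j _ => ?_)).symm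
  rw [(hv3.momForce hW j).slabInteraction_eq (hb j) hρ,
    (hv3.momDensity j).slabInteraction_eq (hb j) hm]
  exact integral_add (i1 j) (i2 j)

theorem slab_le_morAct_sub (h : ForcedSchrodinger T v G) (hT : 0 ≤ T) {r : ℝ} (hr : 0 < r) :
    1 / 2 * slabInteraction T (radKernel r) (fun t => massDensity (v t))
        (fun t => massDensity (v t)) +
      slabErr T (radDir r) v (fun t x => G t x - cub (v t) x) ≤
    morAct r (v T) - morAct r (v 0) := by
  obtain ⟨w, hw⟩ : ∃ w : ℝ → Plane → ℂ,
      w = fun t x => Complex.I * lap (v t) x + -Complex.I * G t x := ⟨_, rfl⟩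
  have hv2 := h.reg.mono (by norm_num : 2 ≤ 4)
  have hv3 := h.reg.mono (by norm_num : 3 ≤ 4)
  have hwr : TimeRegular (Set.Icc 0 T) 3 w := by
    rw [hw]
    exact ((TimeRegular.lap h.reg).const_mul Complex.I).add
      ((h.reg_forcing.mono (by norm_num)).const_mul _)
  have hρ := hv2.massDensity
  have hP := fun j => hv3.momDensity j
  have hρ' := hv2.massRate (hwr.mono (by norm_num))
  have hP' := fun j => hv3.momRate hwr j
  have hB := fun j => isBddCont_radDir hr j
  have hact : morAct r (v T) - morAct r (v 0) = ∑ j, (slabInteraction T (radDir r j)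
      (fun t => momRate (v t) (w t) j) (fun t => massDensity (v t)) +
      slabInteraction T (radDir r j) (fun t => momDensity (v t) j)
        (fun t => massRate (v t) (w t))) := by
    rw [morAct, morAct, ← Finset.sum_sub_distrib]
    refine Finset.sum_congr rfl fun j _ => ?_
    refine (hP j).interaction_sub_eq hT (hB j) hρ (hP' j) hρ' (fun t ht x => ?_) fun t ht x => ?_
    · have := hasDerivAt_momDensity (h.hasDerivAt t ht x) (h.hasDerivAt_pd j t ht x)
      rw [hw]
      exact this
    · have := hasDerivAt_massDensity (h.hasDerivAt t ht x)
      rw [hw]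
      exact this
  have hK := isBddCont_radKernel hr
  have hi1 : ∀ j, Integrable (fun t => interaction (radDir r j) (momRate (v t) (w t) j)
        (massDensity (v t)) + interaction (radDir r j) (momDensity (v t) j)
        (massRate (v t) (w t))) (volume.restrict (Set.Ioc 0 T)) := fun j =>
    ((hP' j).integrable_interaction (hB j) hρ).add ((hP j).integrable_interaction (hB j) hρ')
  have e1 : ∑ j, (slabInteraction T (radDir r j)
      (fun t => momRate (v t) (w t) j) (fun t => massDensity (v t)) +
      slabInteraction T (radDir r j) (fun t => momDensity (v t) j)
        (fun t => massRate (v t) (w t))) = ∫ t in Set.Ioc 0 T, morRate r (v t) (w t) := by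
    simp only [morRate]
    rw [integral_finsetSum _ fun j _ => hi1 j]
    refine Finset.sum_congr rfl fun j _ => ?_
    rw [integral_add ((hP' j).integrable_interaction (hB j) hρ)
      ((hP j).integrable_interaction (hB j) hρ'), (hP' j).slabInteraction_eq (hB j) hρ,
      (hP j).slabInteraction_eq (hB j) hρ']
  have e2 := h.slabErr_eq hB
  have i1 : Integrable (fun t => morRate r (v t) (w t)) (volume.restrict (Set.Ioc 0 T)) :=
    integrable_finsetSum _ fun j _ => hi1 j
  have i2 := h.integrable_morErr hB
  have i3 := hρ.integrable_interaction hK hρ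
  rw [hact, e1, e2, hρ.slabInteraction_eq hK hρ, ← integral_const_mul,
    ← integral_add (i3.const_mul _) i2]
  refine setIntegral_mono_on ((i3.const_mul _).add i2) i1 measurableSet_Ioc fun t ht => ?_
  have ht' := Set.Ioc_subset_Icc_self ht
  rw [hw]
  exact (h.reg.isSchwartz ht').le_morRate (h.reg_forcing.isSchwartz ht') hr

end ForcedSchrodinger

theorem integral_mul_le_sqrt {f g : Plane → ℝ} (hf : Integrable fun x => f x ^ 2)
    (hg : Integrable fun x => g x ^ 2) (hfg : Integrable fun x => f x * g x) :
    ∫ x, f x * g x ≤ √(∫ x, f x ^ 2) * √(∫ x, g x ^ 2) := by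
  have h : ∀ t : ℝ, 0 ≤ (∫ x, f x ^ 2) * (t * t) + (2 * ∫ x, f x * g x) * t + ∫ x, g x ^ 2 := by
    intro t
    have e : (∫ x, f x ^ 2) * (t * t) + (2 * ∫ x, f x * g x) * t + ∫ x, g x ^ 2 =
        ∫ x, (t * f x + g x) ^ 2 := by
      have e1 : ∀ x, (t * f x + g x) ^ 2 =
          t * t * f x ^ 2 + 2 * t * (f x * g x) + g x ^ 2 := fun x => by ring
      have e2 := integral_add ((hf.const_mul (t * t)).add (hfg.const_mul (2 * t))) hg
      have e3 := integral_add (hf.const_mul (t * t)) (hfg.const_mul (2 * t))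
      simp only [Pi.add_apply, integral_const_mul] at e2 e3
      simp only [e1]
      rw [e2, e3]
      ring
    rw [e]
    exact integral_nonneg fun x => sq_nonneg _
  have hd := discrim_le_zero h
  rw [discrim] at hd
  rw [← Real.sqrt_mul (integral_nonneg fun x => sq_nonneg _)]
  refine Real.le_sqrt_of_sq_le ?_
  linarith

theorem IsSchwartz.sum_integral_norm_sq_pd {f : Plane → ℂ} (hf : IsSchwartz f) :
    ∑ j, ∫ x, ‖_root_.pd j f x‖ ^ 2 = (2 * π * HdotNorm 1 f) ^ 2 := by
  have hnn : 0 ≤ ∫ ξ : Plane, ‖ξ‖ ^ ((2 : ℝ) * 1) * ‖𝓕 f ξ‖ ^ 2 :=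
    integral_nonneg fun ξ => mul_nonneg (Real.rpow_nonneg (norm_nonneg _) _) (sq_nonneg _)
  simp only [← (hf.pd _).integral_norm_sq_fourier]
  rw [mul_pow, HdotNorm, ← Real.sqrt_eq_rpow, Real.sq_sqrt hnn, ← integral_const_mul,
    ← integral_finsetSum _ fun j _ => (hf.pd j).fourier.integrable_norm_sq]
  refine integral_congr_ae (.of_forall fun ξ => ?_)
  simp only [Fin.sum_univ_two, hf.fourier_pd, norm_mul, Complex.norm_real, Complex.norm_I,
    Real.norm_eq_abs, mul_pow, sq_abs, Complex.norm_ofNat, mul_one]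
  norm_num only [Real.rpow_ofNat, norm_sq_eq_coord]
  ring

theorem IsSchwartz.integral_norm_sq_pd_le {f : Plane → ℂ} (hf : IsSchwartz f) (j : Fin 2) :
    √(∫ x, ‖_root_.pd j f x‖ ^ 2) ≤ 2 * π * HdotNorm 1 f := by
  refine Real.sqrt_le_iff.2 ⟨?_, ?_⟩
  · have h0 : 0 ≤ HdotNorm 1 f := Real.rpow_nonneg (integral_nonneg fun ξ =>
      mul_nonneg (Real.rpow_nonneg (norm_nonneg _) _) (sq_nonneg _)) _
    have := Real.pi_pos
    positivity
  · rw [← hf.sum_integral_norm_sq_pd]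
    exact Finset.single_le_sum (f := fun j => ∫ x, ‖_root_.pd j f x‖ ^ 2)
      (fun i _ => integral_nonneg fun x => sq_nonneg _) (Finset.mem_univ j)

theorem IsSchwartz.abs_morAct_le {v : Plane → ℂ} (hv : IsSchwartz v) {r : ℝ} (hr : 0 < r) :
    |morAct r v| ≤ 4 * π * (HdotNorm 1 v * L2Norm v ^ 3) := by
  have hL : L2Norm v = √(∫ x, ‖v x‖ ^ 2) := (Real.sqrt_eq_rpow _).symm
  have hnn : 0 ≤ ∫ x, ‖v x‖ ^ 2 := integral_nonneg fun x => sq_nonneg _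
  have hρ : ∫ x, ‖_root_.massDensity v x‖ = L2Norm v ^ 2 := by
    rw [hL, Real.sq_sqrt hnn]
    exact integral_congr_ae (.of_forall fun x => Real.norm_of_nonneg (massDensity_nonneg v x))
  have hL0 : 0 ≤ L2Norm v := hL ▸ Real.sqrt_nonneg _
  have h1 : ∀ j, |interaction (radDir r j) (_root_.momDensity v j) (_root_.massDensity v)| ≤
      2 * π * HdotNorm 1 v * L2Norm v ^ 3 := fun j => by
    have hP : ∫ x, ‖_root_.momDensity v j x‖ ≤ L2Norm v * (2 * π * HdotNorm 1 v) := by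
      have hi : Integrable fun x => ‖v x‖ * ‖_root_.pd j v x‖ :=
        (hv.mul (hv.pd j)).integrable.norm.congr (.of_forall fun x => norm_mul _ _)
      calc ∫ x, ‖_root_.momDensity v j x‖ ≤ ∫ x, ‖v x‖ * ‖_root_.pd j v x‖ := by
            refine integral_mono (hv.momDensity j).integrable.norm hi fun x => ?_
            refine (Complex.abs_im_le_norm _).trans_eq ?_
            rw [norm_mul, Complex.norm_conj]
        _ ≤ _ := (integral_mul_le_sqrt hv.integrable_norm_sq (hv.pd j).integrable_norm_sq hi).trans
            (by rw [← hL]; exact mul_le_mul_of_nonneg_left (hv.integral_norm_sq_pd_le j) hL0)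
    have hPi := (hv.momDensity j).integrable
    have hρi := hv.massDensity.integrable
    calc |interaction (radDir r j) (_root_.momDensity v j) (_root_.massDensity v)|
        ≤ ∫ p : Plane × Plane, ‖_root_.momDensity v j p.1‖ * ‖_root_.massDensity v p.2‖ := by
          rw [← Real.norm_eq_abs, interaction]
          refine norm_integral_le_of_norm_le (hPi.norm.mul_prod hρi.norm) (.of_forall fun p => ?_)
          rw [norm_mul, norm_mul]
          exact mul_le_of_le_one_left (by positivity) (abs_radDir_le_one hr j _)
      _ = (∫ x, ‖_root_.momDensity v j x‖) * L2Norm v ^ 2 := by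
          rw [Measure.volume_eq_prod, integral_prod_mul (fun x => ‖_root_.momDensity v j x‖)
            fun x => ‖_root_.massDensity v x‖, hρ]
      _ ≤ L2Norm v * (2 * π * HdotNorm 1 v) * L2Norm v ^ 2 :=
          mul_le_mul_of_nonneg_right hP (sq_nonneg _)
      _ = _ := by ring
  rw [morAct, Fin.sum_univ_two]
  refine (abs_add_le _ _).trans ((add_le_add (h1 0) (h1 1)).trans_eq ?_)
  ring

theorem hasDerivAt_radPrim {r : ℝ} (hr : 0 < r) (x : Plane) :
    HasDerivAt (fun r => radPrim r x) (-radKernel r x) r := by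
  have hg : HasDerivAt (fun r => invRad r x) (-(r * invRad r x ^ 3)) r := by
    have h1 : HasDerivAt (fun r : ℝ => r ^ 2 + ‖x‖ ^ 2) (2 * r) r := by
      simpa using (hasDerivAt_pow 2 r).add_const (‖x‖ ^ 2)
    have hs := Real.sqrt_pos.2 (rad_sq_pos hr x)
    refine ((h1.sqrt (rad_sq_pos hr x).ne').inv hs.ne').congr_deriv ?_
    rw [invRad]
    field_simp
  refine (((hasDerivAt_id r).mul (hg.pow 3)).add (((hasDerivAt_pow 3 r).const_mul 3).mul
    (hg.pow 5))).congr_deriv ?_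
  simp only [radKernel, id, Pi.pow_apply]
  norm_num
  ring

theorem measurable_invRad : Measurable fun p : ℝ × Plane => invRad p.1 p.2 := by
  unfold invRad
  fun_prop

theorem measurable_radKernel : Measurable (Function.uncurry radKernel) := by
  have h := measurable_invRad
  change Measurable fun p : ℝ × Plane => radKernel p.1 p.2
  unfold radKernel
  fun_prop

theorem measurable_radDir (j : Fin 2) : Measurable (Function.uncurry fun r => radDir r j) := by
  have h := measurable_invRad
  change Measurable fun p : ℝ × Plane => radDir p.1 j p.2
  unfold radDir
  fun_prop

theorem abs_radKernel_le {ε r : ℝ} (hε : 0 < ε) (hr : ε ≤ r) (x : Plane) :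
    |radKernel r x| ≤ 22 * (ε⁻¹) ^ 3 := by
  have hr0 := hε.trans_le hr
  have hg := (invRad_pos hr0 x).le
  have h1 : invRad r x ≤ ε⁻¹ := (invRad_le hr0 x).trans (inv_anti₀ hε hr)
  have h2 := mul_invRad_le_one hr0 x
  have h0 : 0 ≤ r * invRad r x := by positivity
  have h3 : invRad r x ^ 3 ≤ (ε⁻¹) ^ 3 := pow_le_pow_left₀ hg h1 3
  have h4 := pow_le_one₀ (n := 2) h0 h2
  have h5 := pow_le_one₀ (n := 4) h0 h2
  have e : radKernel r x = -(invRad r x ^ 3 * (1 + 6 * (r * invRad r x) ^ 2 -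
      15 * (r * invRad r x) ^ 4)) := by
    rw [radKernel]
    ring
  rw [e, abs_neg, abs_mul, abs_of_nonneg (by positivity), mul_comm]
  refine mul_le_mul ?_ h3 (by positivity) (by norm_num)
  rw [abs_le]
  constructor <;> nlinarith [pow_nonneg h0 2, pow_nonneg h0 4]

theorem integral_radKernel {ε M : ℝ} (hε : 0 < ε) (hM : ε ≤ M) (x : Plane) :
    ∫ r in Set.Ioc ε M, radKernel r x = radPrim ε x - radPrim M x := by
  have hi : IntervalIntegrable (fun r => radKernel r x) volume ε M := by
    rw [intervalIntegrable_iff_integrableOn_Ioc_of_le hM]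
    refine (integrableOn_const (C := 22 * (ε⁻¹) ^ 3) measure_Ioc_lt_top.ne).mono'
      (measurable_radKernel.comp (measurable_id.prodMk measurable_const)).aestronglyMeasurable ?_
    exact (ae_restrict_mem measurableSet_Ioc).mono fun r hr => abs_radKernel_le hε hr.1.le x
  have h := intervalIntegral.integral_eq_sub_of_hasDerivAt (a := ε) (b := M)
    (f := fun r => -radPrim r x) (f' := fun r => radKernel r x)
    (fun r hr => by
      rw [Set.uIcc_of_le hM] at hr
      exact (hasDerivAt_radPrim (hε.trans_le hr.1) x).neg.congr_deriv (neg_neg _)) hi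
  rw [← intervalIntegral.integral_of_le hM, h]
  ring

instance (T : ℝ) : SFinite (slabMeasure T) := by
  unfold slabMeasure
  infer_instance

section SlabFubini

variable {T a b C : ℝ} {f g : ℝ → Plane → ℝ} {k : ℝ → Plane → ℝ}

theorem RegularDensity.integrable_slab_prod (hk : Measurable (Function.uncurry k))
    (hC : ∀ r ∈ Set.Ioc a b, ∀ z, |k r z| ≤ C) (hf : RegularDensity (Set.Icc 0 T) f)
    (hg : RegularDensity (Set.Icc 0 T) g) :
    Integrable (fun p : ℝ × ℝ × Plane × Plane =>
      k p.1 (p.2.2.1 - p.2.2.2) * (f p.2.1 p.2.2.1 * g p.2.1 p.2.2.2))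
      ((volume.restrict (Set.Ioc a b)).prod (slabMeasure T)) := by
  refine ((hf.integrable_tensor hg).comp_snd _).bdd_mul (c := C) ?_ ?_
  · exact (hk.comp (g := Function.uncurry k)
      (f := fun p : ℝ × ℝ × Plane × Plane => (p.1, p.2.2.1 - p.2.2.2))
      (by fun_prop)).aestronglyMeasurable
  · exact (Measure.quasiMeasurePreserving_fst.ae (ae_restrict_mem measurableSet_Ioc)).mono
      fun p hp => hC _ hp _

theorem RegularDensity.integrable_slabInteraction (hk : Measurable (Function.uncurry k))
    (hC : ∀ r ∈ Set.Ioc a b, ∀ z, |k r z| ≤ C) (hf : RegularDensity (Set.Icc 0 T) f)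
    (hg : RegularDensity (Set.Icc 0 T) g) :
    IntegrableOn (fun r => slabInteraction T (k r) f g) (Set.Ioc a b) :=
  (hf.integrable_slab_prod hk hC hg).integral_prod_left

theorem RegularDensity.integral_slabInteraction (hk : Measurable (Function.uncurry k))
    (hC : ∀ r ∈ Set.Ioc a b, ∀ z, |k r z| ≤ C) (hf : RegularDensity (Set.Icc 0 T) f)
    (hg : RegularDensity (Set.Icc 0 T) g) :
    ∫ r in Set.Ioc a b, slabInteraction T (k r) f g =
      slabInteraction T (fun z => ∫ r in Set.Ioc a b, k r z) f g := by
  unfold slabInteraction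
  rw [integral_integral_swap (hf.integrable_slab_prod hk hC hg)]
  simp only [integral_mul_const]

theorem RegularDensity.exists_abs_slabInteraction_le (hf : RegularDensity (Set.Icc 0 T) f)
    (hg : RegularDensity (Set.Icc 0 T) g) :
    ∃ K, ∀ h : Plane → ℝ, (∀ z, |h z| ≤ 1) → |slabInteraction T h f g| ≤ K := by
  refine ⟨∫ q, ‖f q.1 q.2.1 * g q.1 q.2.2‖ ∂slabMeasure T, fun h hh => ?_⟩
  rw [← Real.norm_eq_abs, slabInteraction]
  refine norm_integral_le_of_norm_le (hf.integrable_tensor hg).norm (.of_forall fun q => ?_)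
  rw [norm_mul]
  exact mul_le_of_le_one_left (norm_nonneg _) (hh _)

end SlabFubini

theorem norm_fderiv_le_sum_norm_pd (f : Plane → ℂ) (x : Plane) :
    ‖fderiv ℝ f x‖ ≤ ‖pd 0 f x‖ + ‖pd 1 f x‖ := by
  refine ContinuousLinearMap.opNorm_le_bound _ (by positivity) fun y => ?_
  have hy : y = y 0 • EuclideanSpace.single 0 1 + y 1 • EuclideanSpace.single 1 1 := by
    ext i
    fin_cases i <;> simp
  have h0 := abs_coord_le_norm y 0
  have h1 := abs_coord_le_norm y 1
  have e : fderiv ℝ f x y = y 0 • pd 0 f x + y 1 • pd 1 f x := by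
    conv_lhs => rw [hy]
    rw [map_add, map_smul, map_smul, pd, pd]
  rw [e]
  refine (norm_add_le _ _).trans ?_
  rw [norm_smul, norm_smul, Real.norm_eq_abs, Real.norm_eq_abs, add_mul]
  rw [mul_comm, mul_comm |y 1|]
  gcongr

theorem IsSchwartz.massDensity_sub_le {v : Plane → ℂ} (hv : IsSchwartz v) {A B D : ℝ}
    (hA : ∀ x, ‖v x‖ ≤ A) (hB : ∀ x, ‖_root_.pd 0 v x‖ ≤ B) (hD : ∀ x, ‖_root_.pd 1 v x‖ ≤ D)
    (x y : Plane) :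
    _root_.massDensity v x - _root_.massDensity v y ≤ 2 * A * (B + D) * ‖x - y‖ := by
  have h := Convex.norm_image_sub_le_of_norm_fderiv_le (𝕜 := ℝ) (f := v) (s := Set.univ)
    (C := B + D) (fun z _ => hv.differentiable z)
    (fun z _ => (norm_fderiv_le_sum_norm_pd v z).trans (add_le_add (hB z) (hD z))) convex_univ
    (Set.mem_univ y) (Set.mem_univ x)
  have h1 : ‖v x‖ - ‖v y‖ ≤ (B + D) * ‖x - y‖ := (norm_sub_norm_le _ _).trans h
  have h0 : 0 ≤ (B + D) * ‖x - y‖ := (norm_nonneg _).trans h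
  have hx := norm_nonneg (v x)
  have hy := norm_nonneg (v y)
  rw [_root_.massDensity, _root_.massDensity]
  have := mul_le_mul_of_nonneg_left h1 (add_nonneg hx hy)
  have := mul_le_mul_of_nonneg_right (add_le_add (hA x) (hA y)) h0
  linarith

theorem TimeRegular.exists_massDensity_sub_le {S : Set ℝ} {v : ℝ → Plane → ℂ}
    (hv : TimeRegular S 3 v) : ∃ L, 0 ≤ L ∧ ∀ t ∈ S, ∀ x y,
      _root_.massDensity (v t) x - _root_.massDensity (v t) y ≤ L * ‖x - y‖ := by
  obtain ⟨A, hA0, hA⟩ := hv.decay.exists_norm_le (by norm_num)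
  obtain ⟨B, hB0, hB⟩ := (TimeRegular.pd hv 0).decay.exists_norm_le le_rfl
  obtain ⟨D, hD0, hD⟩ := (TimeRegular.pd hv 1).decay.exists_norm_le le_rfl
  exact ⟨2 * A * (B + D), by positivity, fun t ht x y =>
    (hv.isSchwartz ht).massDensity_sub_le (hA t ht) (hB t ht) (hD t ht) x y⟩

theorem integral_radPrim_mul_ge {ρ : Plane → ℝ} (hρ : Integrable ρ) (h0 : ∀ x, 0 ≤ ρ x) {L : ℝ}
    (hL0 : 0 ≤ L) (hL : ∀ x y, ρ x - ρ y ≤ L * ‖x - y‖) {ε : ℝ} (hε : 0 < ε) (x : Plane) :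
    π / 4 * (ρ x ^ 2 - L * ε * ρ x) ≤ ∫ y, radPrim ε (x - y) * (ρ x * ρ y) := by
  obtain ⟨hc, C, hC⟩ := isBddCont_radPrim hε
  have hi : Integrable fun y => radPrim ε (x - y) * (ρ x * ρ y) :=
    (hρ.const_mul _).bdd_mul (c := C) (hc.comp (by fun_prop)).aestronglyMeasurable
      (.of_forall fun y => hC _)
  refine le_trans ?_ (setIntegral_le_integral (s := Metric.ball x ε) hi (.of_forall fun y =>
    mul_nonneg (radPrim_nonneg hε _) (mul_nonneg (h0 x) (h0 y))))
  have hm : volume.real (Metric.ball x ε) = π * ε ^ 2 := by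
    rw [Measure.real, EuclideanSpace.volume_ball_fin_two, ENNReal.toReal_mul, ENNReal.toReal_pow,
      ENNReal.toReal_ofReal hε.le, ENNReal.toReal_ofReal Real.pi_pos.le, mul_comm]
  calc π / 4 * (ρ x ^ 2 - L * ε * ρ x)
      = ∫ y in Metric.ball x ε, 1 / 4 * (ε⁻¹) ^ 2 * (ρ x * (ρ x - L * ε)) := by
        rw [setIntegral_const, hm, smul_eq_mul]
        field_simp
    _ ≤ _ := by
        refine setIntegral_mono_on (integrableOn_const measure_ball_lt_top.ne) hi.integrableOn
          measurableSet_ball fun y hy => ?_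
        have hy' : ‖x - y‖ ≤ ε := by
          rw [← dist_eq_norm, dist_comm]
          exact hy.le
        have h1 := mul_le_mul_of_nonneg_left hy' hL0
        have h2 := hL x y
        have h3 : ρ x * (ρ x - L * ε) ≤ ρ x * ρ y :=
          mul_le_mul_of_nonneg_left (by linarith) (h0 x)
        exact (mul_le_mul_of_nonneg_left h3 (by positivity)).trans
          (mul_le_mul_of_nonneg_right (le_radPrim hε hy') (mul_nonneg (h0 x) (h0 y)))

theorem interaction_radPrim_ge {ρ : Plane → ℝ} (hρ : Integrable ρ)
    (hρ2 : Integrable fun x => ρ x ^ 2) (h0 : ∀ x, 0 ≤ ρ x) {L : ℝ} (hL0 : 0 ≤ L)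
    (hL : ∀ x y, ρ x - ρ y ≤ L * ‖x - y‖) {ε : ℝ} (hε : 0 < ε) :
    π / 4 * ((∫ x, ρ x ^ 2) - L * ε * ∫ x, ρ x) ≤ interaction (radPrim ε) ρ ρ := by
  have hi := (isBddCont_radPrim hε).integrable_interaction hρ hρ
  rw [interaction, Measure.volume_eq_prod, integral_prod _ hi, ← integral_const_mul,
    ← integral_sub hρ2 (hρ.const_mul _), ← integral_const_mul]
  exact integral_mono ((hρ2.sub (hρ.const_mul _)).const_mul _) hi.integral_prod_left
    fun x => integral_radPrim_mul_ge hρ h0 hL0 hL hε x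

theorem interaction_radPrim_le {ρ : Plane → ℝ} (hρ : Integrable ρ) (h0 : ∀ x, 0 ≤ ρ x) {M : ℝ}
    (hM : 0 < M) : interaction (radPrim M) ρ ρ ≤ 4 * (M⁻¹) ^ 2 * (∫ x, ρ x) ^ 2 := by
  have hi := (isBddCont_radPrim hM).integrable_interaction hρ hρ
  have e : ∫ p : Plane × Plane, ρ p.1 * ρ p.2 = (∫ x, ρ x) ^ 2 := by
    rw [Measure.volume_eq_prod, integral_prod_mul, sq]
  rw [← e, ← integral_const_mul]
  exact integral_mono hi ((hρ.mul_prod hρ).const_mul _) fun p =>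
    mul_le_mul_of_nonneg_right (radPrim_le hM _) (mul_nonneg (h0 _) (h0 _))

namespace ForcedSchrodinger

variable {T M : ℝ} {v G : ℝ → Plane → ℂ}

theorem integrableOn_slabErr (h : ForcedSchrodinger T v G) :
    IntegrableOn (fun r => slabErr T (radDir r) v fun t x => G t x - cub (v t) x)
      (Set.Ioc 0 M) := by
  have hv3 := h.reg.mono (by norm_num : 3 ≤ 4)
  have hW := h.reg_commutator.mono (by norm_num : 3 ≤ 4)
  have hρ := (hv3.mono (by norm_num)).massDensity
  have hm := (hv3.mono (by norm_num)).massForce (hW.mono (by norm_num))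
  have hb : ∀ j, ∀ r ∈ Set.Ioc 0 M, ∀ z, |radDir r j z| ≤ 1 := fun j r hr z =>
    abs_radDir_le_one hr.1 j z
  exact integrable_finsetSum _ fun j _ =>
    ((hv3.momForce hW j).integrable_slabInteraction (measurable_radDir j) (hb j) hρ).add
      ((hv3.momDensity j).integrable_slabInteraction (measurable_radDir j) (hb j) hm)

theorem integral_slabErr (h : ForcedSchrodinger T v G) :
    ∫ r in Set.Ioc 0 M, slabErr T (radDir r) v (fun t x => G t x - cub (v t) x) =
      slabErr T (fun j z => ∫ r in Set.Ioc 0 M, radDir r j z) v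
        fun t x => G t x - cub (v t) x := by
  have hv3 := h.reg.mono (by norm_num : 3 ≤ 4)
  have hW := h.reg_commutator.mono (by norm_num : 3 ≤ 4)
  have hρ := (hv3.mono (by norm_num)).massDensity
  have hm := (hv3.mono (by norm_num)).massForce (hW.mono (by norm_num))
  have hb : ∀ j, ∀ r ∈ Set.Ioc 0 M, ∀ z, |radDir r j z| ≤ 1 := fun j r hr z =>
    abs_radDir_le_one hr.1 j z
  have i1 := fun j => (hv3.momForce hW j).integrable_slabInteraction (measurable_radDir j) (hb j) hρ
  have i2 := fun j => (hv3.momDensity j).integrable_slabInteraction (measurable_radDir j) (hb j) hm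
  unfold slabErr
  refine (integral_finsetSum _ fun j _ => (i1 j).add (i2 j)).trans
    (Finset.sum_congr rfl fun j _ => ?_)
  rw [← (hv3.momForce hW j).integral_slabInteraction (measurable_radDir j) (hb j) hρ,
    ← (hv3.momDensity j).integral_slabInteraction (measurable_radDir j) (hb j) hm]
  exact integral_add (i1 j) (i2 j)

theorem exists_abs_slabErr_le (h : ForcedSchrodinger T v G) :
    ∃ K, 0 ≤ K ∧ ∀ b : Fin 2 → Plane → ℝ, (∀ j z, |b j z| ≤ 1) →
      |slabErr T b v fun t x => G t x - cub (v t) x| ≤ K := by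
  have hv3 := h.reg.mono (by norm_num : 3 ≤ 4)
  have hW := h.reg_commutator.mono (by norm_num : 3 ≤ 4)
  have hρ := (hv3.mono (by norm_num)).massDensity
  have hm := (hv3.mono (by norm_num)).massForce (hW.mono (by norm_num))
  choose K hK using fun j => (hv3.momForce hW j).exists_abs_slabInteraction_le hρ
  choose K' hK' using fun j => (hv3.momDensity j).exists_abs_slabInteraction_le hm
  refine ⟨∑ j, (|K j| + |K' j|), by positivity, fun b hb => ?_⟩
  refine (Finset.abs_sum_le_sum_abs _ _).trans (Finset.sum_le_sum fun j _ => ?_)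
  exact (abs_add_le _ _).trans (add_le_add ((hK j _ (hb j)).trans (le_abs_self _))
    ((hK' j _ (hb j)).trans (le_abs_self _)))

end ForcedSchrodinger

theorem HdotNorm_nonneg (σ : ℝ) (f : Plane → ℂ) : 0 ≤ HdotNorm σ f :=
  Real.rpow_nonneg (integral_nonneg fun _ =>
    mul_nonneg (Real.rpow_nonneg (norm_nonneg _) _) (sq_nonneg _)) _

theorem L2Norm_nonneg (f : Plane → ℂ) : 0 ≤ L2Norm f :=
  Real.rpow_nonneg (integral_nonneg fun _ => sq_nonneg _) _

theorem RegularDensity.slabInteraction_sub {T : ℝ} {h h' : Plane → ℝ} {f g : ℝ → Plane → ℝ}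
    (hh : IsBddCont h) (hh' : IsBddCont h') (hf : RegularDensity (Set.Icc 0 T) f)
    (hg : RegularDensity (Set.Icc 0 T) g) :
    slabInteraction T (fun z => h z - h' z) f g =
      slabInteraction T h f g - slabInteraction T h' f g := by
  unfold slabInteraction
  rw [← integral_sub (hf.integrable_slab hh hg) (hf.integrable_slab hh' hg)]
  exact integral_congr_ae (.of_forall fun q => sub_mul _ _ _)

namespace ForcedSchrodinger

variable {T : ℝ} {v G : ℝ → Plane → ℂ}

theorem slabInteraction_radPrim_ge (h : ForcedSchrodinger T v G) (hT : 0 ≤ T) {m : ℝ}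
    (hm : ∀ t ∈ Set.Icc 0 T, ∫ x, massDensity (v t) x ≤ m) :
    ∃ L, 0 ≤ L ∧ ∀ ε, 0 < ε →
      π / 4 * (∫ t in Set.Ioc 0 T, ∫ x, massDensity (v t) x ^ 2) - L * ε ≤
        slabInteraction T (radPrim ε) (fun t => massDensity (v t)) fun t => massDensity (v t) := by
  obtain ⟨L, hL0, hL⟩ := (h.reg.mono (by norm_num : 3 ≤ 4)).exists_massDensity_sub_le
  have hρ := (h.reg.mono (by norm_num : 2 ≤ 4)).massDensity
  have hm0 : 0 ≤ m := (integral_nonneg fun x => massDensity_nonneg (v 0) x).trans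
    (hm 0 ⟨le_rfl, hT⟩)
  refine ⟨π / 4 * L * m * T, by have := Real.pi_pos; positivity, fun ε hε => ?_⟩
  have hi := hρ.integrable_interaction (isBddCont_radPrim hε) hρ
  have hc : Integrable (fun _ : ℝ => π / 4 * L * m * ε) (volume.restrict (Set.Ioc 0 T)) :=
    integrable_const _
  have key : ∫ t in Set.Ioc 0 T, π / 4 * ∫ x, massDensity (v t) x ^ 2 ≤
      ∫ t in Set.Ioc 0 T, (interaction (radPrim ε) (massDensity (v t)) (massDensity (v t)) +
        π / 4 * L * m * ε) := by
    refine integral_mono_of_nonneg (.of_forall fun t => ?_) (hi.add hc) ?_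
    · have := Real.pi_pos
      have h0 : 0 ≤ ∫ x, massDensity (v t) x ^ 2 := integral_nonneg fun x => sq_nonneg _
      change 0 ≤ π / 4 * ∫ x, massDensity (v t) x ^ 2
      positivity
    · refine (ae_restrict_mem measurableSet_Ioc).mono fun t ht => ?_
      have ht' := Set.Ioc_subset_Icc_self ht
      have hv := (h.reg.isSchwartz ht').massDensity
      have i2 : Integrable fun x => massDensity (v t) x ^ 2 :=
        (hv.mul hv).integrable.congr (.of_forall fun x => (sq _).symm)
      have h1 := interaction_radPrim_ge hv.integrable i2 (massDensity_nonneg (v t)) hL0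
        (hL t ht') hε
      have h2 : π / 4 * L * ε * ∫ x, massDensity (v t) x ≤ π / 4 * L * ε * m :=
        mul_le_mul_of_nonneg_left (hm t ht') (by have := Real.pi_pos; positivity)
      change π / 4 * ∫ x, massDensity (v t) x ^ 2 ≤ _ + _
      linarith
  rw [integral_const_mul, integral_add hi hc, setIntegral_const, Measure.real, Real.volume_Ioc,
    sub_zero, ENNReal.toReal_ofReal hT, smul_eq_mul, ← hρ.slabInteraction_eq
      (isBddCont_radPrim hε) hρ] at key
  linarith

theorem slabInteraction_radPrim_le (h : ForcedSchrodinger T v G) (hT : 0 ≤ T) {m M : ℝ}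
    (hm : ∀ t ∈ Set.Icc 0 T, ∫ x, massDensity (v t) x ≤ m) (hM : 0 < M) :
    slabInteraction T (radPrim M) (fun t => massDensity (v t)) (fun t => massDensity (v t)) ≤
      4 * (M⁻¹) ^ 2 * m ^ 2 * T := by
  have hρ := (h.reg.mono (by norm_num : 2 ≤ 4)).massDensity
  have hi := hρ.integrable_interaction (isBddCont_radPrim hM) hρ
  have hc : Integrable (fun _ : ℝ => 4 * (M⁻¹) ^ 2 * m ^ 2) (volume.restrict (Set.Ioc 0 T)) :=
    integrable_const _
  have key := setIntegral_mono_on hi hc measurableSet_Ioc fun t ht => by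
    have ht' := Set.Ioc_subset_Icc_self ht
    have hv := (h.reg.isSchwartz ht').massDensity
    refine (interaction_radPrim_le hv.integrable (massDensity_nonneg (v t)) hM).trans ?_
    exact mul_le_mul_of_nonneg_left (pow_le_pow_left₀ (integral_nonneg fun x =>
      massDensity_nonneg (v t) x) (hm t ht') 2) (by positivity)
  rw [setIntegral_const, Measure.real, Real.volume_Ioc, sub_zero, ENNReal.toReal_ofReal hT,
    smul_eq_mul, ← hρ.slabInteraction_eq (isBddCont_radPrim hM) hρ] at key
  linarith

theorem integral_sq_massDensity_le (h : ForcedSchrodinger T v G) (hT : 0 ≤ T) {m M S : ℝ}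
    (hM : 0 < M) (hm : ∀ t ∈ Set.Icc 0 T, ∫ x, massDensity (v t) x ≤ m)
    (hS : ∀ t ∈ Set.Icc 0 T, HdotNorm 1 (v t) * L2Norm (v t) ^ 3 ≤ S) :
    π / 8 * (∫ t in Set.Ioc 0 T, ∫ x, massDensity (v t) x ^ 2) ≤
      8 * π * S * M + 2 * (M⁻¹) ^ 2 * m ^ 2 * T +
        |∫ r in Set.Ioc 0 M, slabErr T (radDir r) v fun t x => G t x - cub (v t) x| := by
  have hpi := Real.pi_pos
  have h0 : (0 : ℝ) ∈ Set.Icc 0 T := ⟨le_rfl, hT⟩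
  have h1 : T ∈ Set.Icc 0 T := ⟨hT, le_rfl⟩
  have hS0 : 0 ≤ S := (mul_nonneg (HdotNorm_nonneg _ _) (pow_nonneg (L2Norm_nonneg _) 3)).trans
    (hS 0 h0)
  have hρ := (h.reg.mono (by norm_num : 2 ≤ 4)).massDensity
  obtain ⟨L, hL0, hL⟩ := h.slabInteraction_radPrim_ge hT hm
  obtain ⟨K, hK0, hK⟩ := h.exists_abs_slabErr_le
  have hR := h.slabInteraction_radPrim_le hT hm hM
  obtain ⟨e, he⟩ : ∃ e : ℝ → ℝ,
      e = fun r => slabErr T (radDir r) v fun t x => G t x - cub (v t) x := ⟨_, rfl⟩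
  have hei : IntegrableOn e (Set.Ioc 0 M) := he ▸ h.integrableOn_slabErr
  have key : ∀ ε, 0 < ε → ε ≤ M →
      π / 8 * (∫ t in Set.Ioc 0 T, ∫ x, massDensity (v t) x ^ 2) ≤
      8 * π * S * M + 2 * (M⁻¹) ^ 2 * m ^ 2 * T + |∫ r in Set.Ioc 0 M, e r| + (L + K) * ε := by
    intro ε hε hεM
    have hC : ∀ r ∈ Set.Ioc ε M, ∀ z, |radKernel r z| ≤ 22 * (ε⁻¹) ^ 3 := fun r hr z =>
      abs_radKernel_le hε hr.1.le z
    have i1 := hρ.integrable_slabInteraction measurable_radKernel hC hρ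
    have i2 : IntegrableOn e (Set.Ioc ε M) := hei.mono_set (Set.Ioc_subset_Ioc_left hε.le)
    have i3 : IntegrableOn e (Set.Ioc 0 ε) := hei.mono_set (Set.Ioc_subset_Ioc_right hεM)
    have i4 : IntegrableOn (fun _ : ℝ => 8 * π * S) (Set.Ioc ε M) := integrable_const _
    have hmono := setIntegral_mono_on ((i1.const_mul (1 / 2)).add i2) i4 measurableSet_Ioc
      fun r hr => by
        have hr0 := hε.trans hr.1
        have a1 := abs_le.1 ((h.reg.isSchwartz h0).abs_morAct_le hr0)
        have a2 := abs_le.1 ((h.reg.isSchwartz h1).abs_morAct_le hr0)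
        have b1 := mul_le_mul_of_nonneg_left (hS 0 h0) (by positivity : 0 ≤ 4 * π)
        have b2 := mul_le_mul_of_nonneg_left (hS T h1) (by positivity : 0 ≤ 4 * π)
        have := h.slab_le_morAct_sub hT hr0
        simp only [Pi.add_apply, he]
        linarith [a1.1, a2.2]
    rw [integral_add' (i1.const_mul (1 / 2)) i2, integral_const_mul,
      hρ.integral_slabInteraction measurable_radKernel hC hρ, setIntegral_const, Measure.real,
      Real.volume_Ioc, ENNReal.toReal_ofReal (sub_nonneg.2 hεM), smul_eq_mul] at hmono
    simp only [integral_radKernel hε hεM] at hmono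
    rw [hρ.slabInteraction_sub (isBddCont_radPrim hε) (isBddCont_radPrim hM) hρ] at hmono
    have hsplit : ∫ r in Set.Ioc 0 M, e r =
        (∫ r in Set.Ioc 0 ε, e r) + ∫ r in Set.Ioc ε M, e r := by
      rw [← setIntegral_union (Set.Ioc_disjoint_Ioc_of_le le_rfl) measurableSet_Ioc i3 i2,
        Set.Ioc_union_Ioc_eq_Ioc hε.le hεM]
    have hsmall : |∫ r in Set.Ioc 0 ε, e r| ≤ K * ε := by
      have := norm_setIntegral_le_of_norm_le_const (f := e) (s := Set.Ioc 0 ε) (C := K)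
        (μ := volume) measure_Ioc_lt_top fun r hr => by
          rw [he]
          exact hK _ fun j z => abs_radDir_le_one hr.1 j z
      rwa [Measure.real, Real.volume_Ioc, sub_zero, ENNReal.toReal_ofReal hε.le] at this
    have c1 := hL ε hε
    have c2 := neg_abs_le (∫ r in Set.Ioc 0 M, e r)
    have c3 := (abs_le.1 hsmall).2
    have c4 : (M - ε) * (8 * π * S) ≤ M * (8 * π * S) :=
      mul_le_mul_of_nonneg_right (by linarith) (by positivity)
    have c5 : 0 ≤ L * ε := by positivity
    linarith
  rw [← he]
  refine le_of_forall_pos_le_add fun δ hδ => ?_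
  have hLK : 0 ≤ L + K := add_nonneg hL0 hK0
  obtain ⟨ε, hε⟩ : ∃ ε, ε = min M (δ / (L + K + 1)) := ⟨_, rfl⟩
  have hε0 : 0 < ε := hε ▸ lt_min hM (by positivity)
  refine (key ε hε0 (hε ▸ min_le_left _ _)).trans ?_
  have : (L + K + 1) * ε ≤ δ := by
    have := mul_le_mul_of_nonneg_left (hε ▸ min_le_right M (δ / (L + K + 1)) : ε ≤ _)
      (by positivity : 0 ≤ L + K + 1)
    rwa [mul_div_cancel₀ _ (by positivity)] at this
  linarith

end ForcedSchrodinger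

/-- The weight `M⁻¹ ∫₀ᴹ √(r² + |z|²) dr`. -/
def avgWeight (M : ℝ) (z : Plane) : ℝ := M⁻¹ * ∫ r in Set.Ioc 0 M, √(r ^ 2 + ‖z‖ ^ 2)

/-- The components of the gradient of `avgWeight`. -/
def avgDir (M : ℝ) (j : Fin 2) (z : Plane) : ℝ := M⁻¹ * ∫ r in Set.Ioc 0 M, radDir r j z

theorem sqrt_sq_add_norm_sq_convex (r : ℝ) :
    ConvexOn ℝ Set.univ fun z : Plane => √(r ^ 2 + ‖z‖ ^ 2) := by
  refine ⟨convex_univ, fun x _ y _ a b ha hb hab => ?_⟩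
  obtain ⟨X, hX⟩ : ∃ X, X = √(r ^ 2 + ‖x‖ ^ 2) := ⟨_, rfl⟩
  obtain ⟨Y, hY⟩ : ∃ Y, Y = √(r ^ 2 + ‖y‖ ^ 2) := ⟨_, rfl⟩
  have hX0 : 0 ≤ X := hX ▸ Real.sqrt_nonneg _
  have hY0 : 0 ≤ Y := hY ▸ Real.sqrt_nonneg _
  have hX2 : X ^ 2 = r ^ 2 + ‖x‖ ^ 2 := hX ▸ Real.sq_sqrt (by positivity)
  have hY2 : Y ^ 2 = r ^ 2 + ‖y‖ ^ 2 := hY ▸ Real.sq_sqrt (by positivity)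
  have hXY : r ^ 2 + ‖x‖ * ‖y‖ ≤ X * Y := by
    refine abs_le_of_sq_le_sq' ?_ (mul_nonneg hX0 hY0) |>.2
    rw [mul_pow, hX2, hY2]
    nlinarith [sq_nonneg (r * (‖x‖ - ‖y‖))]
  have hn : ‖a • x + b • y‖ ≤ a * ‖x‖ + b * ‖y‖ := (norm_add_le _ _).trans_eq (by
    rw [norm_smul_of_nonneg ha, norm_smul_of_nonneg hb])
  change √(r ^ 2 + ‖a • x + b • y‖ ^ 2) ≤ a * √(r ^ 2 + ‖x‖ ^ 2) + b * √(r ^ 2 + ‖y‖ ^ 2)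
  rw [← hX, ← hY]
  refine Real.sqrt_le_iff.2 ⟨by positivity, ?_⟩
  have h1 := pow_le_pow_left₀ (norm_nonneg _) hn 2
  have h2 := mul_le_mul_of_nonneg_left hXY (mul_nonneg ha hb)
  have h3 : r ^ 2 = (a + b) ^ 2 * r ^ 2 := by rw [hab, one_pow, one_mul]
  have h4 : (a * X + b * Y) ^ 2 = a ^ 2 * X ^ 2 + 2 * (a * b * (X * Y)) + b ^ 2 * Y ^ 2 := by ring
  rw [h4, hX2, hY2]
  linarith

section AvgWeight

variable {M : ℝ}

theorem integrableOn_sqrt_sq_add_norm_sq (M : ℝ) (z : Plane) :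
    IntegrableOn (fun r : ℝ => √(r ^ 2 + ‖z‖ ^ 2)) (Set.Ioc 0 M) :=
  (by fun_prop : Continuous fun r : ℝ => √(r ^ 2 + ‖z‖ ^ 2)).integrableOn_Ioc

theorem convexOn_avgWeight (hM : 0 < M) : ConvexOn ℝ Set.univ (avgWeight M) := by
  refine ⟨convex_univ, fun x hx y hy a b ha hb hab => ?_⟩
  have hi := integrableOn_sqrt_sq_add_norm_sq M
  have h : ∫ r in Set.Ioc 0 M, √(r ^ 2 + ‖a • x + b • y‖ ^ 2) ≤
      ∫ r in Set.Ioc 0 M, (a * √(r ^ 2 + ‖x‖ ^ 2) + b * √(r ^ 2 + ‖y‖ ^ 2)) :=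
    integral_mono (hi _) (((hi x).const_mul a).add ((hi y).const_mul b)) fun r =>
      (sqrt_sq_add_norm_sq_convex r).2 hx hy ha hb hab
  rw [integral_add ((hi x).const_mul a) ((hi y).const_mul b), integral_const_mul,
    integral_const_mul] at h
  have := mul_le_mul_of_nonneg_left h (inv_nonneg.2 hM.le)
  simp only [avgWeight, smul_eq_mul]
  linarith

/-- The derivative of `z ↦ √(r² + |z|²)`. -/
def radDeriv (r : ℝ) (z : Plane) : Plane →L[ℝ] ℝ := invRad r z • innerSL ℝ z

theorem hasFDerivAt_sqrt_sq_add_norm_sq {r : ℝ} (hr : 0 < r) (z : Plane) :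
    HasFDerivAt (fun z : Plane => √(r ^ 2 + ‖z‖ ^ 2)) (radDeriv r z) z := by
  have h := ((hasStrictFDerivAt_norm_sq z).hasFDerivAt.const_add (r ^ 2)).sqrt
    (rad_sq_pos hr z).ne'
  refine h.congr_fderiv ?_
  ext y
  simp only [radDeriv, invRad, smul_apply, smul_eq_mul, nsmul_eq_mul]
  norm_num
  ring

theorem norm_radDeriv_le_one {r : ℝ} (hr : 0 < r) (z : Plane) : ‖radDeriv r z‖ ≤ 1 := by
  have hg := invRad_pos hr z
  rw [radDeriv, norm_smul, innerSL_apply_norm, Real.norm_of_nonneg hg.le]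
  refine (abs_le_of_sq_le_sq' ?_ zero_le_one).2
  rw [mul_pow, one_pow, ← invRad_sq hr z]
  exact mul_le_mul_of_nonneg_left (by nlinarith) (sq_nonneg _)

theorem continuous_radDeriv {r : ℝ} (hr : 0 < r) : Continuous (radDeriv r) :=
  (differentiable_invRad hr).continuous.smul (innerSL ℝ).continuous

theorem aestronglyMeasurable_radDeriv (z : Plane) (μ : Measure ℝ) :
    AEStronglyMeasurable (fun r => radDeriv r z) μ :=
  ((measurable_invRad.comp (measurable_id.prodMk
    measurable_const)).stronglyMeasurable.smul_const _).aestronglyMeasurable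

theorem hasFDerivAt_avgWeight (M : ℝ) (z : Plane) :
    HasFDerivAt (avgWeight M) (M⁻¹ • ∫ r in Set.Ioc 0 M, radDeriv r z) z := by
  have h := hasFDerivAt_integral_of_dominated_of_fderiv_le
    (μ := volume.restrict (Set.Ioc 0 M)) (F := fun z r => √(r ^ 2 + ‖z‖ ^ 2))
    (F' := fun z r => radDeriv r z) (x₀ := z) (s := Set.univ) (bound := fun _ => 1)
    Filter.univ_mem (.of_forall fun z =>
      (integrableOn_sqrt_sq_add_norm_sq M z).aestronglyMeasurable)
    (integrableOn_sqrt_sq_add_norm_sq M z) (aestronglyMeasurable_radDeriv z _)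
    ((ae_restrict_mem measurableSet_Ioc).mono fun r hr z _ => norm_radDeriv_le_one hr.1 z)
    (integrable_const _)
    ((ae_restrict_mem measurableSet_Ioc).mono fun r hr z _ =>
      hasFDerivAt_sqrt_sq_add_norm_sq hr.1 z)
  exact h.const_mul M⁻¹

theorem contDiff_avgWeight (M : ℝ) : ContDiff ℝ 1 (avgWeight M) := by
  rw [contDiff_one_iff_fderiv]
  refine ⟨fun z => (hasFDerivAt_avgWeight M z).differentiableAt, ?_⟩
  rw [funext fun z => (hasFDerivAt_avgWeight M z).fderiv]
  have hc : Continuous fun z => ∫ r in Set.Ioc 0 M, radDeriv r z := by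
    refine continuous_of_dominated (bound := fun _ => 1)
      (fun z => aestronglyMeasurable_radDeriv z _) (fun z => ?_) (integrable_const _) ?_
    · exact (ae_restrict_mem measurableSet_Ioc).mono fun r hr => norm_radDeriv_le_one hr.1 z
    · exact (ae_restrict_mem measurableSet_Ioc).mono fun r hr => continuous_radDeriv hr.1
  exact hc.const_smul M⁻¹

theorem norm_fderiv_avgWeight_le (hM : 0 < M) (z : Plane) : ‖fderiv ℝ (avgWeight M) z‖ ≤ 1 := by
  rw [(hasFDerivAt_avgWeight M z).fderiv, norm_smul, norm_inv, Real.norm_of_nonneg hM.le]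
  have h := norm_setIntegral_le_of_norm_le_const (f := fun r => radDeriv r z) (s := Set.Ioc 0 M)
    (C := 1) (μ := volume) measure_Ioc_lt_top fun r hr => norm_radDeriv_le_one hr.1 z
  rw [Measure.real, Real.volume_Ioc, sub_zero, ENNReal.toReal_ofReal hM.le, one_mul] at h
  rw [inv_mul_le_iff₀ hM, mul_one]
  exact h

theorem fderiv_avgWeight_single (M : ℝ) (z : Plane) (j : Fin 2) :
    fderiv ℝ (avgWeight M) z (EuclideanSpace.single j 1) = avgDir M j z := by
  have hi : Integrable (fun r => radDeriv r z) (volume.restrict (Set.Ioc 0 M)) :=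
    (integrable_const (1 : ℝ)).mono' (aestronglyMeasurable_radDeriv z _)
      ((ae_restrict_mem measurableSet_Ioc).mono fun r hr => norm_radDeriv_le_one hr.1 z)
  rw [(hasFDerivAt_avgWeight M z).fderiv, smul_apply,
    ContinuousLinearMap.integral_apply hi, avgDir, smul_eq_mul]
  congr 1
  refine integral_congr_ae (.of_forall fun r => ?_)
  simp [radDeriv, radDir, EuclideanSpace.inner_single_right, mul_comm]

theorem isBddCont_avgDir (hM : 0 < M) (j : Fin 2) : IsBddCont (avgDir M j) := by
  rw [← funext fun z => fderiv_avgWeight_single M z j]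
  refine ⟨((contDiff_avgWeight M).continuous_fderiv one_ne_zero).clm_apply continuous_const,
    1, fun z => ?_⟩
  refine (ContinuousLinearMap.le_opNorm _ _).trans ?_
  simpa using norm_fderiv_avgWeight_le hM z

theorem avgDir_neg (M : ℝ) (j : Fin 2) (z : Plane) : avgDir M j (-z) = -avgDir M j z := by
  simp only [avgDir, radDir_neg, integral_neg, mul_neg]

/-- The two-particle weight `(x, y) ↦ M⁻¹ ∫₀ᴹ √(r² + |x - y|²) dr`. -/
def pairWeight (M : ℝ) (p : Plane × Plane) : ℝ := avgWeight M (p.1 - p.2)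

/-- Subtraction on the plane as a continuous linear map. -/
def subCLM : Plane × Plane →L[ℝ] Plane :=
  ContinuousLinearMap.fst ℝ Plane Plane - ContinuousLinearMap.snd ℝ Plane Plane

theorem convexOn_pairWeight (hM : 0 < M) : ConvexOn ℝ Set.univ (pairWeight M) :=
  (convexOn_avgWeight hM).comp_linearMap (subCLM : Plane × Plane →ₗ[ℝ] Plane)

theorem contDiff_pairWeight (M : ℝ) : ContDiff ℝ 1 (pairWeight M) :=
  (contDiff_avgWeight M).comp subCLM.contDiff

theorem fderiv_pairWeight (M : ℝ) (p : Plane × Plane) :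
    fderiv ℝ (pairWeight M) p = (fderiv ℝ (avgWeight M) (p.1 - p.2)).comp subCLM :=
  (HasFDerivAt.comp p (((contDiff_avgWeight M).differentiable one_ne_zero) _).hasFDerivAt
    subCLM.hasFDerivAt).fderiv

theorem norm_fderiv_pairWeight_le (hM : 0 < M) (p : Plane × Plane) :
    ‖fderiv ℝ (pairWeight M) p‖ ≤ 2 := by
  rw [fderiv_pairWeight]
  refine (ContinuousLinearMap.opNorm_comp_le _ _).trans ?_
  have h : ‖subCLM‖ ≤ 2 := (norm_sub_le _ _).trans ((add_le_add
    (ContinuousLinearMap.norm_fst_le _ _ _) (ContinuousLinearMap.norm_snd_le _ _ _)).trans_eq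
    one_add_one_eq_two)
  have := mul_le_mul (norm_fderiv_avgWeight_le hM (p.1 - p.2)) h (norm_nonneg _) zero_le_one
  linarith

theorem fderiv_pairWeight_fst (M : ℝ) (p : Plane × Plane) (j : Fin 2) :
    fderiv ℝ (pairWeight M) p (EuclideanSpace.single j 1, 0) = avgDir M j (p.1 - p.2) := by
  rw [fderiv_pairWeight, ← fderiv_avgWeight_single]
  simp [subCLM]

theorem fderiv_pairWeight_snd (M : ℝ) (p : Plane × Plane) (j : Fin 2) :
    fderiv ℝ (pairWeight M) p (0, EuclideanSpace.single j 1) = -avgDir M j (p.1 - p.2) := by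
  rw [fderiv_pairWeight, ← fderiv_avgWeight_single]
  simp [subCLM]

end AvgWeight

theorem hasFDerivAt_comp_fst {f : Plane → ℂ} (hf : Differentiable ℝ f) (p : Plane × Plane) :
    HasFDerivAt (fun p : Plane × Plane => f p.1)
      ((fderiv ℝ f p.1).comp (ContinuousLinearMap.fst ℝ Plane Plane)) p :=
  HasFDerivAt.comp p (hf p.1).hasFDerivAt hasFDerivAt_fst

theorem hasFDerivAt_comp_snd {f : Plane → ℂ} (hf : Differentiable ℝ f) (p : Plane × Plane) :
    HasFDerivAt (fun p : Plane × Plane => f p.2)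
      ((fderiv ℝ f p.2).comp (ContinuousLinearMap.snd ℝ Plane Plane)) p :=
  HasFDerivAt.comp p (hf p.2).hasFDerivAt hasFDerivAt_snd

section Bracket

variable {W v : Plane → ℂ}

theorem bracketDir_fst (hW : Differentiable ℝ W) (hv : Differentiable ℝ v) (p : Plane × Plane)
    (j : Fin 2) :
    bracketDir (fun p => W p.1 * v p.2 + W p.2 * v p.1) (fun p => v p.1 * v p.2) p
        (EuclideanSpace.single j 1, 0) =
      momForce v W j p.1 * massDensity v p.2 + momDensity v j p.1 * massForce v W p.2 := by
  have hG := ((hasFDerivAt_comp_fst hv p).mul (hasFDerivAt_comp_snd hv p)).fderiv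
  have hF := (((hasFDerivAt_comp_fst hW p).mul (hasFDerivAt_comp_snd hv p)).add
    ((hasFDerivAt_comp_snd hW p).mul (hasFDerivAt_comp_fst hv p))).fderiv
  have eG : fderiv ℝ (fun p : Plane × Plane => v p.1 * v p.2) p (EuclideanSpace.single j 1, 0) =
      v p.2 * pd j v p.1 := by
    refine (DFunLike.congr_fun hG _).trans ?_
    simp [pd]
  have eF : fderiv ℝ (fun p : Plane × Plane => W p.1 * v p.2 + W p.2 * v p.1) p
      (EuclideanSpace.single j 1, 0) = v p.2 * pd j W p.1 + W p.2 * pd j v p.1 := by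
    refine (DFunLike.congr_fun hF _).trans ?_
    simp [pd]
  rw [bracketDir, eG, eF, massDensity, Complex.sq_norm, Complex.normSq_apply]
  simp only [momForce, momDensity, massForce, Complex.sub_re, Complex.add_re,
    Complex.mul_re, Complex.mul_im, Complex.conj_re, Complex.conj_im, Complex.add_im, map_add,
    map_mul]
  ring

theorem bracketDir_snd (hW : Differentiable ℝ W) (hv : Differentiable ℝ v) (p : Plane × Plane)
    (j : Fin 2) :
    bracketDir (fun p => W p.1 * v p.2 + W p.2 * v p.1) (fun p => v p.1 * v p.2) p
        (0, EuclideanSpace.single j 1) =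
      massDensity v p.1 * momForce v W j p.2 + massForce v W p.1 * momDensity v j p.2 := by
  have hG := ((hasFDerivAt_comp_fst hv p).mul (hasFDerivAt_comp_snd hv p)).fderiv
  have hF := (((hasFDerivAt_comp_fst hW p).mul (hasFDerivAt_comp_snd hv p)).add
    ((hasFDerivAt_comp_snd hW p).mul (hasFDerivAt_comp_fst hv p))).fderiv
  have eG : fderiv ℝ (fun p : Plane × Plane => v p.1 * v p.2) p (0, EuclideanSpace.single j 1) =
      v p.1 * pd j v p.2 := by
    refine (DFunLike.congr_fun hG _).trans ?_
    simp [pd]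
  have eF : fderiv ℝ (fun p : Plane × Plane => W p.1 * v p.2 + W p.2 * v p.1) p
      (0, EuclideanSpace.single j 1) = W p.1 * pd j v p.2 + v p.1 * pd j W p.2 := by
    refine (DFunLike.congr_fun hF _).trans ?_
    simp [pd]
  rw [bracketDir, eG, eF, massDensity, Complex.sq_norm, Complex.normSq_apply]
  simp only [momForce, momDensity, massForce, Complex.sub_re, Complex.add_re,
    Complex.mul_re, Complex.mul_im, Complex.conj_re, Complex.conj_im, Complex.add_im, map_add,
    map_mul]
  ring

theorem IsSchwartz.integral_bracket_eq (hW : IsSchwartz W) (hv : IsSchwartz v) {M : ℝ}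
    (hM : 0 < M) :
    ∫ p, ((∑ j, fderiv ℝ (pairWeight M) p (EuclideanSpace.single j 1, 0) *
        bracketDir (fun p => W p.1 * v p.2 + W p.2 * v p.1) (fun p => v p.1 * v p.2) p
          (EuclideanSpace.single j 1, 0)) +
      ∑ j, fderiv ℝ (pairWeight M) p (0, EuclideanSpace.single j 1) *
        bracketDir (fun p => W p.1 * v p.2 + W p.2 * v p.1) (fun p => v p.1 * v p.2) p
          (0, EuclideanSpace.single j 1)) = 2 * morErr (avgDir M) v W := by
  have hb := fun j => isBddCont_avgDir hM j
  have hρ := hv.massDensity.integrable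
  have hm := (hv.massForce hW).integrable
  have hP := fun j => (hv.momDensity j).integrable
  have hF := fun j => (hv.momForce hW j).integrable
  simp only [fderiv_pairWeight_fst, fderiv_pairWeight_snd,
    bracketDir_fst hW.differentiable hv.differentiable,
    bracketDir_snd hW.differentiable hv.differentiable, mul_add]
  have i1 := fun j => (hb j).integrable_interaction (hF j) hρ
  have i2 := fun j => (hb j).integrable_interaction (hP j) hm
  have i3 := fun j => (hb j).neg.integrable_interaction hρ (hF j)
  have i4 := fun j => (hb j).neg.integrable_interaction hm (hP j)
  refine (integral_add (integrable_finsetSum _ fun j _ => (i1 j).add (i2 j))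
    (integrable_finsetSum _ fun j _ => (i3 j).add (i4 j))).trans ?_
  have e1 := (integral_finsetSum Finset.univ fun j _ => (i1 j).add (i2 j)).trans
    (Finset.sum_congr rfl fun j _ => integral_add (i1 j) (i2 j))
  have e2 := (integral_finsetSum Finset.univ fun j _ => (i3 j).add (i4 j)).trans
    (Finset.sum_congr rfl fun j _ => integral_add (i3 j) (i4 j))
  refine (congrArg₂ (· + ·) e1 e2).trans ?_
  have hs : ∀ (j : Fin 2) (f g : Plane → ℝ), interaction (fun z => -avgDir M j z) f g =
      interaction (avgDir M j) g f := fun j f g => by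
    rw [interaction_swap]
    simp only [avgDir_neg, neg_neg]
  have hs1 := fun j => hs j (_root_.massDensity v) (_root_.momForce v W j)
  have hs2 := fun j => hs j (_root_.massForce v W) (_root_.momDensity v j)
  simp only [interaction] at hs1 hs2
  simp only [hs1, hs2, morErr, interaction]
  ring

end Bracket

theorem morErr_const_mul (c : ℝ) (h : Fin 2 → Plane → ℝ) (v W : Plane → ℂ) :
    morErr (fun j z => c * h j z) v W = c * morErr h v W := by
  simp only [morErr, interaction, mul_assoc, integral_const_mul, Finset.mul_sum, mul_add]

theorem mul_avgDir {M : ℝ} (hM : 0 < M) :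
    (fun j z => ∫ r in Set.Ioc 0 M, radDir r j z) = fun j z => M * avgDir M j z := by
  ext j z
  rw [avgDir, mul_inv_cancel_left₀ hM.ne']

theorem ForcedSchrodinger.integral_slabErr_eq {T : ℝ} {v G : ℝ → Plane → ℂ}
    (h : ForcedSchrodinger T v G) {M : ℝ} (hM : 0 < M) :
    ∫ r in Set.Ioc 0 M, slabErr T (radDir r) v (fun t x => G t x - cub (v t) x) =
      M * ∫ t in Set.Ioc 0 T, morErr (avgDir M) (v t) fun x => G t x - cub (v t) x := by
  rw [h.integral_slabErr, mul_avgDir hM,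
    h.slabErr_eq fun j => (IsBddCont.const M).mul (isBddCont_avgDir hM j)]
  simp only [morErr_const_mul, integral_const_mul]

theorem ForcedSchrodinger.integral_bracket_eq {T : ℝ} {v G : ℝ → Plane → ℂ}
    (h : ForcedSchrodinger T v G) {M : ℝ} (hM : 0 < M) {t : ℝ} (ht : t ∈ Set.Icc 0 T) :
    ∫ p, ((∑ j, fderiv ℝ (pairWeight M) p (EuclideanSpace.single j 1, 0) *
        bracketDir (fun p => (G t p.1 - cub (v t) p.1) * v t p.2 +
            (G t p.2 - cub (v t) p.2) * v t p.1) (fun p => v t p.1 * v t p.2) p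
          (EuclideanSpace.single j 1, 0)) +
      ∑ j, fderiv ℝ (pairWeight M) p (0, EuclideanSpace.single j 1) *
        bracketDir (fun p => (G t p.1 - cub (v t) p.1) * v t p.2 +
            (G t p.2 - cub (v t) p.2) * v t p.1) (fun p => v t p.1 * v t p.2) p
          (0, EuclideanSpace.single j 1)) =
      2 * morErr (avgDir M) (v t) fun x => G t x - cub (v t) x :=
  (h.reg_commutator.isSchwartz ht).integral_bracket_eq (h.reg.isSchwartz ht) hM

theorem L2Norm_sq (f : Plane → ℂ) : L2Norm f ^ 2 = ∫ x, ‖f x‖ ^ 2 := by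
  rw [L2Norm, ← Real.sqrt_eq_rpow, Real.sq_sqrt (integral_nonneg fun _ => sq_nonneg _)]

theorem ForcedSchrodinger.bddAbove {T : ℝ} {v G : ℝ → Plane → ℂ}
    (h : ForcedSchrodinger T v G) :
    ∃ B, 0 ≤ B ∧ ∀ t ∈ Set.Icc 0 T, HdotNorm 1 (v t) * L2Norm (v t) ^ 3 ≤ B := by
  obtain ⟨A, hA, hA'⟩ := h.reg.decay.exists_integral_norm_sq_le (by norm_num)
  choose D hD hD' using fun j => (h.reg.pd j).decay.exists_integral_norm_sq_le (by norm_num)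
  refine ⟨√(∑ j, D j) * √A ^ 3, by positivity, fun t ht => ?_⟩
  have hH := HdotNorm_nonneg 1 (v t)
  have hL := L2Norm_nonneg (v t)
  refine mul_le_mul (Real.le_sqrt_of_sq_le ?_) (pow_le_pow_left₀ hL (Real.le_sqrt_of_sq_le ?_) 3)
    (by positivity) (Real.sqrt_nonneg _)
  · have e := (h.reg.isSchwartz ht).sum_integral_norm_sq_pd
    have : (2 * π * HdotNorm 1 (v t)) ^ 2 ≤ ∑ j, D j := by
      rw [← e]
      exact Finset.sum_le_sum fun j _ => hD' j t ht
    refine le_trans ?_ this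
    refine pow_le_pow_left₀ hH ?_ 2
    nlinarith [Real.pi_gt_three]
  · rw [L2Norm_sq]
    exact hA' t ht

theorem ForcedSchrodinger.le_iSup {T : ℝ} {v G : ℝ → Plane → ℂ}
    (h : ForcedSchrodinger T v G) {t : ℝ} (ht : t ∈ Set.Icc 0 T) :
    HdotNorm 1 (v t) * L2Norm (v t) ^ 3 ≤
      ⨆ t ∈ Set.Icc (0 : ℝ) T, HdotNorm 1 (v t) * L2Norm (v t) ^ 3 := by
  obtain ⟨B, hB, hB'⟩ := h.bddAbove
  refine le_ciSup_of_le ⟨B, ?_⟩ t ?_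
  · rintro _ ⟨t, rfl⟩
    exact Real.iSup_le (fun ht => hB' t ht) hB
  · rw [ciSup_pos ht]

theorem integral_norm_pow_four_le {s N T : ℝ} {Ck : ℕ → ℝ} {φ : ℝ → ℝ} {u : ℝ → Plane → ℂ}
    (hu : IsNLSSolution 2 T u) (h : IMultiplier s N Ck φ) (hs : s < 1) (hN : 1 ≤ N) (hT : 0 < T)
    {M : ℝ} (hM : 0 < M) :
    π / 8 * (∫ t in Set.Ioc 0 T, ∫ x, ‖Iop φ (u t) x‖ ^ 4) ≤
      8 * π * (⨆ t ∈ Set.Icc (0 : ℝ) T,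
          HdotNorm 1 (Iop φ (u t)) * L2Norm (Iop φ (u t)) ^ 3) * M +
        2 * (M⁻¹) ^ 2 * (L2Norm (u 0) ^ 2) ^ 2 * T +
        M / 2 * |∫ t in Set.Ioc 0 T, ∫ p, errDensity (pairWeight M) φ u t p| := by
  have hv := hu.forcedSchrodinger h hs hN
  have hm : ∀ t ∈ Set.Icc 0 T, ∫ x, massDensity (Iop φ (u t)) x ≤ L2Norm (u 0) ^ 2 := by
    intro t ht
    refine (h.integral_norm_sq_Iop_le hs hN (hu.2.1 t ht)).trans_eq ?_
    rw [L2Norm_sq]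
    exact hu.mass_eq le_rfl ht.1 ht.2 (hu.uniformDecay.mono_set (Set.Icc_subset_Icc_right ht.2))
  have key := hv.integral_sq_massDensity_le hT.le hM hm fun t ht => hv.le_iSup ht
  have e4 : ∀ t x, massDensity (Iop φ (u t)) x ^ 2 = ‖Iop φ (u t) x‖ ^ 4 := fun t x => by
    rw [massDensity, ← pow_mul]
  have eE : ∫ t in Set.Ioc 0 T, ∫ p, errDensity (pairWeight M) φ u t p =
      2 * ∫ t in Set.Ioc 0 T, morErr (avgDir M) (Iop φ (u t)) fun x =>
        Iop φ (cub (u t)) x - cub (Iop φ (u t)) x := by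
    rw [← integral_const_mul]
    exact setIntegral_congr_fun measurableSet_Ioc fun t ht =>
      hv.integral_bracket_eq hM (Set.Ioc_subset_Icc_self ht)
  simp only [e4] at key
  rw [hv.integral_slabErr_eq hM, abs_mul, abs_of_pos hM] at key
  rw [eE, abs_mul, abs_of_pos (two_pos : (0 : ℝ) < 2)]
  linarith

theorem pi_div_eight_absorb {A S m M E : ℝ} (hS : 0 ≤ S) (hm : 0 ≤ m) (hM : 0 < M) (hE : 0 ≤ E)
    (h : π / 8 * A ≤ 8 * π * S * M + 2 * M * m + M / 2 * E) :
    A ≤ 100 * M * (S + m) + 100 * M * E := by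
  have h3 := Real.pi_gt_three
  have hMS : 0 ≤ M * S := by positivity
  have hMm : 0 ≤ M * m := by positivity
  have hME : 0 ≤ M * E := by positivity
  have hp : 0 < π / 8 := by positivity
  refine le_of_mul_le_mul_left (h.trans ?_) hp
  nlinarith [mul_nonneg (sub_nonneg.2 h3.le) hMm, mul_nonneg (sub_nonneg.2 h3.le) hME,
    mul_nonneg (sub_nonneg.2 h3.le) hMS]

/-- The almost interaction Morawetz estimate for `I_N u` in two dimensions,
with the error given by the momentum bracket of the bad nonlinearity. -/
theorem almost_morawetz_2d :
    ∃ C > (0:ℝ), ∀ T > (0:ℝ),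
      ∃ a : EuclideanSpace ℝ (Fin 2) × EuclideanSpace ℝ (Fin 2) → ℝ,
        ConvexOn ℝ Set.univ a ∧ ContDiff ℝ 1 a ∧ (∀ p, ‖fderiv ℝ a p‖ ≤ 100) ∧
        ∀ s : ℝ, 0 < s → s < 1 → ∀ N : ℝ, 1 ≤ N → ∀ Ck : ℕ → ℝ, ∀ φ : ℝ → ℝ,
          IMultiplier s N Ck φ →
          ∀ u : ℝ → EuclideanSpace ℝ (Fin 2) → ℂ, IsNLSSolution 2 T u →
            (∫ t in Set.Ioc (0:ℝ) T, ∫ x, ‖Iop φ (u t) x‖ ^ 4)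
              ≤ C * T ^ ((1:ℝ)/3) *
                  ((⨆ t ∈ Set.Icc (0:ℝ) T,
                      HdotNorm 1 (Iop φ (u t)) * (L2Norm (Iop φ (u t))) ^ 3)
                    + (L2Norm (u 0)) ^ 4)
                + C * T ^ ((1:ℝ)/3) *
                  |∫ t in Set.Ioc (0:ℝ) T, ∫ p, errDensity a φ u t p| := by
  refine ⟨100, by norm_num, fun T hT => ?_⟩
  have hM : 0 < T ^ ((1 : ℝ) / 3) := Real.rpow_pos_of_pos hT _
  refine ⟨pairWeight (T ^ ((1 : ℝ) / 3)), convexOn_pairWeight hM, contDiff_pairWeight _,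
    fun p => (norm_fderiv_pairWeight_le hM p).trans (by norm_num),
    fun s _ hs1 N hN Ck φ hφ u hu => ?_⟩
  have key := integral_norm_pow_four_le hu hφ hs1 hN hT hM
  have hM3 : (T ^ ((1 : ℝ) / 3)) ^ 3 = T := by
    rw [← Real.rpow_natCast, ← Real.rpow_mul hT.le]
    norm_num
  refine pi_div_eight_absorb (Real.iSup_nonneg fun t => Real.iSup_nonneg fun _ =>
    mul_nonneg (HdotNorm_nonneg _ _) (pow_nonneg (L2Norm_nonneg _) 3))
    (pow_nonneg (L2Norm_nonneg _) 4) hM (abs_nonneg _) (key.trans_eq ?_)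
  have e : 2 * ((T ^ ((1 : ℝ) / 3))⁻¹) ^ 2 * (L2Norm (u 0) ^ 2) ^ 2 * T =
      2 * T ^ ((1 : ℝ) / 3) * L2Norm (u 0) ^ 4 := by
    nth_rewrite 2 [← hM3]
    field_simp
  rw [e]

end
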